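/- arXiv:1902.07733 — 6 statements merged into one kernel-verified Lean document; each statement's English description precedes it below -/
import Mathlib

section
/- Let f : ℝⁿ → ℝⁿ be piecewise affine with pieces (f_i, C_i), i = 1,…,N. If f is locally injective (every point of ℝⁿ has an open neighborhood on which f is injective), then f is a homeomorphism of ℝⁿ onto ℝⁿ. -/
/-- `Eu n` is the Euclidean space `ℝⁿ`. -/
noncomputable abbrev Eu (n : ℕ) := EuclideanSpace ℝ (Fin n)

/-- A closed convex polyhedron in `ℝⁿ`: a finite intersection of closed half-spaces. -/
def IsPolyhedron {n : ℕ} (C : Set (Eu n)) : Prop :=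
  ∃ (m : ℕ) (l : Fin m → (Eu n →ₗ[ℝ] ℝ)) (c : Fin m → ℝ),
    C = {x | ∀ i, l i x ≤ c i}

/-- `f : ℝⁿ → ℝⁿ` is piecewise affine with pieces `(F i, C i)`, `i : Fin N`:
each `F i` is an affine map, each `C i` is a closed convex polyhedron with nonempty
interior, the `C i` cover `ℝⁿ`, their interiors are pairwise disjoint, and `f`
agrees with `F i` on `C i`. -/
def IsPiecewiseAffine {n N : ℕ} (f : Eu n → Eu n)
    (F : Fin N → (Eu n →ᵃ[ℝ] Eu n)) (C : Fin N → Set (Eu n)) : Prop :=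
  (∀ i, IsPolyhedron (C i)) ∧
  (∀ i, (interior (C i)).Nonempty) ∧
  (⋃ i, C i) = Set.univ ∧
  (∀ i j, i ≠ j → interior (C i) ∩ interior (C j) = ∅) ∧
  (∀ i, ∀ x ∈ C i, f x = F i x)

open Topology Filter Set

namespace PAHomeo

/-- One side of a point lying on at most one wall is contained in a single piece. -/
lemma side {n N : ℕ} (C : Fin N → Set (Eu n)) (hcov : (⋃ i, C i) = Set.univ)
    (m : Fin N → ℕ) (l : ∀ i, Fin (m i) → (Eu n →ₗ[ℝ] ℝ)) (c : ∀ i, Fin (m i) → ℝ)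
    (hC : ∀ i, C i = {x | ∀ k, l i k x ≤ c i k})
    (x : Eu n) (l0 : Eu n →ₗ[ℝ] ℝ) (v : Eu n) (hv : 0 < l0 v)
    (hgood : ∀ i k, l i k x = c i k → ∃ t : ℝ, l i k = t • l0) :
    ∃ i, ∀ᶠ y in 𝓝 x, 0 ≤ l0 (y - x) → y ∈ C i := by
  have hcont : ∀ L : Eu n →ₗ[ℝ] ℝ, Continuous L := fun L => L.continuous_of_finiteDimensional
  have htend : Tendsto (fun ε : ℝ => x + ε • v) (𝓝[>] 0) (𝓝 x) := by
    have : Continuous (fun ε : ℝ => x + ε • v) := by fun_prop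
    have h := this.tendsto 0
    simp only [zero_smul, add_zero] at h
    exact h.mono_left nhdsWithin_le_nhds
  have hclosed : ∀ i, IsClosed (C i) := by
    intro i
    rw [hC i, Set.ofPred_forall]
    exact isClosed_iInter fun k => isClosed_le (hcont _) continuous_const
  obtain ⟨i, hi⟩ : ∃ i, ∃ᶠ ε in 𝓝[>] (0:ℝ), x + ε • v ∈ C i := by
    by_contra hne
    push Not at hne
    have h1 : ∀ᶠ ε in 𝓝[>] (0:ℝ), ∀ i, x + ε • v ∉ C i := by
      rw [eventually_all]
      intro i
      exact hne i
    obtain ⟨ε, hε⟩ := h1.exists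
    have : x + ε • v ∈ ⋃ i, C i := by rw [hcov]; trivial
    obtain ⟨i, h⟩ := Set.mem_iUnion.1 this
    exact hε i h
  have hx : x ∈ C i := (hclosed i).mem_of_frequently_of_tendsto hi htend
  have hx' : ∀ k, l i k x ≤ c i k := by
    rw [hC i] at hx; exact hx
  refine ⟨i, ?_⟩
  have key : ∀ k, ∀ᶠ y in 𝓝 x, 0 ≤ l0 (y - x) → l i k y ≤ c i k := by
    intro k
    rcases lt_or_eq_of_le (hx' k) with h | h
    · filter_upwards [(hcont (l i k)).continuousAt.eventually_lt continuousAt_const h] with y hy _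
      exact hy.le
    · obtain ⟨t, ht⟩ := hgood i k h
      obtain ⟨ε, hε, hpos⟩ := (hi.and_eventually self_mem_nhdsWithin).exists
      have hpos' : 0 < ε := hpos
      rw [hC i] at hε
      have h1 := hε k
      rw [map_add, h, map_smul, ht] at h1
      simp only [LinearMap.smul_apply, smul_eq_mul] at h1
      have h2 : t * (ε * l0 v) ≤ 0 := by nlinarith
      have ht0 : t ≤ 0 := by
        by_contra hh
        push Not at hh
        have := mul_pos hh (mul_pos hpos' hv)
        linarith
      refine Eventually.of_forall fun y hy => ?_
      have h3 : l i k y = l i k x + l i k (y - x) := by rw [← map_add]; congr 1; abel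
      rw [h3, h, ht]
      simp only [LinearMap.smul_apply, smul_eq_mul]
      nlinarith
  filter_upwards [eventually_all.2 key] with y hy h0
  rw [hC i]
  exact fun k => hy k h0

/-- Gluing two affine isomorphisms along a hyperplane, injectively, gives a map open at `x`. -/
lemma open_of_two {n : ℕ} (f : Eu n → Eu n) (A B : Eu n ≃ᵃ[ℝ] Eu n) (x : Eu n)
    (l0 : Eu n →ₗ[ℝ] ℝ) (v : Eu n) (hv : 0 < l0 v)
    (hA : ∀ᶠ y in 𝓝 x, 0 ≤ l0 (y - x) → f y = A y)
    (hB : ∀ᶠ y in 𝓝 x, l0 (y - x) ≤ 0 → f y = B y)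
    (U : Set (Eu n)) (hU : U ∈ 𝓝 x) (hinj : Set.InjOn f U) :
    ∀ S ∈ 𝓝 x, f '' S ∈ 𝓝 (f x) := by
  have hray : ∀ w : Eu n, Tendsto (fun ε : ℝ => x + ε • w) (𝓝[>] 0) (𝓝 x) := by
    intro w
    have : Continuous (fun ε : ℝ => x + ε • w) := by fun_prop
    have h := this.tendsto 0
    simp only [zero_smul, add_zero] at h
    exact h.mono_left nhdsWithin_le_nhds
  have hAx : f x = A x := hA.self_of_nhds (by simp)
  have hBx : f x = B x := hB.self_of_nhds (by simp)
  have hAlin : ∀ w, A (x + w) = A x + A.linear w := by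
    intro w
    have := A.map_vadd x w
    simpa [add_comm] using this
  have hBlin : ∀ w, B (x + w) = B x + B.linear w := by
    intro w
    have := B.map_vadd x w
    simpa [add_comm] using this
  have hker : ∀ w, l0 w = 0 → A.linear w = B.linear w := by
    intro w hw
    obtain ⟨ε, ⟨h1, h2⟩, hε⟩ :=
      ((((hray w).eventually hA).and ((hray w).eventually hB)).and self_mem_nhdsWithin).exists
    have hε' : ε ≠ 0 := ne_of_gt hε
    have e1 := h1 (by simp [hw])
    have e2 := h2 (by simp [hw])
    rw [e1, hAlin, hBlin, ← hAx, ← hBx, map_smul, map_smul] at e2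
    exact smul_right_injective _ hε' (add_left_cancel e2)
  -- the transition map
  set M : Eu n ≃ₗ[ℝ] Eu n := B.linear.trans A.linear.symm with hM
  have hMker : ∀ w, l0 w = 0 → M w = w := by
    intro w hw
    simp [hM, ← hker w hw]
  have hAM : ∀ w, A.linear (M w) = B.linear w := by intro w; simp [hM]
  set s : ℝ := l0 (M v) / l0 v with hs
  have hMl : ∀ u, l0 (M u) = s * l0 u := by
    intro u
    have h0 : l0 (u - (l0 u / l0 v) • v) = 0 := by
      simp; field_simp; ring
    have h1 := hMker _ h0
    have h2 := congrArg l0 h1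
    rw [h0, map_sub, map_smul, map_sub, map_smul, smul_eq_mul] at h2
    rw [hs]; field_simp; field_simp at h2; linarith
  have hs0 : s ≠ 0 := by
    intro h
    have h1 : l0 (M v) = 0 := by rw [hMl, h, zero_mul]
    have h2 := M.injective (hMker _ h1)
    rw [h2] at h1
    linarith
  have hspos : 0 < s := by
    by_contra hneg
    have hneg : s < 0 := lt_of_le_of_ne (not_lt.1 hneg) hs0
    have t1 := hray (-v)
    have t2 := hray (-(M v))
    obtain ⟨ε, ⟨⟨⟨h1, h2⟩, h3⟩, h4⟩, hε⟩ :=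
      (((((t2.eventually hA).and (t1.eventually hB)).and (t1.eventually hU)).and
        (t2.eventually hU)).and self_mem_nhdsWithin).exists
    have hε' : 0 < ε := hε
    have hMv : l0 (M v) < 0 := by rw [hMl]; exact mul_neg_of_neg_of_pos hneg hv
    have e1 := h1 (by simp; nlinarith)
    have e2 := h2 (by simp; nlinarith)
    have e3 : f (x + ε • -(M v)) = f (x + ε • -v) := by
      rw [e1, e2, hAlin, hBlin, ← hAx, ← hBx]
      simp [hAM]
    have e4 := add_left_cancel (hinj h4 h3 e3)
    have e5 := congrArg l0 (smul_right_injective _ hε'.ne' e4)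
    simp at e5
    linarith
  intro S hS
  have cA : Tendsto (fun z => A.symm z) (𝓝 (f x)) (𝓝 x) := by
    have : Continuous A.symm := A.symm.toAffineMap.continuous_of_finiteDimensional
    have h := this.tendsto (f x)
    rwa [hAx, AffineEquiv.symm_apply_apply, ← hAx] at h
  have cB : Tendsto (fun z => B.symm z) (𝓝 (f x)) (𝓝 x) := by
    have : Continuous B.symm := B.symm.toAffineMap.continuous_of_finiteDimensional
    have h := this.tendsto (f x)
    rwa [hBx, AffineEquiv.symm_apply_apply, ← hBx] at h
  filter_upwards [cA.eventually hA, cB.eventually hB, cA.eventually hS, cB.eventually hS]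
    with z z1 z2 z3 z4
  by_cases h : 0 ≤ l0 (A.symm z - x)
  · exact ⟨_, z3, by rw [z1 h]; simp⟩
  · refine ⟨_, z4, ?_⟩
    rw [z2]
    · simp
    push Not at h
    have ea := hAlin (A.symm z - x)
    have eb := hBlin (B.symm z - x)
    rw [add_sub_cancel, AffineEquiv.apply_symm_apply, ← hAx] at ea
    rw [add_sub_cancel, AffineEquiv.apply_symm_apply, ← hBx, ← hAM] at eb
    have e6 := A.linear.injective (add_left_cancel (ea.symm.trans eb))
    rw [e6, hMl] at h
    by_contra h7
    push Not at h7
    have := mul_pos hspos h7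
    linarith

lemma dense_ne {n : ℕ} (φ : Eu n →ᵃ[ℝ] ℝ) (hφ : φ.linear ≠ 0) : Dense {x | φ x ≠ 0} := by
  obtain ⟨v, hv⟩ : ∃ v, φ.linear v ≠ 0 := by
    by_contra h
    push Not at h
    exact hφ (LinearMap.ext h)
  intro x
  by_cases hx : φ x = 0
  · have hray : Tendsto (fun ε : ℝ => x + ε • v) (𝓝[>] 0) (𝓝 x) := by
      have : Continuous (fun ε : ℝ => x + ε • v) := by fun_prop
      have h := this.tendsto 0
      simp only [zero_smul, add_zero] at h
      exact h.mono_left nhdsWithin_le_nhds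
    refine mem_closure_of_tendsto hray ?_
    filter_upwards [self_mem_nhdsWithin] with ε hε
    have hε' : (0:ℝ) < ε := hε
    have h1 := φ.map_vadd x (ε • v)
    simp only [vadd_eq_add, hx, add_zero, map_smul, smul_eq_mul] at h1
    rw [add_comm, h1]
    exact mul_ne_zero hε'.ne' hv
  · exact subset_closure hx

/-- A nonconstant affine functional vanishing at `y0` and on a codimension two subspace. -/
lemma exists_functional {n : ℕ} (A : Eu n ≃ᵃ[ℝ] Eu n) (l l' : Eu n →ₗ[ℝ] ℝ) (c c' : ℝ)
    (hl : l ≠ 0) (hl' : ∀ t : ℝ, l' ≠ t • l) (y0 : Eu n) :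
    ∃ φ : Eu n →ᵃ[ℝ] ℝ, φ.linear ≠ 0 ∧ φ y0 = 0 ∧
      ∀ x, l x = c → l' x = c' → φ (A x) = 0 := by
  have main : ∀ α β : ℝ, (α ≠ 0 ∨ β ≠ 0) →
      α * (l (A.symm y0) - c) + β * (l' (A.symm y0) - c') = 0 →
      ∃ φ : Eu n →ᵃ[ℝ] ℝ, φ.linear ≠ 0 ∧ φ y0 = 0 ∧
      ∀ x, l x = c → l' x = c' → φ (A x) = 0 := by
    intro α β hαβ h0
    refine ⟨((α • l + β • l').toAffineMap - AffineMap.const ℝ (Eu n) (α * c + β * c')).comp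
      A.symm.toAffineMap, ?_, ?_, ?_⟩
    · intro h
      have h1 : ∀ w, α * l w + β * l' w = 0 := by
        intro w
        have := congrArg (fun L : Eu n →ₗ[ℝ] ℝ => L (A.linear w)) h
        simpa using this
      by_cases hβ : β = 0
      · have hα : α ≠ 0 := by tauto
        apply hl
        ext w
        have := h1 w
        simpa [hβ, hα] using this
      · apply hl' (-(α / β))
        ext w
        have := h1 w
        simp only [LinearMap.smul_apply, smul_eq_mul]
        field_simp
        linarith
    · simp; linarith
    · intro x hx hx'
      simp [hx, hx']
  by_cases h : l (A.symm y0) - c = 0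
  · exact main 1 0 (by simp) (by simp [h])
  · exact main (l' (A.symm y0) - c') (-(l (A.symm y0) - c)) (Or.inr (neg_ne_zero.2 h)) (by ring)

lemma open_everywhere {n N : ℕ} [Nontrivial (Eu n)] (f : Eu n → Eu n) (hf : Continuous f)
    (A : Fin N → (Eu n ≃ᵃ[ℝ] Eu n))
    (C : Fin N → Set (Eu n)) (hcov : (⋃ i, C i) = Set.univ)
    (hfA : ∀ i, ∀ x ∈ C i, f x = A i x)
    (m : Fin N → ℕ) (l : ∀ i, Fin (m i) → (Eu n →ₗ[ℝ] ℝ)) (c : ∀ i, Fin (m i) → ℝ)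
    (hC : ∀ i, C i = {x | ∀ k, l i k x ≤ c i k})
    (hloc : ∀ x : Eu n, ∃ U : Set (Eu n), IsOpen U ∧ x ∈ U ∧ Set.InjOn f U) : IsOpenMap f := by
  let I := Σ i, Fin (m i)
  let L : I → (Eu n →ₗ[ℝ] ℝ) := fun a => l a.1 a.2
  let c' : I → ℝ := fun a => c a.1 a.2
  -- openness at good points
  have hgood : ∀ x, (∀ a b : I, L a x = c' a → L b x = c' b → L a ≠ 0 →
      ∃ t : ℝ, L b = t • L a) → ∀ S ∈ 𝓝 x, f '' S ∈ 𝓝 (f x) := by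
    intro x hx
    obtain ⟨l0, hl0, hl0'⟩ : ∃ l0 : Eu n →ₗ[ℝ] ℝ, l0 ≠ 0 ∧
        ∀ a, L a x = c' a → ∃ t : ℝ, L a = t • l0 := by
      by_cases h : ∃ a, L a x = c' a ∧ L a ≠ 0
      · obtain ⟨a, ha, ha'⟩ := h
        exact ⟨L a, ha', fun b hb => hx a b ha hb ha'⟩
      · push Not at h
        obtain ⟨l0, hl0⟩ := exists_ne (0 : Eu n →ₗ[ℝ] ℝ)
        exact ⟨l0, hl0, fun a ha => ⟨0, by rw [h a ha, zero_smul]⟩⟩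
    obtain ⟨v, hv⟩ : ∃ v, 0 < l0 v := by
      by_contra h
      push Not at h
      apply hl0
      ext w
      have h1 := h w
      have h2 := h (-w)
      rw [map_neg] at h2
      simp only [LinearMap.zero_apply]
      linarith
    obtain ⟨i, hi⟩ := side C hcov m l c hC x l0 v hv (fun i k h => hl0' ⟨i, k⟩ h)
    obtain ⟨j, hj⟩ := side C hcov m l c hC x (-l0) (-v) (by simpa using hv) (fun i k h => by
      obtain ⟨t, ht⟩ := hl0' ⟨i, k⟩ h
      exact ⟨-t, by simpa using ht⟩)
    obtain ⟨U, hU, hxU, hinj⟩ := hloc x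
    refine open_of_two f (A i) (A j) x l0 v hv ?_ ?_ U (hU.mem_nhds hxU) hinj
    · filter_upwards [hi] with y hy h
      exact hfA i y (hy h)
    · filter_upwards [hj] with y hy h
      refine hfA j y (hy ?_)
      simp only [LinearMap.neg_apply]
      linarith
  rw [isOpenMap_iff_nhds_le]
  intro x
  intro T hT
  rw [mem_map] at hT
  obtain ⟨U, hU, hxU, hinj⟩ := hloc x
  obtain ⟨r, hr, hrU⟩ := Metric.nhds_basis_closedBall.mem_iff.1
    (inter_mem hT (hU.mem_nhds hxU))
  have hsph : IsClosed (f '' Metric.sphere x r) :=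
    ((isCompact_sphere x r).image hf).isClosed
  have hxs : f x ∉ f '' Metric.sphere x r := by
    rintro ⟨y, hy, hyx⟩
    have := hinj (hrU (Metric.sphere_subset_closedBall hy)).2 hxU hyx
    rw [this] at hy
    simp at hy
    exact hr.ne hy
  obtain ⟨δ, hδ, hδs⟩ := Metric.isOpen_iff.1 hsph.isOpen_compl (f x) hxs
  have hclaim : Metric.ball (f x) δ ⊆ f '' Metric.closedBall x r := by
    intro y0 hy0
    by_contra hnot
    -- choice of functionals
    let J := {p : Fin N × I × I // L p.2.1 ≠ 0 ∧ ∀ t : ℝ, L p.2.2 ≠ t • L p.2.1}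
    choose φ hφ1 hφ2 hφ3 using fun p : J =>
      exists_functional (A p.1.1) (L p.1.2.1) (L p.1.2.2) (c' p.1.2.1) (c' p.1.2.2)
        p.2.1 p.2.2 y0
    have hdense : Dense (⋂ q : Fin N × J, {x | ((φ q.2).comp (A q.1).toAffineMap) x ≠ 0}) := by
      apply dense_iInter_of_isOpen
      · intro q
        exact isOpen_ne_fun (AffineMap.continuous_of_finiteDimensional _) continuous_const
      · intro q
        apply dense_ne
        intro h
        apply hφ1 q.2
        ext w
        have := congrArg (fun L : Eu n →ₗ[ℝ] ℝ => L ((A q.1).linear.symm w)) h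
        simpa using this
    obtain ⟨x1, ⟨hx1V, hx1b⟩, hx1⟩ := hdense.inter_open_nonempty
      (f ⁻¹' Metric.ball (f x) δ ∩ Metric.ball x r)
      ((Metric.isOpen_ball.preimage hf).inter Metric.isOpen_ball)
      ⟨x, by simp [hδ], by simp [hr]⟩
    rw [mem_iInter] at hx1
    have hφx1 : ∀ p : J, φ p (f x1) ≠ 0 := by
      intro p
      have : x1 ∈ ⋃ i, C i := by rw [hcov]; trivial
      obtain ⟨i, hi⟩ := mem_iUnion.1 this
      rw [hfA i x1 hi]
      exact hx1 (i, p)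
    let γ : ℝ → Eu n := fun t => AffineMap.lineMap (f x1) y0 t
    have hγ : Continuous γ := AffineMap.lineMap_continuous
    have hK : IsClosed (f '' Metric.closedBall x r) :=
      ((isCompact_closedBall x r).image hf).isClosed
    have hsub : Icc (0:ℝ) 1 ⊆ γ ⁻¹' (f '' Metric.closedBall x r) := by
      apply IsClosed.Icc_subset_of_forall_exists_gt
      · exact (hK.preimage hγ).inter isClosed_Icc
      · simp only [mem_preimage, γ, AffineMap.lineMap_apply_zero]
        exact mem_image_of_mem _ (Metric.ball_subset_closedBall hx1b)
      · rintro t ⟨⟨z, hz, hzt⟩, ht0, ht1⟩ t' ht'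
        have hγV : γ t ∈ Metric.ball (f x) δ :=
          (convex_ball (f x) δ).lineMap_mem hx1V hy0 ⟨ht0, ht1.le⟩
        have hzb : z ∈ Metric.ball x r := by
          rcases lt_or_eq_of_le (Metric.mem_closedBall.1 hz) with h | h
          · exact h
          · exact absurd ⟨z, h, hzt⟩ (hδs hγV)
        have hopen : f '' Metric.ball x r ∈ 𝓝 (γ t) := by
          rw [← hzt]
          refine hgood z ?_ _ (Metric.isOpen_ball.mem_nhds hzb)
          intro a b ha hb ha0
          by_contra hne
          push Not at hne
          have : z ∈ ⋃ i, C i := by rw [hcov]; trivial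
          obtain ⟨i, hi⟩ := mem_iUnion.1 this
          let p : J := ⟨(i, a, b), ha0, hne⟩
          have h0 : φ p (γ t) = 0 := by
            rw [← hzt, hfA i z hi]
            exact hφ3 p z ha hb
          simp only [γ, AffineMap.apply_lineMap, hφ2 p, AffineMap.lineMap_apply_ring] at h0
          have h1 : (1 - t) * φ p (f x1) = 0 := by linarith
          rcases mul_eq_zero.1 h1 with h | h
          · linarith
          · exact hφx1 p h
        have hev : ∀ᶠ u in 𝓝[>] t, γ u ∈ f '' Metric.ball x r :=
          (hγ.continuousAt.eventually hopen).filter_mono nhdsWithin_le_nhds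
        obtain ⟨u, hu1, hu2⟩ := (hev.and (Ioc_mem_nhdsGT ht')).exists
        exact ⟨u, image_mono Metric.ball_subset_closedBall hu1, hu2⟩
    have := hsub (right_mem_Icc.2 zero_le_one)
    simp only [mem_preimage, γ, AffineMap.lineMap_apply_one] at this
    exact hnot this
  refine mem_of_superset (Metric.ball_mem_nhds _ hδ) (hclaim.trans ?_)
  rintro _ ⟨y, hy, rfl⟩
  exact (hrU hy).1

lemma affine_injective {n : ℕ} (f : Eu n → Eu n) (G : Eu n →ᵃ[ℝ] Eu n) (D : Set (Eu n))
    (hD : (interior D).Nonempty) (hfG : ∀ x ∈ D, f x = G x)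
    (hloc : ∀ x : Eu n, ∃ U : Set (Eu n), IsOpen U ∧ x ∈ U ∧ Set.InjOn f U) :
    Function.Bijective G := by
  have hlin : Function.Injective G.linear := by
    rw [← LinearMap.ker_eq_bot, LinearMap.ker_eq_bot']
    intro v hv
    obtain ⟨x, hx⟩ := hD
    obtain ⟨U, hU, hxU, hinj⟩ := hloc x
    have hray : Tendsto (fun ε : ℝ => x + ε • v) (𝓝[>] 0) (𝓝 x) := by
      have : Continuous (fun ε : ℝ => x + ε • v) := by fun_prop
      have h := this.tendsto 0
      simp only [zero_smul, add_zero] at h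
      exact h.mono_left nhdsWithin_le_nhds
    obtain ⟨ε, ⟨h1, h2⟩, hε⟩ := (((hray.eventually (hU.mem_nhds hxU)).and
      (hray.eventually (mem_interior_iff_mem_nhds.1 hx))).and self_mem_nhdsWithin).exists
    have hε' : (0:ℝ) < ε := hε
    have e : f (x + ε • v) = f x := by
      rw [hfG _ h2, hfG _ (interior_subset hx)]
      have h1 := G.map_vadd x (ε • v)
      simpa [hv, add_comm] using h1
    have := hinj h1 hxU e
    simpa [hε'.ne'] using this
  exact ⟨G.linear_injective_iff.1 hlin,
    G.linear_surjective_iff.1 (LinearMap.injective_iff_surjective.1 hlin)⟩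

/-- A closed, locally injective, open, continuous self-map of `ℝⁿ` with finite fibers is a
homeomorphism. -/
lemma homeo_of_proper {n : ℕ} (f : Eu n → Eu n) (hf : Continuous f) (ho : IsOpenMap f)
    (hc : IsClosedMap f) (hfin : ∀ y, (f ⁻¹' {y}).Finite)
    (hloc : ∀ x : Eu n, ∃ U : Set (Eu n), IsOpen U ∧ x ∈ U ∧ Set.InjOn f U) :
    ∃ g : Eu n ≃ₜ Eu n, ⇑g = f := by
  have hlh : IsLocalHomeomorphOn f univ := by
    rw [isLocalHomeomorphOn_iff_isOpenEmbedding_restrict]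
    intro x _
    obtain ⟨U, hU, hxU, hinj⟩ := hloc x
    refine ⟨U, hU.mem_nhds hxU, ?_⟩
    exact .of_continuous_injective_isOpenMap (hf.comp continuous_subtype_val)
      (Set.injOn_iff_injective.1 hinj) (ho.comp hU.isOpenMap_subtype_val)
  have hcov : IsCoveringMap f := by
    rw [isCoveringMap_iff_isCoveringMapOn_univ]
    exact hc.isCoveringMapOn_of_isLocalHomeomorphOn (fun y _ => hfin y) (by simpa using hlh)
  have hsurj : Function.Surjective f := by
    rw [← range_eq_univ]
    exact IsClopen.eq_univ ⟨hc.isClosed_range, ho.isOpen_range⟩ (range_nonempty f)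
  have hinj : Function.Injective f := by
    intro a b hab
    obtain ⟨s, ⟨hs1, hs2⟩, -⟩ := hcov.existsUnique_continuousMap_lifts (ContinuousMap.id (Eu n))
      (f a) a rfl
    have h : (s ∘ f) = id := by
      refine hcov.eq_of_comp_eq (s.continuous.comp hf) continuous_id ?_ a hs1
      rw [← Function.comp_assoc, hs2]
      rfl
    have ha := congrFun h a
    have hb := congrFun h b
    simp only [Function.comp_apply, id] at ha hb
    rw [← ha, ← hb, hab]
  exact ⟨(Equiv.ofBijective f ⟨hinj, hsurj⟩).toHomeomorphOfContinuousOpen hf ho, rfl⟩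

end PAHomeo

/-- A locally injective piecewise affine map `f : ℝⁿ → ℝⁿ`
is a homeomorphism of `ℝⁿ` onto `ℝⁿ`. -/
theorem locally_injective_piecewise_affine_is_homeomorphism
    {n N : ℕ} (f : Eu n → Eu n) (F : Fin N → (Eu n →ᵃ[ℝ] Eu n))
    (C : Fin N → Set (Eu n)) (hpa : IsPiecewiseAffine f F C)
    (hloc : ∀ x : Eu n, ∃ U : Set (Eu n), IsOpen U ∧ x ∈ U ∧ Set.InjOn f U) :
    ∃ g : Eu n ≃ₜ Eu n, ⇑g = f := by
  rcases subsingleton_or_nontrivial (Eu n) with hsub | hnt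
  · exact ⟨Homeomorph.refl _, funext fun x => Subsingleton.elim _ _⟩
  obtain ⟨hpoly, hint, hcov, -, hfF⟩ := hpa
  choose m l c hC using hpoly
  have hbij : ∀ i, Function.Bijective (F i) := fun i =>
    PAHomeo.affine_injective f (F i) (C i) (hint i) (hfF i) hloc
  let A : Fin N → (Eu n ≃ᵃ[ℝ] Eu n) := fun i => AffineEquiv.ofBijective (hbij i)
  have hfA : ∀ i, ∀ x ∈ C i, f x = A i x := fun i x hx => hfF i x hx
  have hclosed : ∀ i, IsClosed (C i) := by
    intro i
    rw [hC i, Set.ofPred_forall]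
    exact isClosed_iInter fun k =>
      isClosed_le (LinearMap.continuous_of_finiteDimensional _) continuous_const
  have hcontA : ∀ i, Continuous (A i) := fun i =>
    (A i).toAffineMap.continuous_of_finiteDimensional
  have hf : Continuous f := by
    refine (locallyFinite_of_finite C).continuous hcov hclosed fun i => ?_
    exact (hcontA i).continuousOn.congr (hfA i)
  have hcl : IsClosedMap f := by
    intro K hK
    have : f '' K = ⋃ i, (A i) '' (K ∩ C i) := by
      ext y
      simp only [mem_image, mem_iUnion]
      constructor
      · rintro ⟨x, hx, rfl⟩
        have : x ∈ ⋃ i, C i := by rw [hcov]; trivial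
        obtain ⟨i, hi⟩ := mem_iUnion.1 this
        exact ⟨i, x, ⟨hx, hi⟩, (hfA i x hi).symm⟩
      · rintro ⟨i, x, ⟨hx, hi⟩, rfl⟩
        exact ⟨x, hx, hfA i x hi⟩
    rw [this]
    refine isClosed_iUnion_of_finite fun i => ?_
    exact (A i).toHomeomorphOfFiniteDimensional.isClosedMap _ (hK.inter (hclosed i))
  have hfin : ∀ y, (f ⁻¹' {y}).Finite := by
    intro y
    refine (Set.finite_range fun i => (A i).symm y).subset ?_
    intro x hx
    have : x ∈ ⋃ i, C i := by rw [hcov]; trivial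
    obtain ⟨i, hi⟩ := mem_iUnion.1 this
    refine ⟨i, ?_⟩
    have hx' : f x = y := hx
    simp only [← hx', hfA i x hi, AffineEquiv.symm_apply_apply]
  exact PAHomeo.homeo_of_proper f hf
    (PAHomeo.open_everywhere f hf A C hcov hfA m l c hC hloc) hcl hfin hloc
end

section
/- Let f : ℝⁿ → ℝⁿ be piecewise affine with pieces (f_i, C_i), i = 1,…,N, let x₀ ∈ ℝⁿ, and let I = { i : x₀ ∈ C_i }. If every matrix in the convex hull (taken in the space of n×n real matrices) of the set { linear part of f_i : i ∈ I } is invertible, then f is a homeomorphism of some open neighborhood of x₀ onto an open neighborhood of f(x₀). -/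
open Set Filter Topology

/-- Along any ray some fixed piece contains points arbitrarily close to the start. -/
lemma pa_frequent {n N : ℕ} {C : Fin N → Set (Eu n)} (hcl : ∀ i, IsClosed (C i))
    (hcov : (⋃ i, C i) = Set.univ) (x d : Eu n) :
    ∃ i, x ∈ C i ∧ ∃ᶠ t in 𝓝[>] (0 : ℝ), x + t • d ∈ C i := by
  have h1 : ∃ i, ∃ᶠ t in 𝓝[>] (0 : ℝ), x + t • d ∈ C i := by
    by_contra hcon
    push Not at hcon
    have h2 : ∀ᶠ t in 𝓝[>] (0 : ℝ), ∀ i, x + t • d ∉ C i := by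
      rw [eventually_all]
      intro i
      simpa [Filter.not_frequently] using hcon i
    obtain ⟨t, ht⟩ := h2.exists
    have : x + t • d ∈ ⋃ i, C i := by rw [hcov]; trivial
    obtain ⟨i, hi⟩ := mem_iUnion.1 this
    exact ht i hi
  obtain ⟨i, hi⟩ := h1
  refine ⟨i, ?_, hi⟩
  have hc : Tendsto (fun t : ℝ => x + t • d) (𝓝[>] (0 : ℝ)) (𝓝 x) := by
    have : Continuous (fun t : ℝ => x + t • d) := by fun_prop
    have h := this.tendsto 0
    simp only [zero_smul, add_zero] at h
    exact h.mono_left nhdsWithin_le_nhds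
  by_contra hx
  have := hc.eventually ((hcl i).isOpen_compl.mem_nhds hx)
  obtain ⟨t, ht1, ht2⟩ := (hi.and_eventually this).exists
  exact ht2 ht1

lemma pa_closed {n : ℕ} {C : Set (Eu n)} (h : IsPolyhedron C) : IsClosed C := by
  obtain ⟨m, l, c, rfl⟩ := h
  rw [Set.ofPred_forall]
  exact isClosed_iInter fun i =>
    isClosed_le (l i).continuous_of_finiteDimensional continuous_const

lemma pa_ray {n N : ℕ} {f : Eu n → Eu n} {F : Fin N → (Eu n →ᵃ[ℝ] Eu n)}
    {C : Fin N → Set (Eu n)} (hf : ∀ i, ∀ x ∈ C i, f x = F i x) {i : Fin N} {x d : Eu n} {t : ℝ}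
    (hx : x ∈ C i) (hd : x + t • d ∈ C i) : f (x + t • d) = f x + t • (F i).linear d := by
  rw [hf i _ hx, hf i _ hd, add_comm x, ← vadd_eq_add, AffineMap.map_vadd, vadd_eq_add,
    map_smul, add_comm]

/-- Mean value inequality in a convex region where only the pieces in `I` occur. -/
lemma pa_mvt {n N : ℕ} {f : Eu n → Eu n} {F : Fin N → (Eu n →ᵃ[ℝ] Eu n)}
    {C : Fin N → Set (Eu n)} (hcl : ∀ i, IsClosed (C i))
    (hcov : (⋃ i, C i) = Set.univ) (hf : ∀ i, ∀ x ∈ C i, f x = F i x) (hcont : Continuous f)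
    {U : Set (Eu n)} (hU : Convex ℝ U) {I : Fin N → Prop} (hI : ∀ x ∈ U, ∀ i, x ∈ C i → I i)
    {x y : Eu n} (hx : x ∈ U) (hy : y ∈ U) (g : Eu n →L[ℝ] ℝ) (c : ℝ)
    (hc : ∀ i, I i → g ((F i).linear (y - x)) ≤ c) : g (f y) - g (f x) ≤ c := by
  set d := y - x with hd
  have key : ∀ ⦃s : ℝ⦄, s ∈ Icc (0:ℝ) 1 → g (f (x + s • d)) ≤ g (f x) + s * c := by
    refine image_le_of_liminf_slope_right_le_deriv_boundary (f := fun s : ℝ => g (f (x + s • d)))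
      (B := fun s => g (f x) + s * c) (B' := fun _ => c) ?_ ?_ ?_ ?_ ?_
    · exact Continuous.continuousOn (by fun_prop)
    · simp
    · exact Continuous.continuousOn (by fun_prop)
    · intro s _
      have : HasDerivAt (fun s : ℝ => g (f x) + s * c) c s := by
        simpa using ((hasDerivAt_id s).mul_const c).const_add (g (f x))
      exact this.hasDerivWithinAt
    · intro s hs r hr
      obtain ⟨i, hi, hfr⟩ := pa_frequent hcl hcov (x + s • d) d
      have hsU : x + s • d ∈ U := by
        have := hU.add_smul_sub_mem hx hy (t := s) ⟨hs.1, hs.2.le⟩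
        simpa [hd] using this
      have hci := hc i (hI _ hsU i hi)
      have hmap : Tendsto (fun t : ℝ => s + t) (𝓝[>] 0) (𝓝[>] s) := by
        refine tendsto_nhdsWithin_iff.2 ⟨?_, ?_⟩
        · have : Continuous (fun t : ℝ => s + t) := by fun_prop
          have h := this.tendsto 0
          simp only [add_zero] at h
          exact h.mono_left nhdsWithin_le_nhds
        · filter_upwards [self_mem_nhdsWithin] with t ht
          simpa using ht
      refine hmap.frequently ?_
      refine (hfr.and_eventually self_mem_nhdsWithin).mono ?_
      rintro t ⟨ht, ht0⟩
      have ht0 : 0 < t := ht0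
      have e : x + (s + t) • d = x + s • d + t • d := by rw [add_smul, add_assoc]
      have := pa_ray hf hi ht
      rw [slope_def_field]
      simp only [e, this, map_add, map_smul, smul_eq_mul, add_sub_cancel_left]
      rw [mul_div_cancel_left₀ _ ht0.ne']
      exact lt_of_le_of_lt hci hr
  have := key (s := 1) ⟨zero_le_one, le_rfl⟩
  simp only [one_smul, hd, add_sub_cancel, one_mul] at this
  linarith

/-- tropical version of Clarke's inverse function theorem.
If the convex hull of the linear parts of the pieces of `f` containing `x₀`
consists of invertible (bijective) linear maps, then `f` is a homeomorphism of a
neighborhood of `x₀` onto a neighborhood of `f x₀`. -/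
theorem piecewise_affine_clarke_local_homeomorphism
    {n N : ℕ} (f : Eu n → Eu n) (F : Fin N → (Eu n →ᵃ[ℝ] Eu n))
    (C : Fin N → Set (Eu n)) (hpa : IsPiecewiseAffine f F C) (x₀ : Eu n)
    (hJ : ∀ A ∈ convexHull ℝ {A : Eu n →ₗ[ℝ] Eu n | ∃ i, x₀ ∈ C i ∧ A = (F i).linear},
      Function.Bijective A) :
    ∃ U : Set (Eu n), IsOpen U ∧ x₀ ∈ U ∧ IsOpen (f '' U) ∧
      ∃ e : U ≃ₜ (f '' U), ∀ x : U, (e x : Eu n) = f x := by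
  obtain ⟨hpoly, -, hcov, -, hf⟩ := hpa
  have hcl : ∀ i, IsClosed (C i) := fun i => pa_closed (hpoly i)
  have hcont : Continuous f := by
    refine (locallyFinite_of_finite C).continuous hcov hcl fun i => ?_
    exact ((F i).continuous_of_finiteDimensional.continuousOn).congr fun x hx => hf i x hx
  set S : Set (Eu n →ₗ[ℝ] Eu n) := {A | ∃ i, x₀ ∈ C i ∧ A = (F i).linear} with hS
  have hSfin : S.Finite := by
    refine (Set.finite_range fun i => (F i).linear).subset ?_
    rintro A ⟨i, -, rfl⟩
    exact ⟨i, rfl⟩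
  -- the neighbourhood
  obtain ⟨r, hr, hball⟩ : ∃ r > 0, ∀ x ∈ Metric.ball x₀ r, ∀ i, x ∈ C i → x₀ ∈ C i := by
    have : ∀ᶠ x in 𝓝 x₀, ∀ i, x ∈ C i → x₀ ∈ C i := by
      rw [eventually_all]
      intro i
      by_cases h : x₀ ∈ C i
      · exact Eventually.of_forall fun _ _ => h
      · filter_upwards [(hcl i).isOpen_compl.mem_nhds h] with x hx hx'
        exact absurd hx' hx
    obtain ⟨r, hr, h⟩ := Metric.eventually_nhds_iff_ball.1 this
    exact ⟨r, hr, h⟩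
  -- injectivity
  have hinj : InjOn f (Metric.ball x₀ r) := by
    intro x hx y hy hxy
    by_contra hne
    let ev : (Eu n →ₗ[ℝ] Eu n) →ₗ[ℝ] Eu n := LinearMap.applyₗ (y - x)
    have h0 : (0 : Eu n) ∉ convexHull ℝ (ev '' S) := by
      rw [← LinearMap.image_convexHull]
      rintro ⟨A, hA, hA0⟩
      have h1 : A (y - x) = A 0 := by simpa [ev] using hA0
      exact hne (sub_eq_zero.1 ((hJ A hA).1 h1)).symm
    obtain ⟨g, s, hgs, hg⟩ := geometric_hahn_banach_closed_point (convex_convexHull ℝ _)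
      ((hSfin.image ev).isClosed_convexHull ℝ) h0
    have := pa_mvt hcl hcov hf hcont (convex_ball x₀ r) hball hx hy g s (fun i hi =>
      (hgs _ (subset_convexHull ℝ _ ⟨_, ⟨i, hi, rfl⟩, rfl⟩)).le)
    rw [hxy] at this
    simp at this hg
    linarith
  -- openness
  have hopen : ∀ V ⊆ Metric.ball x₀ r, IsOpen V → IsOpen (f '' V) := by
    intro V hVU hV
    rw [isOpen_iff_mem_nhds]
    rintro _ ⟨x, hx, rfl⟩
    obtain ⟨ε, hε, hεV⟩ := Metric.nhds_basis_closedBall.mem_iff.1 (hV.mem_nhds hx)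
    have hsph : f x ∉ f '' Metric.sphere x ε := by
      rintro ⟨z, hz, hzx⟩
      have hzV := hεV (Metric.sphere_subset_closedBall hz)
      have := hinj (hVU hzV) (hVU hx) hzx
      rw [this] at hz
      simp at hz
      linarith
    have hsc : IsClosed (f '' Metric.sphere x ε) :=
      ((isCompact_sphere x ε).image hcont).isClosed
    obtain ⟨m, hm, hmS⟩ := Metric.mem_nhds_iff.1 (hsc.isOpen_compl.mem_nhds hsph)
    refine Metric.mem_nhds_iff.2 ⟨m / 2, by positivity, ?_⟩
    intro y hy
    obtain ⟨z, hz, hzmin⟩ := (isCompact_closedBall x ε).exists_isMinOn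
      ⟨x, Metric.mem_closedBall_self hε.le⟩
      (f := fun z => ‖f z - y‖) (by fun_prop)
    have hzb : z ∈ Metric.ball x ε := by
      by_contra hzn
      have hzs : z ∈ Metric.sphere x ε := by
        simp only [Metric.mem_ball, not_lt, Metric.mem_closedBall, Metric.mem_sphere] at *
        exact le_antisymm hz hzn
      have h1 : ‖f z - y‖ ≤ ‖f x - y‖ := hzmin (Metric.mem_closedBall_self hε.le)
      have h2 : f z ∈ Metric.ball (f x) m := by
        rw [Metric.mem_ball] at hy ⊢
        rw [← dist_eq_norm, ← dist_eq_norm, dist_comm (f x)] at h1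
        linarith [dist_triangle (f z) y (f x)]
      exact hmS h2 ⟨z, hzs, rfl⟩
    refine ⟨z, hεV hz, ?_⟩
    by_contra hne
    set u := f z - y with hu
    have hu0 : u ≠ 0 := sub_ne_zero.2 hne
    let T : (Eu n →ₗ[ℝ] Eu n) →ₗ[ℝ] Eu n :=
      { toFun := fun A => LinearMap.adjoint A u
        map_add' := by intro A B; simp
        map_smul' := by intro a A; simp }
    have h0 : (0 : Eu n) ∉ convexHull ℝ (T '' S) := by
      rw [← LinearMap.image_convexHull]
      rintro ⟨A, hA, hA0⟩
      have hA0 : LinearMap.adjoint A u = 0 := hA0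
      obtain ⟨v, hv⟩ := (hJ A hA).2 u
      apply hu0
      rw [← inner_self_eq_zero (𝕜 := ℝ)]
      nth_rewrite 1 [← hv]
      rw [← LinearMap.adjoint_inner_right, hA0, inner_zero_right]
    obtain ⟨g, s, hgs, hg⟩ := geometric_hahn_banach_point_closed (convex_convexHull ℝ _)
      ((hSfin.image T).isClosed_convexHull ℝ) h0
    set v := (InnerProductSpace.toDual ℝ (Eu n)).symm g with hv
    obtain ⟨i, hi, hfr⟩ := pa_frequent hcl hcov z (-v)
    have hiI := hball z (hVU (hεV hz)) i hi
    set L := (F i).linear with hL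
    have hpos : 0 < inner ℝ (L v) u := by
      have h1 := hg (T L) (subset_convexHull ℝ _ ⟨_, ⟨i, hiI, rfl⟩, rfl⟩)
      have h2 : g (T L) = inner ℝ (L v) u := by
        rw [← LinearMap.adjoint_inner_right]
        exact (InnerProductSpace.toDual_symm_apply).symm
      rw [h2] at h1
      simp at hgs
      linarith
    have hev1 : ∀ᶠ t in 𝓝[>] (0:ℝ), z + t • (-v) ∈ Metric.ball x ε := by
      have : Continuous (fun t : ℝ => z + t • (-v)) := by fun_prop
      have h := this.tendsto 0
      simp only [zero_smul, add_zero] at h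
      exact (h.mono_left nhdsWithin_le_nhds).eventually (Metric.isOpen_ball.mem_nhds hzb)
    have hev2 : ∀ᶠ t in 𝓝[>] (0:ℝ), t * ‖L v‖ ^ 2 < 2 * inner ℝ (L v) u := by
      have : Continuous (fun t : ℝ => t * ‖L v‖ ^ 2) := by fun_prop
      have h := this.tendsto 0
      simp only [zero_mul] at h
      exact (h.mono_left nhdsWithin_le_nhds).eventually (gt_mem_nhds (by linarith))
    obtain ⟨t, ht, ⟨ht1, ht2⟩, ht0⟩ :=
      (hfr.and_eventually ((hev1.and hev2).and self_mem_nhdsWithin)).exists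
    have ht0 : 0 < t := ht0
    have h1 : ‖u‖ ≤ ‖f (z + t • (-v)) - y‖ := hzmin (Metric.ball_subset_closedBall ht1)
    have h2 : f (z + t • (-v)) - y = u - t • L v := by
      rw [pa_ray hf hi ht, hu, map_neg, smul_neg]
      abel
    rw [h2] at h1
    have h3 : ‖u‖ ^ 2 ≤ ‖u - t • L v‖ ^ 2 := by gcongr
    rw [norm_sub_sq_real u, inner_smul_right, norm_smul, mul_pow, Real.norm_eq_abs, sq_abs,
      real_inner_comm (L v) u] at h3
    nlinarith [mul_lt_mul_of_pos_left ht2 ht0]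
  -- conclusion
  refine ⟨Metric.ball x₀ r, Metric.isOpen_ball, Metric.mem_ball_self hr,
    hopen _ subset_rfl Metric.isOpen_ball, ?_⟩
  let e₀ := Equiv.Set.imageOfInjOn f (Metric.ball x₀ r) hinj
  have hc : Continuous e₀ := by
    refine Continuous.subtype_mk (hcont.comp continuous_subtype_val) _
  have ho : IsOpenMap e₀ := by
    intro W hW
    have hW' : IsOpen ((↑) '' W : Set (Eu n)) := Metric.isOpen_ball.isOpenMap_subtype_val W hW
    have := hopen _ (by rintro _ ⟨w, -, rfl⟩; exact w.2) hW'
    refine ⟨_, this, ?_⟩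
    ext ⟨p, hp⟩
    constructor
    · rintro ⟨_, ⟨w, hw, rfl⟩, hwp⟩
      exact ⟨w, hw, Subtype.ext hwp⟩
    · rintro ⟨w, hw, hwp⟩
      exact ⟨w, ⟨w, hw, rfl⟩, congrArg Subtype.val hwp⟩
  exact ⟨e₀.toHomeomorphOfContinuousOpen hc ho, fun x => rfl⟩
end

section
/- Let f : ℝⁿ → ℝⁿ be piecewise affine with pieces (f_i, C_i), i = 1,…,N. Then f is a homeomorphism of ℝⁿ onto ℝⁿ if and only if the following two conditions hold: (1) either J_i > 0 for every i, or J_i < 0 for every i; and (2) there exists a regular value y₀ of f such that the preimage f⁻¹({y₀}) has exactly one element. -/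
namespace PA

open Set Filter Topology Metric

/-- the hyperplane `a z = b` -/
def HP {n : ℕ} (a : Eu n →ₗ[ℝ] ℝ) (b : ℝ) : Set (Eu n) := {z | a z = b}

/-- points lying on at most one hyperplane of the family -/
def Good {n : ℕ} {ι : Type} (a : ι → (Eu n →ₗ[ℝ] ℝ)) (b : ι → ℝ) : Set (Eu n) :=
  {z | ∀ k l, a k z = b k → a l z = b l → HP (a k) (b k) = HP (a l) (b l)}

/-- points lying on no hyperplane of the family -/
def Off {n : ℕ} {ι : Type} (a : ι → (Eu n →ₗ[ℝ] ℝ)) (b : ι → ℝ) : Set (Eu n) :=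
  {z | ∀ k, a k z ≠ b k}

variable {n : ℕ}

lemma cont_fun (a : Eu n →ₗ[ℝ] ℝ) : Continuous a := a.continuous_of_finiteDimensional

lemma exists_eq_one {a : Eu n →ₗ[ℝ] ℝ} (ha : a ≠ 0) : ∃ e, a e = 1 := by
  obtain ⟨v, hv⟩ : ∃ v, a v ≠ 0 := by
    by_contra! h
    exact ha (LinearMap.ext h)
  exact ⟨(a v)⁻¹ • v, by simp [hv]⟩

lemma small_add (x e : Eu n) {s : Set (Eu n)} (hs : s ∈ 𝓝 x) :
    ∃ t : ℝ, 0 < t ∧ x + t • e ∈ s ∧ x - t • e ∈ s := by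
  have h1 : Tendsto (fun t : ℝ => x + t • e) (𝓝 0) (𝓝 x) := by
    have : Continuous (fun t : ℝ => x + t • e) := by fun_prop
    simpa using this.tendsto 0
  have h2 : Tendsto (fun t : ℝ => x - t • e) (𝓝 0) (𝓝 x) := by
    have : Continuous (fun t : ℝ => x - t • e) := by fun_prop
    simpa using this.tendsto 0
  have h3 := (h1.eventually hs).and (h2.eventually hs)
  have h4 : ∀ᶠ t : ℝ in 𝓝[>] 0, x + t • e ∈ s ∧ x - t • e ∈ s := nhdsWithin_le_nhds h3
  obtain ⟨t, ht, ht'⟩ := (h4.and self_mem_nhdsWithin).exists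
  exact ⟨t, ht', ht⟩

lemma dense_ne {a : Eu n →ₗ[ℝ] ℝ} (ha : a ≠ 0) (b : ℝ) : Dense {z | a z ≠ b} := by
  obtain ⟨e, he⟩ := exists_eq_one ha
  intro x
  rw [mem_closure_iff_nhds]
  intro s hs
  obtain ⟨t, ht, h1, -⟩ := small_add x e hs
  by_cases hx : a x = b
  · refine ⟨_, h1, ?_⟩
    simp [he, hx, ht.ne']
  · exact ⟨x, mem_of_mem_nhds hs, hx⟩

lemma isOpen_ne (a : Eu n →ₗ[ℝ] ℝ) (b : ℝ) : IsOpen {z | a z ≠ b} :=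
  isOpen_ne_fun (cont_fun a) continuous_const

lemma dense_off {ι : Type} [Finite ι] {a : ι → (Eu n →ₗ[ℝ] ℝ)} (ha : ∀ k, a k ≠ 0) (b : ι → ℝ) :
    Dense (Off a b) := by
  have := dense_iInter_of_isOpen (fun k => isOpen_ne (a k) (b k)) (fun k => dense_ne (ha k) (b k))
  convert this using 1
  ext z
  simp [Off]

lemma off_subset_good {ι : Type} (a : ι → (Eu n →ₗ[ℝ] ℝ)) (b : ι → ℝ) : Off a b ⊆ Good a b :=
  fun _ hz k _ hk _ => absurd hk (hz k)

lemma isOpen_off {ι : Type} [Finite ι] (a : ι → (Eu n →ₗ[ℝ] ℝ)) (b : ι → ℝ) :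
    IsOpen (Off a b) := by
  have : Off a b = ⋂ k, {z | a k z ≠ b k} := by ext; simp [Off]
  rw [this]
  exact isOpen_iInter_of_finite fun k => isOpen_ne _ _

lemma isOpen_good {ι : Type} [Finite ι] (a : ι → (Eu n →ₗ[ℝ] ℝ)) (b : ι → ℝ) :
    IsOpen (Good a b) := by
  have : Good a b = ⋂ k, ⋂ l, {z | a k z = b k → a l z = b l →
      HP (a k) (b k) = HP (a l) (b l)} := by ext; simp [Good]
  rw [this]
  refine isOpen_iInter_of_finite fun k => isOpen_iInter_of_finite fun l => ?_
  by_cases h : HP (a k) (b k) = HP (a l) (b l)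
  · simp [h]
  · have : {z | a k z = b k → a l z = b l → HP (a k) (b k) = HP (a l) (b l)} =
      {z | a k z ≠ b k} ∪ {z | a l z ≠ b l} := by
      ext z; simp only [h, mem_ofPred_eq, mem_union]; tauto
    rw [this]
    exact (isOpen_ne _ _).union (isOpen_ne _ _)

/-- the functional cutting out the cone from `y` over the intersection of two hyperplanes -/
def coneFun (y : Eu n) (a₁ : Eu n →ₗ[ℝ] ℝ) (b₁ : ℝ) (a₂ : Eu n →ₗ[ℝ] ℝ) (b₂ : ℝ) :
    Eu n →ₗ[ℝ] ℝ := (b₂ - a₂ y) • a₁ - (b₁ - a₁ y) • a₂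

lemma HP_eq_of_coneFun {y : Eu n} {a₁ : Eu n →ₗ[ℝ] ℝ} {b₁ : ℝ} {a₂ : Eu n →ₗ[ℝ] ℝ} {b₂ : ℝ}
    (h1 : a₁ ≠ 0) (h2 : a₂ ≠ 0) (hy : ¬ (a₁ y = b₁ ∧ a₂ y = b₂))
    (h : coneFun y a₁ b₁ a₂ b₂ = 0) : HP a₁ b₁ = HP a₂ b₂ := by
  have hv : ∀ v, (b₂ - a₂ y) * a₁ v = (b₁ - a₁ y) * a₂ v := by
    intro v
    have := LinearMap.congr_fun h v
    simp only [coneFun, LinearMap.sub_apply, LinearMap.smul_apply, smul_eq_mul,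
      LinearMap.zero_apply] at this
    linarith
  obtain ⟨e1, he1⟩ := exists_eq_one h1
  obtain ⟨e2, he2⟩ := exists_eq_one h2
  have hα : b₁ - a₁ y ≠ 0 := by
    intro h0
    have := hv e1
    rw [h0, he1] at this
    apply hy; constructor <;> linarith
  have hβ : b₂ - a₂ y ≠ 0 := by
    intro h0
    have := hv e2
    rw [h0, he2] at this
    apply hy; constructor <;> linarith
  ext z
  have hz := hv (z - y)
  simp only [map_sub] at hz
  simp only [HP, mem_ofPred_eq]
  constructor
  · intro h
    rw [h] at hz
    have : (b₁ - a₁ y) * (b₂ - a₂ z) = 0 := by linarith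
    rcases mul_eq_zero.1 this with h | h
    · exact absurd h hα
    · linarith
  · intro h
    rw [h] at hz
    have : (b₂ - a₂ y) * (b₁ - a₁ z) = 0 := by linarith
    rcases mul_eq_zero.1 this with h | h
    · exact absurd h hβ
    · linarith

lemma dense_good_segment {ι : Type} [Finite ι] {a : ι → (Eu n →ₗ[ℝ] ℝ)} (ha : ∀ k, a k ≠ 0)
    (b : ι → ℝ) {y : Eu n} (hy : y ∈ Good a b) : Dense {w | segment ℝ y w ⊆ Good a b} := by
  let κ := {p : ι × ι // HP (a p.1) (b p.1) ≠ HP (a p.2) (b p.2)}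
  let c : κ → (Eu n →ₗ[ℝ] ℝ) := fun p => coneFun y (a p.1.1) (b p.1.1) (a p.1.2) (b p.1.2)
  have hny : ∀ p : κ, ¬ (a p.1.1 y = b p.1.1 ∧ a p.1.2 y = b p.1.2) :=
    fun p h => p.2 (hy _ _ h.1 h.2)
  have hc : ∀ p, c p ≠ 0 := by
    intro p hp
    exact p.2 (HP_eq_of_coneFun (ha _) (ha _) (hny p) hp)
  refine (dense_off hc (fun p => c p y)).mono ?_
  intro w hw z hz k l hk hl
  by_contra hne
  let p : κ := ⟨(k, l), hne⟩
  apply hw p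
  rw [segment_eq_image'] at hz
  obtain ⟨t, -, rfl⟩ := hz
  have h1 : a k y + t * a k (w - y) = b k := by simpa using hk
  have h2 : a l y + t * a l (w - y) = b l := by simpa using hl
  have ht : t ≠ 0 := by
    rintro rfl
    exact hny p ⟨by simpa using h1, by simpa using h2⟩
  have h3 : t * c p (w - y) = 0 := by
    simp only [c, p, coneFun, LinearMap.sub_apply, LinearMap.smul_apply, smul_eq_mul]
    have e1 : b k - a k y = t * a k (w - y) := by linarith
    have e2 : b l - a l y = t * a l (w - y) := by linarith
    rw [e1, e2]; ring
  have h4 := (mul_eq_zero.1 h3).resolve_left ht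
  rw [map_sub] at h4
  linarith

lemma preconnected_good {ι : Type} [Finite ι] {a : ι → (Eu n →ₗ[ℝ] ℝ)} (ha : ∀ k, a k ≠ 0)
    (b : ι → ℝ) {V : Set (Eu n)} (hV : IsOpen V) (hVc : Convex ℝ V) :
    IsPreconnected (Good a b ∩ V) := by
  refine isPreconnected_of_forall_pair ?_
  intro y hy y' hy'
  obtain ⟨r, hr, hB⟩ := Metric.isOpen_iff.1 ((isOpen_good a b).inter hV) y' hy'
  obtain ⟨w, hw, hwB⟩ := (dense_good_segment ha b hy.1).exists_mem_open
    (isOpen_ball (x := y') (ε := r)) ⟨y', mem_ball_self hr⟩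
  refine ⟨segment ℝ y w ∪ ball y' r, ?_, ?_, ?_, ?_⟩
  · apply union_subset _ hB
    exact subset_inter hw (hVc.segment_subset hy.2 (hB hwB).2)
  · exact Or.inl (left_mem_segment _ _ _)
  · exact Or.inr (mem_ball_self hr)
  · exact IsPreconnected.union w (right_mem_segment _ _ _) hwB
      (convex_segment _ _).isPreconnected (convex_ball _ _).isPreconnected


/-- A uniform presentation of all the pieces by nonzero functionals. -/
lemma exists_presentation {N : ℕ} {C : Fin N → Set (Eu n)} (hC : ∀ i, IsPolyhedron (C i))
    (hne : ∀ i, (interior (C i)).Nonempty) :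
    ∃ (ι : Type) (_ : Finite ι) (a : ι → (Eu n →ₗ[ℝ] ℝ)) (b : ι → ℝ) (idx : ι → Fin N),
      (∀ p, a p ≠ 0) ∧ ∀ i x, x ∈ C i ↔ ∀ p, idx p = i → a p x ≤ b p := by
  choose m l c h using hC
  refine ⟨{p : Σ i, Fin (m i) // l p.1 p.2 ≠ 0}, inferInstance, fun p => l p.1.1 p.1.2,
    fun p => c p.1.1 p.1.2, fun p => p.1.1, fun p => p.2, ?_⟩
  intro i x
  constructor
  · rintro hx ⟨⟨j, k⟩, hp⟩ rfl
    rw [h] at hx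
    exact hx k
  · intro hx
    rw [h]
    intro k
    by_cases h0 : l i k = 0
    · obtain ⟨z, hz⟩ := hne i
      have hz' := interior_subset hz
      rw [h] at hz'
      have := hz' k
      rw [h0] at this ⊢
      simpa using this
    · exact hx ⟨⟨i, k⟩, h0⟩ rfl

section pieces

variable {N : ℕ} {C : Fin N → Set (Eu n)} {ι : Type} [Finite ι]
  {a : ι → (Eu n →ₗ[ℝ] ℝ)} {b : ι → ℝ} {idx : ι → Fin N}

lemma off_mem_interior (hC : ∀ i x, x ∈ C i ↔ ∀ p, idx p = i → a p x ≤ b p) {i : Fin N} {x : Eu n}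
    (hx : x ∈ C i) (ho : x ∈ Off a b) : x ∈ interior (C i) := by
  rw [mem_interior]
  refine ⟨⋂ p, {z | idx p = i → a p z < b p}, ?_, ?_, ?_⟩
  · intro z hz
    rw [hC]
    intro p hp
    exact (mem_iInter.1 hz p hp).le
  · refine isOpen_iInter_of_finite fun p => ?_
    by_cases h : idx p = i
    · simpa [h] using isOpen_lt (cont_fun (a p)) continuous_const
    · simp [h]
  · refine mem_iInter.2 fun p hp => ?_
    exact lt_of_le_of_ne ((hC i x).1 hx p hp) (ho p)

lemma piece_isClosed (hC : ∀ i x, x ∈ C i ↔ ∀ p, idx p = i → a p x ≤ b p) (i : Fin N) :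
    IsClosed (C i) := by
  have : C i = ⋂ p, {z | idx p = i → a p z ≤ b p} := by ext z; simp [hC]
  rw [this]
  refine isClosed_iInter fun p => ?_
  by_cases h : idx p = i
  · simpa [h] using isClosed_le (cont_fun (a p)) continuous_const
  · simp [h]

lemma piece_convex (hC : ∀ i x, x ∈ C i ↔ ∀ p, idx p = i → a p x ≤ b p) (i : Fin N) :
    Convex ℝ (C i) := by
  have : C i = ⋂ p, {z | idx p = i → a p z ≤ b p} := by ext z; simp [hC]
  rw [this]
  refine convex_iInter fun p => ?_
  by_cases h : idx p = i
  · simpa [h] using convex_halfSpace_le (a p).isLinear (b p)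
  · simpa [h] using convex_univ

/-- a convex set avoiding all hyperplanes lies in one piece -/
lemma convex_off_subset (hC : ∀ i x, x ∈ C i ↔ ∀ p, idx p = i → a p x ≤ b p)
    {S : Set (Eu n)} (hS : Convex ℝ S) (hoff : S ⊆ Off a b) {i : Fin N} {u : Eu n} (hu : u ∈ S)
    (hui : u ∈ C i) : S ⊆ C i := by
  intro v hv
  rw [hC] at hui ⊢
  intro p hp
  by_contra! hlt
  have himg : IsPreconnected (a p '' S) :=
    hS.isPreconnected.image _ (cont_fun (a p)).continuousOn
  have := himg.Icc_subset (mem_image_of_mem _ hu) (mem_image_of_mem _ hv)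
    ⟨hui p hp, hlt.le⟩
  obtain ⟨z, hz, hzb⟩ := this
  exact hoff hz p hzb

/-- Local structure at a good point: two half balls. -/
lemma half_balls (ha : ∀ p, a p ≠ 0) (hC : ∀ i x, x ∈ C i ↔ ∀ p, idx p = i → a p x ≤ b p)
    (hcov : (⋃ i, C i) = Set.univ) {x : Eu n} (hx : x ∈ Good a b) :
    ∃ (i j : Fin N) (α : Eu n →ₗ[ℝ] ℝ) (r : ℝ), 0 < r ∧ (α = 0 → i = j) ∧
      (∀ v ∈ ball x r, 0 ≤ α (v - x) → v ∈ C i) ∧ (∀ v ∈ ball x r, α (v - x) ≤ 0 → v ∈ C j) := by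
  have hmem : ∀ z, ∃ i, z ∈ C i := fun z => by
    have : z ∈ ⋃ i, C i := hcov ▸ mem_univ z
    simpa using this
  -- a ball meeting only the hyperplanes through x
  obtain ⟨r, hr, hball⟩ : ∃ r > 0, ∀ z ∈ ball x r, ∀ p, a p x ≠ b p → a p z ≠ b p := by
    have : (⋂ p, {z | a p x ≠ b p → a p z ≠ b p}) ∈ 𝓝 x := by
      refine IsOpen.mem_nhds (isOpen_iInter_of_finite fun p => ?_) (mem_iInter.2 fun p h => h)
      by_cases h : a p x = b p
      · simp [h]
      · simpa [h] using isOpen_ne (a p) (b p)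
    obtain ⟨r, hr, h⟩ := Metric.mem_nhds_iff.1 this
    exact ⟨r, hr, fun z hz p => mem_iInter.1 (h hz) p⟩
  by_cases hoff : x ∈ Off a b
  · obtain ⟨i, hi⟩ := hmem x
    have : ball x r ⊆ C i := convex_off_subset hC (convex_ball x r)
      (fun z hz p => hball z hz p (hoff p)) (mem_ball_self hr) hi
    exact ⟨i, i, 0, r, hr, fun _ => rfl, fun v hv _ => this hv, fun v hv _ => this hv⟩
  · simp only [Off, mem_ofPred_eq, not_forall, not_not] at hoff
    obtain ⟨k, hk⟩ := hoff
    -- general statement for half balls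
    have key : ∀ α : Eu n →ₗ[ℝ] ℝ, (α = a k ∨ α = - a k) →
        ∃ i, ∀ v ∈ ball x r, 0 ≤ α (v - x) → v ∈ C i := by
      intro α hα
      have hα0 : α ≠ 0 := by
        rcases hα with rfl | rfl
        · exact ha k
        · simpa using ha k
      have hαz : ∀ z, a k z = b k → α (z - x) = 0 := by
        intro z hz
        rcases hα with rfl | rfl <;> simp [hz, hk]
      obtain ⟨e, he⟩ := exists_eq_one hα0
      let S := ball x r ∩ {z | α x < α z}
      have hS : Convex ℝ S := (convex_ball x r).inter (convex_halfSpace_gt α.isLinear _)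
      have hSoff : S ⊆ Off a b := by
        intro z hz p hp
        have hxp : a p x = b p := by
          by_contra h
          exact hball z hz.1 p h hp
        have heq := hx p k hxp hk
        have : z ∈ HP (a k) (b k) := heq ▸ hp
        have h0 := hαz z this
        have h1 : α x < α z := hz.2
        rw [map_sub] at h0
        linarith
      have push : ∀ v ∈ ball x r, 0 ≤ α (v - x) → ∀ s ∈ 𝓝 v, ∃ w ∈ s, w ∈ S := by
        intro v hv h0 s hs
        obtain ⟨t, ht, h1, -⟩ := small_add v e (inter_mem hs (isOpen_ball.mem_nhds hv))
        refine ⟨_, h1.1, h1.2, ?_⟩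
        rw [map_sub] at h0
        simp only [mem_ofPred_eq, map_add, map_smul, he, smul_eq_mul]
        linarith
      obtain ⟨u, -, hu⟩ := push x (mem_ball_self hr) (by simp) univ univ_mem
      obtain ⟨i, hi⟩ := hmem u
      have hSi := convex_off_subset hC hS hSoff hu hi
      refine ⟨i, fun v hv h0 => ?_⟩
      rw [← (piece_isClosed hC i).closure_eq]
      refine closure_mono hSi ?_
      rw [mem_closure_iff_nhds]
      intro s hs
      obtain ⟨w, h1, h2⟩ := push v hv h0 s hs
      exact ⟨w, h1, h2⟩
    obtain ⟨i, hi⟩ := key _ (Or.inl rfl)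
    obtain ⟨j, hj⟩ := key _ (Or.inr rfl)
    refine ⟨i, j, a k, r, hr, fun h => absurd h (ha k), hi, fun v hv h0 => hj v hv ?_⟩
    simpa using h0

end pieces

lemma rank_one_update {A B : Eu n →ₗ[ℝ] Eu n} (hA : LinearMap.det A ≠ 0) {α : Eu n →ₗ[ℝ] ℝ}
    (h0 : α = 0 → A = B) (hk : ∀ v, α v = 0 → A v = B v) :
    ∃ u, (∀ v, B v = A (v + α v • u)) ∧ LinearMap.det B = LinearMap.det A * (1 + α u) := by
  obtain ⟨u, hu⟩ : ∃ u, ∀ v, B v = A (v + α v • u) := by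
    by_cases hα : α = 0
    · exact ⟨0, fun v => by simp [h0 hα]⟩
    · obtain ⟨e, he⟩ := exists_eq_one hα
      let L := LinearMap.equivOfDetNeZero A hA
      have hL : ∀ v, A (L.symm v) = v := fun v => L.apply_symm_apply v
      refine ⟨L.symm (B e - A e), fun v => ?_⟩
      have := hk (v - α v • e) (by simp [he])
      rw [map_add, map_smul, hL]
      simp only [map_sub, map_smul] at this
      rw [smul_sub, eq_comm, ← sub_eq_zero]
      rw [← sub_eq_zero] at this
      rw [← this]
      abel
  refine ⟨u, hu, ?_⟩
  have : B = A ∘ₗ LinearMap.transvection α u := by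
    ext1 v
    simp [hu, LinearMap.transvection.apply]
  rw [this, LinearMap.det_comp, LinearMap.transvection.det]

/-- the folding homeomorphism -/
noncomputable def bend (α : Eu n →ₗ[ℝ] ℝ) (u : Eu n) (h : 0 < 1 + α u) : Eu n ≃ₜ Eu n where
  toFun v := v + min (α v) 0 • u
  invFun w := w - (min (α w) 0 / (1 + α u)) • u
  left_inv v := by
    have h1 : α (v + min (α v) 0 • u) = α v + min (α v) 0 * α u := by simp
    simp only [h1]
    rcases le_total (α v) 0 with hv | hv
    · rw [min_eq_left hv]
      have h2 : α v + α v * α u = α v * (1 + α u) := by ring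
      rw [h2, min_eq_left (mul_nonpos_of_nonpos_of_nonneg hv h.le),
        mul_div_assoc, div_self h.ne', mul_one]
      abel
    · simp [hv]
  right_inv w := by
    have h1 : α (w - (min (α w) 0 / (1 + α u)) • u) =
      α w - min (α w) 0 / (1 + α u) * α u := by simp
    simp only [h1]
    rcases le_total (α w) 0 with hv | hv
    · rw [min_eq_left hv]
      have h2 : α w - α w / (1 + α u) * α u = α w / (1 + α u) := by field_simp; ring
      rw [h2, min_eq_left (div_nonpos_of_nonpos_of_nonneg hv h.le)]
      abel
    · simp [hv]
  continuous_toFun := by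
    have := cont_fun α
    fun_prop
  continuous_invFun := by
    have := cont_fun α
    fun_prop

section pa

variable {N : ℕ} {C : Fin N → Set (Eu n)} {ι : Type} [Finite ι]
  {a : ι → (Eu n →ₗ[ℝ] ℝ)} {b : ι → ℝ} {idx : ι → Fin N} {f : Eu n → Eu n}
  {F : Fin N → (Eu n →ᵃ[ℝ] Eu n)}

lemma aff_sub (G : Eu n →ᵃ[ℝ] Eu n) (x v : Eu n) : G v = G x + G.linear (v - x) := by
  have := G.linearMap_vsub v x
  simp only [vsub_eq_sub] at this
  rw [this]; abel

lemma local_form (ha : ∀ p, a p ≠ 0) (hC : ∀ i x, x ∈ C i ↔ ∀ p, idx p = i → a p x ≤ b p)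
    (hcov : (⋃ i, C i) = Set.univ) (hf : ∀ i, ∀ x ∈ C i, f x = F i x)
    (hdet : ∀ i, LinearMap.det (F i).linear ≠ 0) {x : Eu n} (hx : x ∈ Good a b) :
    ∃ (i j : Fin N) (α : Eu n →ₗ[ℝ] ℝ) (u : Eu n) (r : ℝ), 0 < r ∧
      (∀ v ∈ ball x r, v ∈ C i ∨ v ∈ C j) ∧
      (∀ v ∈ ball x r, f v = f x + (F i).linear ((v - x) + min (α (v - x)) 0 • u)) ∧
      LinearMap.det (F j).linear = LinearMap.det (F i).linear * (1 + α u) := by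
  obtain ⟨i, j, α, r, hr, h0, hi, hj⟩ := half_balls ha hC hcov hx
  have hxi : x ∈ C i := hi x (mem_ball_self hr) (by simp)
  have hxj : x ∈ C j := hj x (mem_ball_self hr) (by simp)
  have hfi : ∀ v ∈ C i, f v = f x + (F i).linear (v - x) := fun v hv => by
    rw [hf i v hv, hf i x hxi, ← aff_sub]
  have hfj : ∀ v ∈ C j, f v = f x + (F j).linear (v - x) := fun v hv => by
    rw [hf j v hv, hf j x hxj, ← aff_sub]
  obtain ⟨u, hu, hd⟩ := rank_one_update (A := (F i).linear) (B := (F j).linear) (hdet i) (α := α)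
    (fun h => by rw [h0 h]) (by
      intro v hv
      obtain ⟨t, ht, h1, -⟩ := small_add x v (ball_mem_nhds x hr)
      have e1 := hfi _ (hi _ h1 (by simp [hv]))
      have e2 := hfj _ (hj _ h1 (by simp [hv]))
      rw [e1] at e2
      have e3 := add_left_cancel e2
      simp only [add_sub_cancel_left, map_smul] at e3
      exact smul_right_injective _ ht.ne' e3)
  refine ⟨i, j, α, u, r, hr, ?_, ?_, hd⟩
  · intro v hv
    rcases le_total 0 (α (v - x)) with h | h
    · exact Or.inl (hi v hv h)
    · exact Or.inr (hj v hv h)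
  · intro v hv
    rcases le_total 0 (α (v - x)) with h | h
    · rw [hfi v (hi v hv h), min_eq_right h]; simp
    · rw [hfj v (hj v hv h), min_eq_left h, hu]

end pa

lemma aff_homeo (G : Eu n →ᵃ[ℝ] Eu n) (h : LinearMap.det G.linear ≠ 0) :
    ∃ g : Eu n ≃ₜ Eu n, ∀ x, g x = G x := by
  refine ⟨(LinearMap.equivOfDetNeZero G.linear h).toContinuousLinearEquiv.toHomeomorph.trans
    (Homeomorph.addRight (G 0)), fun x => ?_⟩
  rw [aff_sub G 0 x, add_comm]
  simp only [sub_zero]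
  rfl

section main

variable {N : ℕ} {C : Fin N → Set (Eu n)} {ι : Type} [Finite ι]
  {a : ι → (Eu n →ₗ[ℝ] ℝ)} {b : ι → ℝ} {idx : ι → Fin N} {f : Eu n → Eu n}
  {F : Fin N → (Eu n →ᵃ[ℝ] Eu n)}

lemma det_ne_of_injective (hne : ∀ i, (interior (C i)).Nonempty)
    (hf : ∀ i, ∀ x ∈ C i, f x = F i x) (hinj : Function.Injective f) (i : Fin N) :
    LinearMap.det (F i).linear ≠ 0 := by
  intro h0
  obtain ⟨x, hx⟩ := hne i
  have := LinearMap.bot_lt_ker_of_det_eq_zero h0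
  obtain ⟨v, hv, hv0⟩ := (Submodule.ne_bot_iff _).1 this.ne'
  obtain ⟨t, ht, h1, -⟩ := small_add x v (mem_interior_iff_mem_nhds.1 hx)
  have e : f (x + t • v) = f x := by
    rw [hf i _ h1, hf i _ (interior_subset hx), aff_sub (F i) x]
    simp [LinearMap.mem_ker.1 hv]
  have := hinj e
  simp [ht.ne', hv0] at this

/-- if the map folds at a good point then it is not injective -/
lemma fold_not_injective {x : Eu n} {A : Eu n →ₗ[ℝ] Eu n} {α : Eu n →ₗ[ℝ] ℝ} {u : Eu n} {r : ℝ}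
    (hr : 0 < r) (h : ∀ v ∈ ball x r, f v = f x + A ((v - x) + min (α (v - x)) 0 • u))
    (hc : 1 + α u < 0) : ¬ Function.Injective f := by
  intro hinj
  have hα : α ≠ 0 := by
    rintro rfl
    simp at hc
    linarith
  obtain ⟨e, he⟩ := exists_eq_one hα
  obtain ⟨s, hs, h1, h2⟩ : ∃ t : ℝ, 0 < t ∧ x - t • e ∈ ball x r ∧
      x - t • (e + u) ∈ ball x r := by
    have t1 : Continuous (fun t : ℝ => x - t • e) := by fun_prop
    have t2 : Continuous (fun t : ℝ => x - t • (e + u)) := by fun_prop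
    have s1 := t1.tendsto 0
    have s2 := t2.tendsto 0
    simp only [zero_smul, sub_zero] at s1 s2
    have h3 := (s1.eventually (ball_mem_nhds x hr)).and (s2.eventually (ball_mem_nhds x hr))
    have h4 := (nhdsWithin_le_nhds (s := Ioi (0:ℝ)) h3)
    obtain ⟨t, ht, ht'⟩ := (Filter.Eventually.and h4 self_mem_nhdsWithin).exists
    exact ⟨t, ht', ht⟩
  have e1 : f (x - s • e) = f x + A (-(s • e) + (-s) • u) := by
    rw [h _ h1]
    have : α (x - s • e - x) = -s := by simp [he]
    rw [this, min_eq_left (by linarith)]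
    congr 3
    abel
  have e2 : f (x - s • (e + u)) = f x + A (-(s • e) + (-s) • u) := by
    rw [h _ h2]
    have : α (x - s • (e + u) - x) = -s * (1 + α u) := by
      simp [he]
      try ring
    rw [this, min_eq_right (mul_nonneg_of_nonpos_of_nonpos (by linarith) hc.le)]
    congr 2
    rw [zero_smul, smul_add, neg_smul]
    abel
  have h3 := hinj (e1.trans e2.symm)
  have h4 : s • u = 0 := by
    rw [smul_add] at h3
    have := sub_right_injective h3
    simpa using this
  have h5 : u = 0 := (smul_eq_zero.1 h4).resolve_left hs.ne'
  rw [h5] at hc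
  simp at hc
  linarith

lemma same_sign_of_injective (ha : ∀ p, a p ≠ 0)
    (hC : ∀ i x, x ∈ C i ↔ ∀ p, idx p = i → a p x ≤ b p)
    (hne : ∀ i, (interior (C i)).Nonempty)
    (hcov : (⋃ i, C i) = Set.univ)
    (hdisj : ∀ i j, i ≠ j → interior (C i) ∩ interior (C j) = ∅)
    (hf : ∀ i, ∀ x ∈ C i, f x = F i x) (hinj : Function.Injective f) :
    (∀ i, 0 < LinearMap.det (F i).linear) ∨ (∀ i, LinearMap.det (F i).linear < 0) := by
  have hdet := det_ne_of_injective hne hf hinj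
  have huniq : ∀ z ∈ Off a b, ∀ i j, z ∈ C i → z ∈ C j → i = j := by
    intro z hz i j hi hj
    by_contra hij
    have : z ∈ interior (C i) ∩ interior (C j) :=
      ⟨off_mem_interior hC hi hz, off_mem_interior hC hj hz⟩
    rw [hdisj i j hij] at this
    exact this
  have hmem : ∀ z, ∃ i, z ∈ C i := fun z => by
    have : z ∈ ⋃ i, C i := hcov ▸ mem_univ z
    simpa using this
  let P : Set (Eu n) := {x | ∀ᶠ z in 𝓝 x, z ∈ Off a b → ∀ m, z ∈ C m →
    0 < LinearMap.det (F m).linear}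
  let Q : Set (Eu n) := {x | ∀ᶠ z in 𝓝 x, z ∈ Off a b → ∀ m, z ∈ C m →
    LinearMap.det (F m).linear < 0}
  have hP : IsOpen P := isOpen_setOfPred_eventually_nhds
  have hQ : IsOpen Q := isOpen_setOfPred_eventually_nhds
  have hPQ : Good a b ∩ univ ⊆ P ∪ Q := by
    rintro x ⟨hx, -⟩
    obtain ⟨i, j, α, u, r, hr, hij, hform, hd⟩ := local_form ha hC hcov hf hdet hx
    have hpos : 0 < 1 + α u := by
      rcases lt_trichotomy (1 + α u) 0 with h | h | h
      · exact absurd hinj (fold_not_injective hr hform h)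
      · rw [h, mul_zero] at hd
        exact absurd hd (hdet j)
      · exact h
    rcases lt_or_gt_of_ne (hdet i) with hi | hi
    · right
      have hj : LinearMap.det (F j).linear < 0 := by rw [hd]; exact mul_neg_of_neg_of_pos hi hpos
      filter_upwards [ball_mem_nhds x hr] with z hz ho m hm
      rcases hij z hz with h | h
      · rwa [huniq z ho m i hm h]
      · rwa [huniq z ho m j hm h]
    · left
      have hj : 0 < LinearMap.det (F j).linear := by rw [hd]; exact mul_pos hi hpos
      filter_upwards [ball_mem_nhds x hr] with z hz ho m hm
      rcases hij z hz with h | h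
      · rwa [huniq z ho m i hm h]
      · rwa [huniq z ho m j hm h]
  have hpre := preconnected_good ha b isOpen_univ convex_univ
  by_contra hcon
  push Not at hcon
  obtain ⟨⟨i, hi⟩, ⟨j, hj⟩⟩ := hcon
  have hi' : LinearMap.det (F i).linear < 0 := lt_of_le_of_ne hi (hdet i)
  have hj' : 0 < LinearMap.det (F j).linear := lt_of_le_of_ne hj (hdet j).symm
  obtain ⟨x, hxo, hx⟩ := (dense_off ha b).exists_mem_open isOpen_interior (hne i)
  obtain ⟨y, hyo, hy⟩ := (dense_off ha b).exists_mem_open isOpen_interior (hne j)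
  have hxQ : x ∈ Q := by
    have : ∀ᶠ z in 𝓝 x, z ∈ C i := mem_interior_iff_mem_nhds.1 hx
    filter_upwards [this] with z hz ho m hm
    rwa [huniq z ho m i hm hz]
  have hyP : y ∈ P := by
    have : ∀ᶠ z in 𝓝 y, z ∈ C j := mem_interior_iff_mem_nhds.1 hy
    filter_upwards [this] with z hz ho m hm
    rwa [huniq z ho m j hm hz]
  obtain ⟨w, -, hwP, hwQ⟩ := hpre P Q hP hQ hPQ
    ⟨y, ⟨off_subset_good a b hyo, mem_univ _⟩, hyP⟩
    ⟨x, ⟨off_subset_good a b hxo, mem_univ _⟩, hxQ⟩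
  obtain ⟨z, hzo, hz⟩ := (mem_closure_iff_nhds.1 (dense_off ha b w)) _ (inter_mem hwP hwQ) |>.imp
    fun z hz => And.intro hz.2 hz.1
  obtain ⟨m, hm⟩ := hmem z
  exact lt_asymm (hz.1 hzo m hm) (hz.2 hzo m hm)

lemma exists_regular_of_injective (ha : ∀ p, a p ≠ 0)
    (hC : ∀ i x, x ∈ C i ↔ ∀ p, idx p = i → a p x ≤ b p) (hinj : Function.Injective f) :
    ∃ y₀ : Eu n, y₀ ∉ (⋃ i, f '' frontier (C i)) ∧ ∃! x : Eu n, f x = y₀ := by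
  obtain ⟨x, hx⟩ := (dense_off ha b).nonempty
  refine ⟨f x, ?_, x, rfl, fun y hy => hinj hy⟩
  intro h
  obtain ⟨i, z, hz, hzx⟩ := mem_iUnion.1 h
  obtain rfl := hinj hzx
  have : z ∈ C i := by
    rw [← (piece_isClosed hC i).closure_eq]
    exact hz.1
  exact hz.2 (off_mem_interior hC this hx)

/-- the local homeomorphism property at good points -/
lemma local_homeo (ha : ∀ p, a p ≠ 0) (hC : ∀ i x, x ∈ C i ↔ ∀ p, idx p = i → a p x ≤ b p)
    (hcov : (⋃ i, C i) = Set.univ) (hf : ∀ i, ∀ x ∈ C i, f x = F i x)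
    (hsign : ∀ i j, 0 < LinearMap.det (F i).linear * LinearMap.det (F j).linear)
    {x : Eu n} (hx : x ∈ Good a b) : ∃ g : Eu n ≃ₜ Eu n, f =ᶠ[𝓝 x] g := by
  have hdet : ∀ i, LinearMap.det (F i).linear ≠ 0 := fun i h => by
    have := hsign i i
    rw [h] at this
    simp at this
  obtain ⟨i, j, α, u, r, hr, hij, hform, hd⟩ := local_form ha hC hcov hf hdet hx
  have hpos : 0 < 1 + α u := by
    have := hsign i j
    rw [hd, ← mul_assoc] at this
    exact pos_of_mul_pos_right this (mul_self_nonneg _)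
  obtain ⟨g, hg⟩ := aff_homeo (F i) (hdet i)
  refine ⟨((Homeomorph.addRight (-x)).trans (bend α u hpos)).trans
    (g.trans (Homeomorph.addRight (f x - F i 0))), ?_⟩
  filter_upwards [ball_mem_nhds x hr] with v hv
  rw [hform v hv]
  have : ∀ w, f x + (F i).linear w = g w + (f x - F i 0) := by
    intro w
    rw [hg, aff_sub (F i) 0 w, sub_zero]
    abel
  rw [this]
  simp [bend, sub_eq_add_neg]

end main

lemma image_nhds_of_local_homeo {f : Eu n → Eu n} {x : Eu n} {g : Eu n ≃ₜ Eu n}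
    (hg : f =ᶠ[𝓝 x] g) {U : Set (Eu n)} (hU : U ∈ 𝓝 x) : f '' U ∈ 𝓝 (f x) := by
  have h1 : map f (𝓝 x) = 𝓝 (f x) := by
    rw [Filter.map_congr hg, g.map_nhds_eq, hg.eq_of_nhds]
  rw [← h1]
  exact image_mem_map hU

/-- the topological core of the argument -/
lemma top_core {f : Eu n → Eu n} (hcont : Continuous f) (hclosed : IsClosedMap f)
    (hfin : ∀ y, {x | f x = y}.Finite) {G : Set (Eu n)} (hGd : Dense G)
    (hGc : ∀ V, IsOpen V → Convex ℝ V → IsPreconnected (G ∩ V))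
    (hloc : ∀ x, f x ∈ G → ∃ g : Eu n ≃ₜ Eu n, f =ᶠ[𝓝 x] g)
    (hhit : ∀ U, IsOpen U → U.Nonempty → ∃ x ∈ U, f x ∈ G)
    {x₀ : Eu n} (huniq : ∀ x, f x = f x₀ → x = x₀) (hloc₀ : ∃ g : Eu n ≃ₜ Eu n, f =ᶠ[𝓝 x₀] g) :
    ∃ g : Eu n ≃ₜ Eu n, ⇑g = f := by
  -- `f` is open
  have hopen : ∀ x, ∀ U ∈ 𝓝 x, f '' U ∈ 𝓝 (f x) := by
    intro x U hU
    have hfib : ({z | f z = f x} \ {x})ᶜ ∈ 𝓝 x :=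
      ((hfin (f x)).subset sdiff_subset).isClosed.isOpen_compl.mem_nhds (by simp)
    obtain ⟨r, hr, hrU⟩ := Metric.nhds_basis_closedBall.mem_iff.1 (inter_mem hU hfib)
    have hyS : f x ∉ f '' sphere x r := by
      rintro ⟨z, hz, hzx⟩
      have h1 := (hrU (sphere_subset_closedBall hz)).2
      have h2 : z = x := by
        by_contra hne
        exact h1 ⟨hzx, hne⟩
      rw [h2] at hz
      simp at hz
      exact hr.ne hz
    obtain ⟨δ, hδ, hV⟩ := Metric.isOpen_iff.1
      (hclosed _ (isClosed_sphere (x := x) (ε := r))).isOpen_compl _ hyS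
    have hK : IsClosed (f '' closedBall x r) := hclosed _ isClosed_closedBall
    have hsub : G ∩ ball (f x) δ ⊆ f '' closedBall x r := by
      by_contra hcon
      obtain ⟨z, hz, hzK⟩ := not_subset.1 hcon
      have hcover : G ∩ ball (f x) δ ⊆ interior (f '' ball x r) ∪ (f '' closedBall x r)ᶜ := by
        intro y hy
        by_cases hyK : y ∈ f '' closedBall x r
        · left
          obtain ⟨w, hw, rfl⟩ := hyK
          have hwb : w ∈ ball x r := by
            rcases eq_or_lt_of_le (mem_closedBall.1 hw) with h | h
            · exact absurd (mem_image_of_mem f (mem_sphere.2 h)) (hV hy.2)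
            · exact h
          obtain ⟨g, hg⟩ := hloc w hy.1
          exact mem_interior_iff_mem_nhds.2
            (image_nhds_of_local_homeo hg (isOpen_ball.mem_nhds hwb))
        · exact Or.inr hyK
      have hxpre : x ∈ f ⁻¹' ball (f x) δ := mem_preimage.2 (mem_ball_self hδ)
      obtain ⟨w, hw, hwG⟩ := hhit (ball x r ∩ f ⁻¹' ball (f x) δ)
        (isOpen_ball.inter (isOpen_ball.preimage hcont)) ⟨x, mem_ball_self hr, hxpre⟩
      obtain ⟨g, hg⟩ := hloc w hwG
      have hwint : f w ∈ interior (f '' ball x r) := mem_interior_iff_mem_nhds.2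
        (image_nhds_of_local_homeo hg (isOpen_ball.mem_nhds hw.1))
      obtain ⟨q, -, hq1, hq2⟩ := hGc (ball (f x) δ) isOpen_ball (convex_ball (f x) δ)
        (interior (f '' ball x r)) (f '' closedBall x r)ᶜ isOpen_interior
        hK.isOpen_compl hcover
        ⟨f w, ⟨hwG, hw.2⟩, hwint⟩
        ⟨z, hz, hzK⟩
      exact hq2 (image_mono ball_subset_closedBall (interior_subset hq1))
    have h1 : ball (f x) δ ⊆ f '' closedBall x r := by
      refine (hGd.open_subset_closure_inter isOpen_ball).trans ?_
      rw [inter_comm]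
      exact closure_minimal hsub hK
    exact mem_of_superset (ball_mem_nhds _ hδ)
      (h1.trans (image_mono fun z hz => (hrU hz).1))
  have hopen' : IsOpenMap f := by
    intro U hU
    rw [isOpen_iff_mem_nhds]
    rintro _ ⟨x, hx, rfl⟩
    exact hopen x U (hU.mem_nhds hx)
  have hsurj : Function.Surjective f := by
    have : IsClopen (range f) := ⟨hclosed.isClosed_range, hopen'.isOpen_range⟩
    rw [← range_eq_univ]
    exact this.eq_univ (range_nonempty f)
  let T : Set (Eu n) := {z | ∃ x₁ x₂, x₁ ≠ x₂ ∧ f x₁ = z ∧ f x₂ = z}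
  have hT : IsOpen T := by
    rw [isOpen_iff_mem_nhds]
    rintro z ⟨x₁, x₂, hne, h1, h2⟩
    obtain ⟨U₁, U₂, ho1, ho2, hm1, hm2, hd⟩ := t2_separation hne
    have i1 := hopen x₁ _ (ho1.mem_nhds hm1)
    have i2 := hopen x₂ _ (ho2.mem_nhds hm2)
    rw [h1] at i1
    rw [h2] at i2
    filter_upwards [i1, i2]
    rintro w ⟨w₁, hw1, e1⟩ ⟨w₂, hw2, e2⟩
    exact ⟨w₁, w₂, hd.ne_of_mem hw1 hw2, e1, e2⟩
  have hTc : ∀ x, f x ∉ T → (∃ g : Eu n ≃ₜ Eu n, f =ᶠ[𝓝 x] g) → f x ∈ interior Tᶜ := by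
    rintro x hx ⟨g, hg⟩
    obtain ⟨U, hUg, hUo, hxU⟩ := _root_.eventually_nhds_iff.1 hg
    rw [mem_interior]
    refine ⟨(f '' Uᶜ)ᶜ, ?_, (hclosed _ hUo.isClosed_compl).isOpen_compl, ?_⟩
    · rintro z hz ⟨x₁, x₂, hne, h1, h2⟩
      have m1 : x₁ ∈ U := by
        by_contra h
        exact hz ⟨x₁, h, h1⟩
      have m2 : x₂ ∈ U := by
        by_contra h
        exact hz ⟨x₂, h, h2⟩
      apply hne
      apply g.injective
      rw [← hUg _ m1, ← hUg _ m2, h1, h2]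
    · rintro ⟨w, hw, hwx⟩
      apply hx
      refine ⟨w, x, ?_, hwx, rfl⟩
      rintro rfl
      exact hw hxU
  have hGT : ∀ z ∈ G, z ∉ T := by
    intro z hz hzT
    have h0 : f x₀ ∈ interior Tᶜ := by
      refine hTc x₀ ?_ hloc₀
      rintro ⟨x₁, x₂, hne, h1, h2⟩
      exact hne ((huniq _ h1).trans (huniq _ h2).symm)
    obtain ⟨y, hyG, hy⟩ := hGd.exists_mem_open isOpen_interior ⟨_, h0⟩
    obtain ⟨q, -, hq1, hq2⟩ := hGc univ isOpen_univ convex_univ T (interior Tᶜ) hT isOpen_interior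
      (by
        rintro w ⟨hw, -⟩
        by_cases hwT : w ∈ T
        · exact Or.inl hwT
        · right
          obtain ⟨x, rfl⟩ := hsurj w
          exact hTc x hwT (hloc x hw))
      ⟨z, ⟨hz, mem_univ _⟩, hzT⟩ ⟨y, ⟨hyG, mem_univ _⟩, hy⟩
    exact interior_subset hq2 hq1
  have hinj : Function.Injective f := by
    intro x₁ x₂ h
    by_contra hne
    obtain ⟨z, hz, hzT⟩ := hGd.exists_mem_open hT ⟨f x₂, x₁, x₂, hne, h, rfl⟩
    exact hGT z hz hzT
  exact ⟨(Equiv.ofBijective f ⟨hinj, hsurj⟩).toHomeomorphOfContinuousOpen hcont hopen', rfl⟩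

lemma homeo_of_conditions {N : ℕ} {C : Fin N → Set (Eu n)} {ι : Type} [Finite ι]
    {a : ι → (Eu n →ₗ[ℝ] ℝ)} {b : ι → ℝ} {idx : ι → Fin N} {f : Eu n → Eu n}
    {F : Fin N → (Eu n →ᵃ[ℝ] Eu n)} (ha : ∀ p, a p ≠ 0)
    (hC : ∀ i x, x ∈ C i ↔ ∀ p, idx p = i → a p x ≤ b p)
    (hcov : (⋃ i, C i) = Set.univ) (hf : ∀ i, ∀ x ∈ C i, f x = F i x)
    (hsign : ∀ i j, 0 < LinearMap.det (F i).linear * LinearMap.det (F j).linear)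
    {y₀ : Eu n} (hreg : y₀ ∉ (⋃ i, f '' frontier (C i))) (hy₀ : ∃! x : Eu n, f x = y₀) :
    ∃ g : Eu n ≃ₜ Eu n, ⇑g = f := by
  have hdet : ∀ i, LinearMap.det (F i).linear ≠ 0 := fun i h => by
    have := hsign i i
    rw [h] at this
    simp at this
  choose g hg using fun i => aff_homeo (F i) (hdet i)
  have hfg : ∀ i, ∀ x ∈ C i, f x = g i x := fun i x hx => by rw [hg, hf i x hx]
  have hmem : ∀ z, ∃ i, z ∈ C i := fun z => by
    have : z ∈ ⋃ i, C i := hcov ▸ mem_univ z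
    simpa using this
  have hcl := piece_isClosed hC
  have hcont : Continuous f := (locallyFinite_of_finite C).continuous hcov hcl
    fun i => (g i).continuous.continuousOn.congr (hfg i)
  have hclosed : IsClosedMap f := by
    intro S hS
    have : f '' S = ⋃ i, g i '' (S ∩ C i) := by
      ext y
      simp only [mem_image, mem_iUnion]
      constructor
      · rintro ⟨x, hx, rfl⟩
        obtain ⟨i, hi⟩ := hmem x
        exact ⟨i, x, ⟨hx, hi⟩, (hfg i x hi).symm⟩
      · rintro ⟨i, x, ⟨hx, hi⟩, rfl⟩
        exact ⟨x, hx, hfg i x hi⟩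
    rw [this]
    exact isClosed_iUnion_of_finite fun i => (g i).isClosedMap _ (hS.inter (hcl i))
  have hfin : ∀ y, {x | f x = y}.Finite := by
    intro y
    refine (finite_range fun i => (g i).symm y).subset ?_
    intro x hx
    obtain ⟨i, hi⟩ := hmem x
    refine ⟨i, ?_⟩
    have hx' : f x = y := hx
    simp only
    rw [← hx', hfg i x hi, Homeomorph.symm_apply_apply]
  -- hyperplanes in the target
  let L := fun i => LinearMap.equivOfDetNeZero (F i).linear (hdet i)
  let a' : ι × Fin N → (Eu n →ₗ[ℝ] ℝ) := fun q => a q.1 ∘ₗ (L q.2).symm.toLinearMap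
  let b' : ι × Fin N → ℝ := fun q => b q.1 + a q.1 ((L q.2).symm (F q.2 0))
  have ha' : ∀ q, a' q ≠ 0 := by
    intro q h
    apply ha q.1
    ext1 v
    have := LinearMap.congr_fun h (L q.2 v)
    simpa [a'] using this
  have hHP : ∀ p i x, a' (p, i) (F i x) = b' (p, i) ↔ a p x = b p := by
    intro p i x
    have : F i x = F i 0 + L i x := by
      have := aff_sub (F i) 0 x
      rw [sub_zero] at this
      exact this
    rw [this]
    simp only [a', b', LinearMap.comp_apply, LinearEquiv.coe_coe, map_add,
      LinearEquiv.symm_apply_apply]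
    constructor <;> intro h <;> linarith
  have hgood : ∀ x, f x ∈ Good a' b' → x ∈ Good a b := by
    intro x hx k l hk hl
    obtain ⟨i, hi⟩ := hmem x
    rw [hf i x hi] at hx
    have h1 := hx (k, i) (l, i) ((hHP k i x).2 hk) ((hHP l i x).2 hl)
    ext z
    have h2 : F i z ∈ HP (a' (k, i)) (b' (k, i)) ↔ F i z ∈ HP (a' (l, i)) (b' (l, i)) := by rw [h1]
    exact ((hHP k i z).symm.trans h2).trans (hHP l i z)
  obtain ⟨x₀, hx₀, hu⟩ := hy₀
  refine top_core (G := Good a' b') (x₀ := x₀) hcont hclosed hfin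
    ((dense_off ha' b').mono (off_subset_good a' b'))
    (fun V hV hVc => preconnected_good ha' b' hV hVc)
    (fun x hx => local_homeo ha hC hcov hf hsign (hgood x hx)) ?_
    (fun x hx => hu x (hx.trans hx₀)) ?_
  · intro U hU hUne
    obtain ⟨x, hxo, hx⟩ := (dense_off ha b).exists_mem_open hU hUne
    obtain ⟨i, hi⟩ := hmem x
    have hxi := off_mem_interior hC hi hxo
    obtain ⟨y, hy, w, hw, rfl⟩ := (dense_off ha' b').exists_mem_open
      ((g i).isOpenMap _ (hU.inter isOpen_interior)) ⟨_, x, ⟨hx, hxi⟩, rfl⟩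
    refine ⟨w, hw.1, ?_⟩
    rw [hfg i w (interior_subset hw.2)]
    exact off_subset_good _ _ hy
  · obtain ⟨i, hi⟩ := hmem x₀
    have hxin : x₀ ∈ interior (C i) := by
      by_contra h
      exact hreg (mem_iUnion.2 ⟨i, x₀, ⟨subset_closure hi, h⟩, hx₀⟩)
    refine ⟨g i, ?_⟩
    filter_upwards [mem_interior_iff_mem_nhds.1 hxin] with z hz
    exact hfg i z hz

end PA

/-- A piecewise affine map `f : ℝⁿ → ℝⁿ` is a homeomorphism of `ℝⁿ`
onto `ℝⁿ` iff (1) all Jacobians have the same sign (all positive or all negative), and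
(2) some regular value `y₀` (i.e. `y₀ ∉ ⋃ i, f '' frontier (C i)`) has exactly one
preimage. -/
theorem piecewise_affine_isomorphism_iff
    {n N : ℕ} (f : Eu n → Eu n) (F : Fin N → (Eu n →ᵃ[ℝ] Eu n))
    (C : Fin N → Set (Eu n)) (hpa : IsPiecewiseAffine f F C) :
    (∃ g : Eu n ≃ₜ Eu n, ⇑g = f) ↔
      (((∀ i, 0 < LinearMap.det (F i).linear) ∨ (∀ i, LinearMap.det (F i).linear < 0)) ∧
        ∃ y₀ : Eu n, y₀ ∉ (⋃ i, f '' frontier (C i)) ∧ ∃! x : Eu n, f x = y₀) := by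

  obtain ⟨hpoly, hne, hcov, hdisj, hf⟩ := hpa
  obtain ⟨ι, _, a, b, idx, ha, hC⟩ := PA.exists_presentation hpoly hne
  constructor
  · rintro ⟨g, rfl⟩
    exact ⟨PA.same_sign_of_injective ha hC hne hcov hdisj hf g.injective,
      PA.exists_regular_of_injective ha hC g.injective⟩
  · rintro ⟨hs, y₀, hreg, hy₀⟩
    refine PA.homeo_of_conditions ha hC hcov hf ?_ hreg hy₀
    intro i j
    rcases hs with h | h
    · exact mul_pos (h i) (h j)
    · exact mul_pos_of_neg_of_neg (h i) (h j)
end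

section
/- Let f : ℝⁿ → ℝⁿ be piecewise affine with pieces (f_i, C_i), i = 1,…,N, and suppose J_i > 0 for every i. Then f is an open map: the image under f of every open subset of ℝⁿ is open. -/
open Set Filter Topology

/-- Linear independence of two affine functionals. -/
def AffIndep {n : ℕ} (a b : Eu n →ᵃ[ℝ] ℝ) : Prop :=
  ∀ s t : ℝ, s • a + t • b = 0 → s = 0 ∧ t = 0

theorem key_det {n : ℕ} (A B : Eu n →ₗ[ℝ] Eu n) (hA : 0 < LinearMap.det A)
    (hB : 0 < LinearMap.det B) (l : Eu n →ₗ[ℝ] ℝ) (h : ∀ v, l v = 0 → A v = B v)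
    (p q : Eu n) (hpq : A p = B q) (hp : l p < 0) (hq : 0 < l q) : False := by
  set u : Eu n := (l q)⁻¹ • (p - q) with hu
  have hB' : B = A ∘ₗ LinearMap.transvection l u := by
    ext1 v
    have h1 := h (v - (l v / l q) • q) (by simp; field_simp; simp)
    simp only [map_sub, map_smul] at h1
    simp only [LinearMap.comp_apply, LinearMap.transvection.apply, map_add, map_smul, hu, map_sub]
    rw [hpq, smul_smul]
    rw [div_eq_mul_inv] at h1
    rw [smul_sub, ← sub_eq_zero] at *
    rw [← neg_eq_zero, ← h1]
    abel
  have h2 : LinearMap.det B = LinearMap.det A * (1 + l u) := by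
    rw [hB', LinearMap.det_comp, LinearMap.transvection.det]
  have h3 : 1 + l u = l p / l q := by
    simp [hu]; field_simp; ring
  rw [h2, h3] at hB
  have : l p / l q < 0 := div_neg_of_neg_of_pos hp hq
  nlinarith

theorem exists_generic {n : ℕ} {Q : Type*} [Finite Q] (a : Q → (Eu n →ᵃ[ℝ] ℝ))
    (ha : ∀ q, a q ≠ 0) (U : Set (Eu n)) (hU : IsOpen U) (hne : U.Nonempty) :
    ∃ x ∈ U, ∀ q, a q x ≠ 0 := by
  have h0 : ∀ q, MeasureTheory.volume {x | a q x = 0} = 0 := by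
    intro q
    let s : AffineSubspace ℝ (Eu n) := (AffineSubspace.mk' (0:ℝ) ⊥).comap (a q)
    have hs : (s : Set (Eu n)) = {x | a q x = 0} := by
      ext x; simp [s]
    rw [← hs]
    apply MeasureTheory.Measure.addHaar_affineSubspace
    intro htop
    apply ha q
    ext x
    have : x ∈ (s : Set (Eu n)) := by rw [htop]; simp
    rw [hs] at this
    simpa using this
  have h1 : MeasureTheory.volume (⋃ q, {x | a q x = 0}) = 0 :=
    MeasureTheory.measure_iUnion_null h0
  have h2 := hU.measure_pos MeasureTheory.volume hne
  by_contra! hcon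
  have h3 : U ⊆ ⋃ q, {x | a q x = 0} := fun x hx => by
    obtain ⟨q, hq⟩ := hcon x hx
    exact mem_iUnion.2 ⟨q, hq⟩
  have := MeasureTheory.measure_mono (μ := MeasureTheory.volume) h3
  rw [h1] at this
  exact absurd h2 (not_lt.2 this)

theorem AffIndep.ne_left {n : ℕ} {a b : Eu n →ᵃ[ℝ] ℝ} (h : AffIndep a b) : a ≠ 0 := by
  rintro rfl
  have := (h 1 0 (by simp)).1
  norm_num at this

theorem thin_connected {n : ℕ} {Q : Type*} [Finite Q] (a b : Q → (Eu n →ᵃ[ℝ] ℝ))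
    (hab : ∀ q, AffIndep (a q) (b q)) (y₀ : Eu n) (δ : ℝ) :
    IsPreconnected (Metric.ball y₀ δ \ {y | ∃ q, a q y = 0 ∧ b q y = 0}) := by
  set T := {y | ∃ q, a q y = 0 ∧ b q y = 0} with hT
  have key : ∀ x ∉ T, ∀ z, (∀ q, (a q x • b q - b q x • a q) z ≠ 0) → ∀ w ∈ segment ℝ x z, w ∉ T := by
    rintro x hx z hz w hw ⟨q, hwa, hwb⟩
    rw [segment_eq_image_lineMap] at hw
    obtain ⟨t, ht, rfl⟩ := hw
    rw [AffineMap.apply_lineMap, AffineMap.lineMap_apply] at hwa hwb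
    simp only [vsub_eq_sub, smul_eq_mul, vadd_eq_add] at hwa hwb
    have hq := hz q
    simp only [AffineMap.coe_sub, AffineMap.coe_smul, Pi.sub_apply, Pi.smul_apply, smul_eq_mul] at hq
    have h1 : t * (a q x * b q z - b q x * a q z) = 0 := by
      linear_combination (a q x) * hwb - (b q x) * hwa
    rcases mul_eq_zero.1 h1 with h | h
    · subst h
      exact hx ⟨q, by simpa using hwa, by simpa using hwb⟩
    · exact hq h
  have hne : ∀ x ∉ T, ∀ q, a q x • b q - b q x • a q ≠ 0 := by
    intro x hx q h
    have := hab q (-(b q x)) (a q x) (by rw [← h, neg_smul]; abel)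
    exact hx ⟨q, this.2, by simpa using this.1⟩
  apply isPreconnected_of_forall_pair
  rintro x ⟨hxb, hx⟩ y ⟨hyb, hy⟩
  obtain ⟨z, hzb, hz⟩ := exists_generic (Q := Q ⊕ Q)
    (Sum.elim (fun q => a q x • b q - b q x • a q) (fun q => a q y • b q - b q y • a q))
    (by rintro (q | q); exacts [hne x hx q, hne y hy q]) _ Metric.isOpen_ball ⟨x, hxb⟩
  have hzx := key x hx z (fun q => hz (Sum.inl q))
  have hzy := key y hy z (fun q => hz (Sum.inr q))
  refine ⟨segment ℝ x z ∪ segment ℝ y z, ?_, Or.inl (left_mem_segment ..),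
    Or.inr (left_mem_segment ..), ?_⟩
  · rintro w (hw | hw)
    · exact ⟨(convex_ball y₀ δ).segment_subset hxb hzb hw, hzx w hw⟩
    · exact ⟨(convex_ball y₀ δ).segment_subset hyb hzb hw, hzy w hw⟩
  · exact IsPreconnected.union z (right_mem_segment ..) (right_mem_segment ..)
      (convex_segment _ _).isPreconnected (convex_segment _ _).isPreconnected

theorem aff_cont {n : ℕ} (a : Eu n →ᵃ[ℝ] ℝ) : Continuous a :=
  AffineMap.continuous_of_finiteDimensional a

/-- One side of the wall `a = 0` near `x` is contained in a single cell. -/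
theorem one_side {n N : ℕ} (m : Fin N → ℕ) (φ : ∀ i, Fin (m i) → (Eu n →ᵃ[ℝ] ℝ))
    (hcov : ∀ x, ∃ i, ∀ j, φ i j x ≤ 0) (x : Eu n) (a : Eu n →ᵃ[ℝ] ℝ) (ha : a ≠ 0) (hax : a x = 0)
    (hm : ∀ i j, φ i j x = 0 → ∃ t : ℝ, φ i j = t • a) :
    ∃ i, ∀ᶠ z in 𝓝 x, 0 ≤ a z → ∀ j, φ i j z ≤ 0 := by
  obtain ⟨z₀, hz₀⟩ : ∃ z, 0 < a z := by
    by_contra! hcon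
    apply ha
    ext z
    have h1 := hcon z
    have h2 := hcon (AffineMap.lineMap x z (-1 : ℝ))
    rw [AffineMap.apply_lineMap, AffineMap.lineMap_apply] at h2
    simp [hax] at h2
    simp; linarith
  let γ : ℝ → Eu n := fun s => AffineMap.lineMap x z₀ s
  have hγ : Tendsto γ (𝓝[>] 0) (𝓝 x) := by
    have : Continuous γ := AffineMap.lineMap_continuous
    have h := this.tendsto 0
    simp only [γ, AffineMap.lineMap_apply_zero] at h
    exact h.mono_left nhdsWithin_le_nhds
  have hfr : ∃ i, ∃ᶠ s in 𝓝[>] (0:ℝ), ∀ j, φ i j (γ s) ≤ 0 := by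
    by_contra! hcon
    obtain ⟨s, hs⟩ := (eventually_all.2 hcon).exists
    obtain ⟨i, hi⟩ := hcov (γ s)
    obtain ⟨j, hj⟩ := hs i
    exact absurd (hi j) (not_le.2 hj)
  obtain ⟨i, hi⟩ := hfr
  refine ⟨i, ?_⟩
  have : ∀ j, ∀ᶠ z in 𝓝 x, 0 ≤ a z → φ i j z ≤ 0 := by
    intro j
    rcases lt_trichotomy (φ i j x) 0 with h | h | h
    · filter_upwards [(aff_cont (φ i j)).tendsto x |>.eventually_lt_const h] with z hz _ using hz.le
    · obtain ⟨t, ht⟩ := hm i j h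
      obtain ⟨s, hs, hs0⟩ := (hi.and_eventually self_mem_nhdsWithin).exists
      have h1 := hs j
      have hs0 : 0 < s := hs0
      simp only [γ] at h1
      rw [ht, AffineMap.apply_lineMap, AffineMap.lineMap_apply] at h1
      simp [hax] at h1
      have ht0 : t ≤ 0 := by
        by_contra! hc
        have : 0 < s * (t * a z₀) := by positivity
        linarith
      refine Eventually.of_forall fun z hz => ?_
      rw [ht]
      simp
      exact mul_nonpos_of_nonpos_of_nonneg ht0 hz
    · exfalso
      have h1 := hγ.eventually ((aff_cont (φ i j)).tendsto x |>.eventually_const_lt h)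
      obtain ⟨s, hs, hs0⟩ := (hi.and_eventually h1).exists
      exact absurd (hs j) (not_le.2 hs0)
  filter_upwards [eventually_all.2 this] with z hz h0 j using hz j h0

theorem local_open {n N : ℕ} (f : Eu n → Eu n) (G : Fin N → (Eu n ≃ᵃ[ℝ] Eu n))
    (hJ : ∀ i, 0 < LinearMap.det ((G i : Eu n →ᵃ[ℝ] Eu n).linear))
    (m : Fin N → ℕ) (φ : ∀ i, Fin (m i) → (Eu n →ᵃ[ℝ] ℝ))
    (hcov : ∀ x, ∃ i, ∀ j, φ i j x ≤ 0)
    (hf : ∀ i x, (∀ j, φ i j x ≤ 0) → f x = G i x) (x : Eu n)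
    (hx : ∀ k k' : (Σ i, Fin (m i)), AffIndep (φ k.1 k.2) (φ k'.1 k'.2) →
      φ k.1 k.2 x = 0 → φ k'.1 k'.2 x = 0 → False) (V : Set (Eu n)) (hV : V ∈ 𝓝 x) :
    f '' V ∈ 𝓝 (f x) := by
  have hGs : ∀ i, Continuous (G i).symm := fun i =>
    AffineMap.continuous_of_finiteDimensional ((G i).symm : Eu n →ᵃ[ℝ] Eu n)
  by_cases hall : ∀ i j, φ i j x = 0 → φ i j = 0
  · obtain ⟨i, hi⟩ := hcov x
    have h1 : ∀ᶠ z in 𝓝 x, f z = G i z := by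
      have : ∀ j, ∀ᶠ z in 𝓝 x, φ i j z ≤ 0 := by
        intro j
        rcases (hi j).lt_or_eq with h | h
        · filter_upwards [(aff_cont (φ i j)).tendsto x |>.eventually_lt_const h] with z hz using hz.le
        · simp [hall i j h]
      filter_upwards [eventually_all.2 this] with z hz using hf i z hz
    have hfx := h1.self_of_nhds
    have ht : Tendsto (G i).symm (𝓝 (f x)) (𝓝 x) := by
      have := (hGs i).tendsto (f x)
      rwa [hfx, AffineEquiv.symm_apply_apply, ← hfx] at this
    filter_upwards [ht.eventually h1, ht.eventually hV] with y hy1 hy2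
    exact ⟨_, hy2, by rw [hy1]; simp⟩
  · push Not at hall
    obtain ⟨i₀, j₀, hax, ha⟩ := hall
    set a := φ i₀ j₀ with hadef
    have hm : ∀ i j, φ i j x = 0 → ∃ t : ℝ, φ i j = t • a := by
      intro i j hij
      by_contra hcon
      refine hx ⟨i₀, j₀⟩ ⟨i, j⟩ ?_ hax hij
      intro s t hst
      change s • a + t • φ i j = 0 at hst
      have ht : t = 0 := by
        by_contra ht
        apply hcon
        refine ⟨-(t⁻¹ * s), ?_⟩
        have h2 : t • φ i j = -(s • a) := by
          rw [eq_neg_iff_add_eq_zero, add_comm]; exact hst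
        rw [neg_smul, mul_smul, ← smul_neg, ← h2, smul_smul, inv_mul_cancel₀ ht, one_smul]
      subst ht
      rw [zero_smul, add_zero] at hst
      exact ⟨(smul_eq_zero.1 hst).resolve_right ha, rfl⟩
    obtain ⟨i, hi⟩ := one_side m φ hcov x a ha hax hm
    obtain ⟨j, hj⟩ := one_side m φ hcov x (-a) (neg_ne_zero.2 ha) (by simp [hax])
      (fun i j h => by
        obtain ⟨t, ht⟩ := hm i j h
        exact ⟨-t, by rw [ht]; simp⟩)
    have hi' : ∀ᶠ z in 𝓝 x, 0 ≤ a z → f z = G i z := by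
      filter_upwards [hi] with z hz h using hf i z (hz h)
    have hj' : ∀ᶠ z in 𝓝 x, a z ≤ 0 → f z = G j z := by
      filter_upwards [hj] with z hz h using hf j z (hz (by simpa using h))
    have hfi := hi'.self_of_nhds hax.ge
    have hfj := hj'.self_of_nhds hax.le
    have hti : Tendsto (G i).symm (𝓝 (f x)) (𝓝 x) := by
      have := (hGs i).tendsto (f x)
      rwa [hfi, AffineEquiv.symm_apply_apply, ← hfi] at this
    have htj : Tendsto (G j).symm (𝓝 (f x)) (𝓝 x) := by
      have := (hGs j).tendsto (f x)
      rwa [hfj, AffineEquiv.symm_apply_apply, ← hfj] at this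
    have hlin : ∀ (i : Fin N) (z : Eu n),
        (G i : Eu n →ᵃ[ℝ] Eu n).linear (z - x) = G i z - G i x := by
      intro i z
      exact (G i : Eu n →ᵃ[ℝ] Eu n).linearMap_vsub z x
    have halin : ∀ z : Eu n, a.linear (z - x) = a z := by
      intro z
      have := a.linearMap_vsub z x
      simpa [hax] using this
    have hagree : ∀ v, a.linear v = 0 → (G i : Eu n →ᵃ[ℝ] Eu n).linear v
        = (G j : Eu n →ᵃ[ℝ] Eu n).linear v := by
      intro v hv
      have ht : Tendsto (fun s : ℝ => x + s • v) (𝓝[≠] 0) (𝓝 x) := by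
        have : Continuous (fun s : ℝ => x + s • v) := by fun_prop
        have h := this.tendsto 0
        simp only [zero_smul, add_zero] at h
        exact h.mono_left nhdsWithin_le_nhds
      obtain ⟨s, ⟨h1, h2⟩, hs⟩ := (((ht.eventually hi').and (ht.eventually hj')).and
        (self_mem_nhdsWithin : _ ∈ 𝓝[≠] (0:ℝ))).exists
      have hs : s ≠ 0 := hs
      have has : a (x + s • v) = 0 := by
        rw [← halin]; simp [hv]
      have h1 := h1 has.ge
      have h2 := h2 has.le
      have h3 := hlin i (x + s • v)
      have h4 := hlin j (x + s • v)
      rw [← h1, ← hfi] at h3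
      rw [← h2, ← hfj, ← h3] at h4
      simp only [add_sub_cancel_left, map_smul] at h4
      exact (smul_right_injective _ hs h4).symm
    filter_upwards [hti.eventually hi', htj.eventually hj', hti.eventually hV, htj.eventually hV]
      with y h1 h2 h3 h4
    by_cases hp : 0 ≤ a ((G i).symm y)
    · exact ⟨_, h3, by rw [h1 hp]; simp⟩
    by_cases hq : a ((G j).symm y) ≤ 0
    · exact ⟨_, h4, by rw [h2 hq]; simp⟩
    exfalso
    push Not at hp hq
    refine key_det _ _ (hJ i) (hJ j) a.linear hagree ((G i).symm y - x) ((G j).symm y - x) ?_ ?_ ?_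
    · rw [hlin, hlin, ← hfi, ← hfj]; simp
    · rwa [halin]
    · rwa [halin]

theorem main_open {n N : ℕ} (f : Eu n → Eu n) (G : Fin N → (Eu n ≃ᵃ[ℝ] Eu n))
    (hJ : ∀ i, 0 < LinearMap.det ((G i : Eu n →ᵃ[ℝ] Eu n).linear))
    (m : Fin N → ℕ) (φ : ∀ i, Fin (m i) → (Eu n →ᵃ[ℝ] ℝ))
    (hcov : ∀ x, ∃ i, ∀ j, φ i j x ≤ 0)
    (hf : ∀ i x, (∀ j, φ i j x ≤ 0) → f x = G i x) (x₀ : Eu n) (V : Set (Eu n)) (hV : V ∈ 𝓝 x₀) :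
    f '' V ∈ 𝓝 (f x₀) := by
  have hGc : ∀ i, Continuous (G i) := fun i =>
    AffineMap.continuous_of_finiteDimensional (G i : Eu n →ᵃ[ℝ] Eu n)
  have hcont : Continuous f := by
    refine LocallyFinite.continuous (f := fun i : Fin N => {x | ∀ j, φ i j x ≤ 0})
      (locallyFinite_of_finite _) ?_ ?_ ?_
    · ext x; simpa using hcov x
    · intro i
      simp only [ofPred_forall]
      exact isClosed_iInter fun j => isClosed_le (aff_cont _) continuous_const
    · intro i
      exact (hGc i).continuousOn.congr fun x hx => hf i x hx
  -- the thin set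
  let K := Σ i, Fin (m i)
  let Q := {p : Fin N × K × K // AffIndep (φ p.2.1.1 p.2.1.2) (φ p.2.2.1 p.2.2.2)}
  let a : Q → (Eu n →ᵃ[ℝ] ℝ) := fun q =>
    (φ q.1.2.1.1 q.1.2.1.2).comp ((G q.1.1).symm : Eu n →ᵃ[ℝ] Eu n)
  let b : Q → (Eu n →ᵃ[ℝ] ℝ) := fun q =>
    (φ q.1.2.2.1 q.1.2.2.2).comp ((G q.1.1).symm : Eu n →ᵃ[ℝ] Eu n)
  have hab : ∀ q, AffIndep (a q) (b q) := by
    intro q s t hst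
    refine q.2 s t ?_
    ext z
    have := congrArg (fun g : Eu n →ᵃ[ℝ] ℝ => g (G q.1.1 z)) hst
    simpa [a, b] using this
  set T : Set (Eu n) := {y | ∃ q, a q y = 0 ∧ b q y = 0} with hT
  have hloc : ∀ x, f x ∉ T → ∀ U ∈ 𝓝 x, f '' U ∈ 𝓝 (f x) := by
    intro x hx U hU
    refine local_open f G hJ m φ hcov hf x ?_ U hU
    intro k k' hkk h1 h2
    obtain ⟨i, hi⟩ := hcov x
    apply hx
    refine ⟨⟨(i, k, k'), hkk⟩, ?_, ?_⟩
    · simp [a, hf i x hi, h1]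
    · simp [b, hf i x hi, h2]
  -- isolate
  have hfin : {x | f x = f x₀}.Finite := by
    refine (Set.finite_range fun i => (G i).symm (f x₀)).subset ?_
    intro x hx
    obtain ⟨i, hi⟩ := hcov x
    refine ⟨i, ?_⟩
    have hx : f x = f x₀ := hx
    simp [← hx, hf i x hi]
  have hiso : ({x | f x = f x₀} \ {x₀})ᶜ ∈ 𝓝 x₀ :=
    (hfin.subset sdiff_subset).isClosed.isOpen_compl.mem_nhds (by simp)
  obtain ⟨r, hr, hrV⟩ := Metric.nhds_basis_closedBall.mem_iff.1 (inter_mem hV hiso)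
  have hcomp : IsCompact (f '' Metric.closedBall x₀ r) :=
    (isCompact_closedBall x₀ r).image hcont
  have hsph : IsClosed (f '' Metric.sphere x₀ r) :=
    ((isCompact_sphere x₀ r).image hcont).isClosed
  have hnot : f x₀ ∉ f '' Metric.sphere x₀ r := by
    rintro ⟨x, hx, hxx⟩
    refine (hrV (Metric.sphere_subset_closedBall hx)).2 ⟨hxx, ?_⟩
    rintro rfl
    simp at hx
    exact hr.ne hx
  obtain ⟨δ, hδ, hδs⟩ := Metric.nhds_basis_ball.mem_iff.1 (hsph.isOpen_compl.mem_nhds hnot)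
  set W := Metric.ball (f x₀) δ \ T with hW
  have hstep : ∀ y ∈ W, y ∈ f '' Metric.closedBall x₀ r →
      y ∈ interior (f '' Metric.closedBall x₀ r) := by
    rintro y ⟨hyb, hyT⟩ ⟨x, hx, rfl⟩
    rw [mem_interior_iff_mem_nhds]
    apply hloc x hyT
    have hxs : x ∉ Metric.sphere x₀ r := fun h => hδs hyb ⟨x, h, rfl⟩
    have : x ∈ Metric.ball x₀ r := by
      rw [Metric.mem_ball]
      exact lt_of_le_of_ne hx hxs
    exact mem_of_superset (Metric.isOpen_ball.mem_nhds this) Metric.ball_subset_closedBall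
  have hWsub : W ⊆ interior (f '' Metric.closedBall x₀ r) := by
    refine (thin_connected a b hab (f x₀) δ).subset_of_closure_inter_subset isOpen_interior ?_ ?_
    · obtain ⟨x, ⟨hx1, hx2⟩, hx⟩ := exists_generic (Q := Fin N × Q)
        (fun p => (a p.2).comp (G p.1 : Eu n →ᵃ[ℝ] Eu n))
        (by
          intro p hp
          apply (hab p.2).ne_left
          ext z
          have := congrArg (fun g : Eu n →ᵃ[ℝ] ℝ => g ((G p.1).symm z)) hp
          simpa using this)
        (Metric.ball x₀ r ∩ f ⁻¹' Metric.ball (f x₀) δ)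
        (Metric.isOpen_ball.inter (Metric.isOpen_ball.preimage hcont))
        ⟨x₀, by simp [hr], by simp [hδ]⟩
      have hxW : f x ∈ W := by
        refine ⟨hx2, ?_⟩
        rintro ⟨q, hq, -⟩
        obtain ⟨i, hi⟩ := hcov x
        apply hx (i, q)
        rw [hf i x hi] at hq
        simpa using hq
      exact ⟨f x, hxW, hstep _ hxW ⟨x, Metric.ball_subset_closedBall hx1, rfl⟩⟩
    · rintro y ⟨hy, hyW⟩
      apply hstep y hyW
      have := closure_mono interior_subset hy
      rwa [hcomp.isClosed.closure_eq] at this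
  have hball : Metric.ball (f x₀) δ ⊆ f '' Metric.closedBall x₀ r := by
    intro y hy
    rw [← hcomp.isClosed.closure_eq, mem_closure_iff]
    intro O hO hyO
    obtain ⟨z, ⟨hz1, hz2⟩, hz⟩ := exists_generic a (fun q => (hab q).ne_left)
      (O ∩ Metric.ball (f x₀) δ) (hO.inter Metric.isOpen_ball) ⟨y, hyO, hy⟩
    exact ⟨z, hz1, interior_subset (hWsub ⟨hz2, fun ⟨q, hq, _⟩ => hz q hq⟩)⟩
  refine mem_of_superset (Metric.ball_mem_nhds _ hδ) (hball.trans (image_mono ?_))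
  exact fun x hx => (hrV hx).1

/-- A piecewise affine map `f : ℝⁿ → ℝⁿ` all of whose Jacobians are
positive is an open map. -/
theorem piecewise_affine_positive_jacobians_open_map
    {n N : ℕ} (f : Eu n → Eu n) (F : Fin N → (Eu n →ᵃ[ℝ] Eu n))
    (C : Fin N → Set (Eu n)) (hpa : IsPiecewiseAffine f F C)
    (hJ : ∀ i, 0 < LinearMap.det (F i).linear) :
    IsOpenMap f := by
  obtain ⟨hpoly, -, hcov, -, hf⟩ := hpa
  choose m l c hC using hpoly
  have hbij : ∀ i, Function.Bijective (F i) := fun i => by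
    rw [← AffineMap.linear_bijective_iff]
    exact (LinearEquiv.ofIsUnitDet (f := (F i).linear) (v := Module.finBasis ℝ (Eu n))
      (v' := Module.finBasis ℝ (Eu n))
      (by rw [LinearMap.det_toMatrix]; exact (hJ i).ne'.isUnit)).bijective
  have hmem : ∀ i x, x ∈ C i ↔ ∀ j, ((l i j).toAffineMap - AffineMap.const ℝ (Eu n) (c i j) : Eu n →ᵃ[ℝ] ℝ) x ≤ 0 := by
    intro i x
    rw [hC i]; simp
  rw [isOpenMap_iff_nhds_le]
  intro x V hV
  refine mem_of_superset (main_open f (fun i => AffineEquiv.ofBijective (hbij i)) ?_ m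
    (fun i j => (l i j).toAffineMap - AffineMap.const ℝ _ (c i j)) ?_ ?_ x _ hV)
    (image_preimage_subset _ _)
  · intro i; exact hJ i
  · intro x
    have : x ∈ ⋃ i, C i := by rw [hcov]; trivial
    obtain ⟨i, hi⟩ := mem_iUnion.1 this
    exact ⟨i, (hmem i x).1 hi⟩
  · intro i x hx
    exact hf i x ((hmem i x).2 hx)
end

section
/- Let f : ℝⁿ → ℝⁿ be piecewise affine with pieces (f_i, C_i), i = 1,…,N, with J_i > 0 for every i, and suppose there exists a regular value y₀ of f such that f⁻¹({y₀}) has exactly one element. Then for every regular value y of f, the preimage f⁻¹({y}) has exactly one element. -/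
open Set Filter Topology

section PAHelpers

variable {E : Type*} [NormedAddCommGroup E] [NormedSpace ℝ E] [FiniteDimensional ℝ E]

/-- Two orientation preserving maps agreeing on a hyperplane preserve its sides. -/
theorem pa_det (A B : E ≃L[ℝ] E) (l : E →L[ℝ] ℝ) (u : E) (hu : l u = 1)
    (hA : 0 < LinearMap.det (A : E →ₗ[ℝ] E)) (hB : 0 < LinearMap.det (B : E →ₗ[ℝ] E))
    (hAB : ∀ v, l v = 0 → A v = B v) :
    ∃ s : ℝ, 0 < s ∧ ∀ w, l (A.symm w) = s * l (B.symm w) := by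
  set w₀ : E := A.symm (B u) - u with hw₀
  have key : ∀ v, B v = A (v + l v • w₀) := by
    intro v
    have h1 : A (v - l v • u) = B (v - l v • u) := hAB _ (by simp [hu])
    have h2 : A w₀ = B u - A u := by simp [hw₀]
    simp only [map_sub, map_smul, map_add, h2] at h1 ⊢
    have : B v = B v - l v • B u + l v • B u := by abel
    rw [this, ← h1, smul_sub]; abel
  have hcomp : (B : E →ₗ[ℝ] E) =
      (A : E →ₗ[ℝ] E) ∘ₗ LinearMap.transvection (l : E →ₗ[ℝ] ℝ) w₀ := by
    ext v
    simpa [LinearMap.transvection] using key v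
  rw [hcomp, LinearMap.det_comp, LinearMap.transvection.det] at hB
  have hs : 0 < 1 + l w₀ := by
    have := (mul_pos_iff_of_pos_left hA).1 hB
    simpa using this
  refine ⟨1 + l w₀, hs, fun w => ?_⟩
  have := key (B.symm w)
  rw [ContinuousLinearEquiv.apply_symm_apply] at this
  conv_lhs => rw [this]
  simp
  ring

theorem pa_dense {ι : Type*} [Finite ι] (m : ι → E →L[ℝ] ℝ) (d : ι → ℝ) (hm : ∀ a, m a ≠ 0) :
    Dense {y | ∀ a, m a y ≠ d a} := by
  have : {y | ∀ a, m a y ≠ d a} = ⋂ a, {y | m a y ≠ d a} := by ext; simp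
  rw [this]
  have hop : ∀ a, IsOpen {y | m a y ≠ d a} := fun a =>
    isOpen_ne_fun (m a).continuous continuous_const
  refine dense_iInter_of_isOpen hop ?_
  intro a y
  obtain ⟨u, hu⟩ : ∃ u, m a u ≠ 0 := by
    by_contra! h
    exact hm a (by ext x; simpa using h x)
  by_cases hy : m a y = d a
  · have ht : Tendsto (fun t : ℝ => y + t • u) (𝓝[≠] 0) (𝓝 y) := by
      have : Tendsto (fun t : ℝ => y + t • u) (𝓝 0) (𝓝 (y + (0:ℝ) • u)) :=
        (by fun_prop : Continuous fun t : ℝ => y + t • u).tendsto 0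
      simp only [zero_smul, add_zero] at this
      exact this.mono_left nhdsWithin_le_nhds
    refine mem_closure_of_tendsto ht ?_
    filter_upwards [self_mem_nhdsWithin] with t ht
    have : t ≠ 0 := ht
    simp [hy, this, hu]
  · exact subset_closure hy

variable {ι κ : Type*} [Finite ι] [Finite κ]

theorem pa_closed_s10 (l : ι → E →L[ℝ] ℝ) (c : ι → ℝ) (S : Set ι) :
    IsClosed {x | ∀ a ∈ S, l a x ≤ c a} := by
  simp only [ofPred_forall]
  exact isClosed_biInter fun a _ => isClosed_le (l a).continuous continuous_const

/-- One side of the hyperplane through `x` is locally filled by exactly one piece. -/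
theorem pa_side (l : ι → E →L[ℝ] ℝ) (c : ι → ℝ) (S : κ → Set ι) (C : κ → Set E)
    (hC : ∀ k, C k = {x | ∀ a ∈ S k, l a x ≤ c a})
    (hcov : ∀ x, ∃ k, x ∈ C k)
    (hdisj : ∀ i j, i ≠ j → interior (C i) ∩ interior (C j) = ∅)
    (x : E) (L : E →L[ℝ] ℝ) (u : E) (hu : L u = 1)
    (hact : ∀ a, l a x = c a → ∃ t : ℝ, t ≠ 0 ∧ l a = t • L) :
    ∃ i, x ∈ C i ∧ (∀ᶠ p in 𝓝 x, L x < L p → ∀ k, (p ∈ C k ↔ k = i)) := by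
  have hcl : ∀ k, IsClosed (C k) := fun k => by rw [hC]; exact pa_closed_s10 _ _ _
  -- near `x`, membership on the positive side is constant
  have hconst : ∀ k, ∃ Q : Prop, ∀ᶠ p in 𝓝 x, L x < L p → (p ∈ C k ↔ Q) := by
    intro k
    by_cases hx : x ∈ C k
    · refine ⟨∀ a ∈ S k, l a x = c a → ∃ t : ℝ, t < 0 ∧ l a = t • L, ?_⟩
      have hin : ∀ a, ∀ᶠ p in 𝓝 x, l a x < c a → l a p < c a := by
        intro a
        by_cases h : l a x < c a
        · filter_upwards [(l a).continuous.continuousAt.eventually_lt_const h] with p hp _ using hp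
        · exact Eventually.of_forall fun p h' => absurd h' h
      filter_upwards [eventually_all.2 hin] with p hp hLp
      rw [hC] at hx ⊢
      constructor
      · intro hpC a ha hax
        obtain ⟨t, ht0, ht⟩ := hact a hax
        refine ⟨t, ?_, ht⟩
        have h1 := hpC a ha
        rw [← hax, ht] at h1
        simp only [smul_apply, smul_eq_mul] at h1
        by_contra hneg
        have : 0 < t := lt_of_le_of_ne (not_lt.1 hneg) (Ne.symm ht0)
        nlinarith
      · intro hQ a ha
        rcases lt_or_eq_of_le (hx a ha) with h | h
        · exact (hp a h).le
        · obtain ⟨t, ht, hl⟩ := hQ a ha h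
          rw [← h, hl]
          simp only [smul_apply, smul_eq_mul]
          nlinarith
    · refine ⟨False, ?_⟩
      filter_upwards [(hcl k).isOpen_compl.mem_nhds hx] with p hp _
      simpa using hp
  choose Q hQ using hconst
  have hQ' := eventually_all.2 hQ
  have hx' : ∀ᶠ p in 𝓝 x, ∀ k, p ∈ C k → x ∈ C k := by
    rw [eventually_all]
    intro k
    by_cases hx : x ∈ C k
    · exact Eventually.of_forall fun _ _ => hx
    · filter_upwards [(hcl k).isOpen_compl.mem_nhds hx] with p hp h
      exact absurd h hp
  have ht : Tendsto (fun t : ℝ => x + t • u) (𝓝[>] 0) (𝓝 x) := by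
    have : Tendsto (fun t : ℝ => x + t • u) (𝓝 0) (𝓝 (x + (0:ℝ) • u)) :=
      (by fun_prop : Continuous fun t : ℝ => x + t • u).tendsto 0
    simp only [zero_smul, add_zero] at this
    exact this.mono_left nhdsWithin_le_nhds
  obtain ⟨e, ⟨he1, he2⟩, he0⟩ := ((ht.eventually (hQ'.eventually_nhds.and hx')).and
    self_mem_nhdsWithin).exists
  have he0 : 0 < e := he0
  have hLp : L x < L (x + e • u) := by simp [hu, he0]
  obtain ⟨i, hi⟩ := hcov (x + e • u)
  have hQi : Q i := (he1.self_of_nhds i hLp).1 hi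
  refine ⟨i, he2 i hi, ?_⟩
  have huniq : ∀ k, Q k → k = i := by
    intro k hk
    by_contra hne
    have hLe : ∀ᶠ p in 𝓝 (x + e • u), L x < L p :=
      L.continuous.continuousAt.eventually_const_lt hLp
    have hint : ∀ k, Q k → x + e • u ∈ interior (C k) := by
      intro k hk
      rw [mem_interior_iff_mem_nhds]
      filter_upwards [he1, hLe] with p hp hL
      exact (hp k hL).2 hk
    have := hdisj k i hne
    have h2 : x + e • u ∈ interior (C k) ∩ interior (C i) := ⟨hint k hk, hint i hQi⟩
    rw [this] at h2
    exact h2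
  filter_upwards [hQ'] with p hp hL k
  rw [hp k hL]
  exact ⟨huniq k, fun h => h ▸ hQi⟩

/-- Unique local preimage near a generic point. -/
theorem pa_local (l : ι → E →L[ℝ] ℝ) (c : ι → ℝ) (S : κ → Set ι) (C : κ → Set E)
    (hl : ∀ a, l a ≠ 0)
    (hC : ∀ k, C k = {x | ∀ a ∈ S k, l a x ≤ c a})
    (hcov : ∀ x, ∃ k, x ∈ C k)
    (hdisj : ∀ i j, i ≠ j → interior (C i) ∩ interior (C j) = ∅)
    (A : κ → E ≃L[ℝ] E) (b : κ → E)
    (hdet : ∀ k, 0 < LinearMap.det (A k : E →ₗ[ℝ] E))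
    (hglue : ∀ i j x, x ∈ C i → x ∈ C j → A i x + b i = A j x + b j)
    (x z : E) (hxz : ∀ k, x ∈ C k → A k x + b k = z)
    (hgen : ∀ a a', l a x = c a → l a' x = c a' → ∃ t : ℝ, t ≠ 0 ∧ l a' = t • l a) :
    ∀ᶠ y in 𝓝 z, (∀ k a, l a ((A k).symm (y - b k)) ≠ c a) →
      ∃! k, x ∈ C k ∧ (A k).symm (y - b k) ∈ C k := by
  have hGx : ∀ k, x ∈ C k → (A k).symm (z - b k) = x := by
    intro k hk
    rw [← hxz k hk]; simp
  have hG : ∀ k, x ∈ C k → Tendsto (fun y => (A k).symm (y - b k)) (𝓝 z) (𝓝 x) := by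
    intro k hk
    have : Continuous fun y => (A k).symm (y - b k) := by fun_prop
    have := this.tendsto z
    rwa [hGx k hk] at this
  by_cases hex : ∃ a, l a x = c a
  · obtain ⟨a, ha⟩ := hex
    obtain ⟨u, hu⟩ : ∃ u, l a u = 1 := by
      obtain ⟨u, hu⟩ : ∃ u, l a u ≠ 0 := by
        by_contra! h
        exact hl a (by ext x; simpa using h x)
      exact ⟨(l a u)⁻¹ • u, by simp [hu]⟩
    obtain ⟨i, hxi, hi⟩ := pa_side l c S C hC hcov hdisj x (l a) u hu
      (fun a' h => hgen a a' ha h)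
    obtain ⟨j, hxj, hj⟩ := pa_side l c S C hC hcov hdisj x (-l a) (-u) (by simp [hu])
      (fun a' h => by
        obtain ⟨t, ht, h'⟩ := hgen a a' ha h
        exact ⟨-t, by simpa using ht, by simpa using h'⟩)
    have hH : ∀ k, x ∈ C k → ∀ᶠ p in 𝓝 x, l a p = l a x → p ∈ C k := by
      intro k hk
      have hin : ∀ a, ∀ᶠ p in 𝓝 x, l a x < c a → l a p < c a := by
        intro a
        by_cases h : l a x < c a
        · filter_upwards [(l a).continuous.continuousAt.eventually_lt_const h] with p hp _ using hp
        · exact Eventually.of_forall fun p h' => absurd h' h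
      filter_upwards [eventually_all.2 hin] with p hp hLp
      rw [hC] at hk ⊢
      intro a' ha'
      rcases lt_or_eq_of_le (hk a' ha') with h | h
      · exact (hp a' h).le
      · obtain ⟨t, ht, h'⟩ := hgen a a' ha h
        rw [← h, h']
        simp [hLp]
    have hker : ∀ v, l a v = 0 → A i v = A j v := by
      intro v hv
      have ht : Tendsto (fun t : ℝ => x + t • v) (𝓝[>] 0) (𝓝 x) := by
        have : Tendsto (fun t : ℝ => x + t • v) (𝓝 0) (𝓝 (x + (0:ℝ) • v)) :=
          (by fun_prop : Continuous fun t : ℝ => x + t • v).tendsto 0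
        simp only [zero_smul, add_zero] at this
        exact this.mono_left nhdsWithin_le_nhds
      obtain ⟨e, ⟨he1, he2⟩, he0⟩ := ((ht.eventually ((hH i hxi).and (hH j hxj))).and
        self_mem_nhdsWithin).exists
      have he0 : 0 < e := he0
      have h1 := hglue i j (x + e • v) (he1 (by simp [hv])) (he2 (by simp [hv]))
      have h2 := hglue i j x hxi hxj
      simp only [map_add, map_smul] at h1
      have h3 : e • A i v = e • A j v := by
        have e1 : e • A i v = (A i x + e • A i v + b i) - (A i x + b i) := by abel
        rw [e1, h1, h2]; abel
      exact smul_right_injective E he0.ne' h3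
    obtain ⟨s, hs, hsl⟩ := pa_det (A i) (A j) (l a) u hu (hdet i) (hdet j) hker
    have hdiff : ∀ k, x ∈ C k → ∀ y, l a ((A k).symm (y - b k)) - l a x =
        l a ((A k).symm (y - z)) := by
      intro k hk y
      conv_lhs => rw [← hGx k hk]
      rw [← map_sub, ← map_sub]
      congr 2
      abel
    have hev : ∀ᶠ y in 𝓝 z, ∀ k, x ∈ C k →
        (l a x < l a ((A k).symm (y - b k)) → ((A k).symm (y - b k) ∈ C k ↔ k = i)) ∧
        (l a ((A k).symm (y - b k)) < l a x → ((A k).symm (y - b k) ∈ C k ↔ k = j)) := by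
      rw [eventually_all]
      intro k
      by_cases hk : x ∈ C k
      · filter_upwards [(hG k hk).eventually hi, (hG k hk).eventually hj] with y h1 h2 _
        exact ⟨fun h => h1 h k, fun h => h2 (neg_lt_neg h) k⟩
      · exact Eventually.of_forall fun y h => absurd h hk
    filter_upwards [hev] with y hy hreg
    have hne : l a ((A i).symm (y - z)) ≠ 0 := by
      rw [← hdiff i hxi, ha]
      exact sub_ne_zero.2 (hreg i a)
    have hij := hsl (y - z)
    rcases lt_or_gt_of_ne hne with hneg | hpos
    · have hnegj : l a ((A j).symm (y - z)) < 0 := by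
        by_contra h
        push Not at h
        have := mul_nonneg hs.le h
        linarith
      have h1 := hdiff i hxi y
      have h2 := hdiff j hxj y
      refine ⟨j, ⟨hxj, ((hy j hxj).2 (by linarith)).2 rfl⟩, ?_⟩
      rintro k ⟨hk, hkC⟩
      have hkne : l a ((A k).symm (y - b k)) ≠ l a x := by rw [ha]; exact hreg k a
      rcases lt_or_gt_of_ne hkne with h | h
      · exact ((hy k hk).2 h).1 hkC
      · have : k = i := ((hy k hk).1 h).1 hkC
        subst this
        linarith
    · have hposj : 0 < l a ((A j).symm (y - z)) := by
        by_contra h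
        push Not at h
        have := mul_nonneg hs.le (neg_nonneg.2 h)
        linarith
      have h1 := hdiff i hxi y
      have h2 := hdiff j hxj y
      refine ⟨i, ⟨hxi, ((hy i hxi).1 (by linarith)).2 rfl⟩, ?_⟩
      rintro k ⟨hk, hkC⟩
      have hkne : l a ((A k).symm (y - b k)) ≠ l a x := by rw [ha]; exact hreg k a
      rcases lt_or_gt_of_ne hkne with h | h
      · have : k = j := ((hy k hk).2 h).1 hkC
        subst this
        linarith
      · exact ((hy k hk).1 h).1 hkC
  · push Not at hex
    have hint : ∀ k, x ∈ C k → C k ∈ 𝓝 x := by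
      intro k hk
      have : ∀ a, ∀ᶠ p in 𝓝 x, a ∈ S k → l a p ≤ c a := by
        intro a
        by_cases h : a ∈ S k
        · have hk' := hk
          rw [hC] at hk'
          have : l a x < c a := lt_of_le_of_ne (hk' a h) (hex a)
          filter_upwards [(l a).continuous.continuousAt.eventually_lt_const this] with p hp _
            using hp.le
        · exact Eventually.of_forall fun p h' => absurd h' h
      filter_upwards [eventually_all.2 this] with p hp
      rw [hC]
      exact hp
    obtain ⟨i, hi⟩ := hcov x
    filter_upwards [(hG i hi).eventually (hint i hi)] with y hy _
    refine ⟨i, ⟨hi, hy⟩, ?_⟩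
    rintro k ⟨hk, -⟩
    by_contra hne
    have h2 : x ∈ interior (C k) ∩ interior (C i) :=
      ⟨mem_interior_iff_mem_nhds.2 (hint k hk), mem_interior_iff_mem_nhds.2 (hint i hi)⟩
    rw [hdisj k i hne] at h2
    exact h2

open Classical in
/-- Number of pieces whose image contains `y`. -/
noncomputable def paCount {κ : Type*} [Fintype κ] (C : κ → Set E) (A : κ → E ≃L[ℝ] E)
    (b : κ → E) (y : E) : ℕ :=
  (Finset.univ.filter fun k => (A k).symm (y - b k) ∈ C k).card

theorem pa_local_const {κ : Type*} [Fintype κ]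
    (l : ι → E →L[ℝ] ℝ) (c : ι → ℝ) (S : κ → Set ι) (C : κ → Set E)
    (hl : ∀ a, l a ≠ 0)
    (hC : ∀ k, C k = {x | ∀ a ∈ S k, l a x ≤ c a})
    (hcov : ∀ x, ∃ k, x ∈ C k)
    (hdisj : ∀ i j, i ≠ j → interior (C i) ∩ interior (C j) = ∅)
    (A : κ → E ≃L[ℝ] E) (b : κ → E)
    (hdet : ∀ k, 0 < LinearMap.det (A k : E →ₗ[ℝ] E))
    (hglue : ∀ i j x, x ∈ C i → x ∈ C j → A i x + b i = A j x + b j)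
    (z : E)
    (hgen : ∀ k a a', l a ((A k).symm (z - b k)) = c a → l a' ((A k).symm (z - b k)) = c a' →
      ∃ t : ℝ, t ≠ 0 ∧ l a' = t • l a) :
    ∃ m : ℕ, ∀ᶠ y in 𝓝 z, (∀ k a, l a ((A k).symm (y - b k)) ≠ c a) → paCount C A b y = m := by
  classical
  have hcl : ∀ k, IsClosed (C k) := fun k => by rw [hC]; exact pa_closed_s10 _ _ _
  let G : κ → E → E := fun k y => (A k).symm (y - b k)
  have hGc : ∀ k, Continuous (G k) := fun k => by
    change Continuous fun y => (A k).symm (y - b k)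
    fun_prop
  have hAG : ∀ k y, A k (G k y) + b k = y := fun k y => by simp [G]
  let X : Finset E := (Finset.univ.filter fun k => G k z ∈ C k).image fun k => G k z
  refine ⟨X.card, ?_⟩
  have h1 : ∀ᶠ y in 𝓝 z, ∀ k, G k y ∈ C k → G k z ∈ C k := by
    rw [eventually_all]
    intro k
    by_cases hx : G k z ∈ C k
    · exact Eventually.of_forall fun _ _ => hx
    · filter_upwards [((hcl k).isOpen_compl.preimage (hGc k)).mem_nhds hx] with p hp h
      exact absurd h hp
  have hXz : ∀ k, G k z ∈ C k → ∀ k', G k z ∈ C k' → G k' z = G k z := by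
    intro k hk k' hk'
    have := hglue k k' _ hk hk'
    rw [hAG] at this
    change (A k').symm (z - b k') = G k z
    rw [ContinuousLinearEquiv.symm_apply_eq, sub_eq_iff_eq_add]
    exact this
  have h2 : ∀ᶠ y in 𝓝 z, ∀ k, G k z ∈ C k → (∀ k a, l a (G k y) ≠ c a) →
      ∃! k', G k z ∈ C k' ∧ G k' y ∈ C k' := by
    rw [eventually_all]
    intro k
    by_cases hx : G k z ∈ C k
    · filter_upwards [pa_local l c S C hl hC hcov hdisj A b hdet hglue (G k z) z
        (fun k' hk' => by rw [← hglue k k' _ hx hk', hAG]) (hgen k)] with y hy _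
      exact hy
    · exact Eventually.of_forall fun _ h => absurd h hx
  filter_upwards [h1, h2] with y hy1 hy2 hreg
  have : paCount C A b y = (Finset.univ.filter fun k => G k y ∈ C k).card := by
    unfold paCount
    congr
  rw [this]
  refine Finset.card_nbij (fun k => G k z) ?_ ?_ ?_
  · intro k hk
    replace hk := (Finset.mem_filter.1 hk).2
    simp only [X, Finset.coe_image, mem_image, Finset.mem_coe, Finset.mem_image, Finset.mem_filter, Finset.mem_univ, true_and]
    exact ⟨k, hy1 k hk, rfl⟩
  · intro k hk k' hk' h
    simp only [Finset.coe_filter, Finset.mem_univ, true_and, mem_ofPred_eq] at hk hk'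
    have h : G k z = G k' z := h
    exact (hy2 k (hy1 k hk) hreg).unique ⟨hy1 k hk, hk⟩ ⟨h ▸ hy1 k' hk', hk'⟩
  · intro x hx
    simp only [X, Finset.coe_image, Finset.coe_filter, Finset.mem_univ, true_and, mem_image,
      mem_ofPred_eq] at hx ⊢
    obtain ⟨k, hk, rfl⟩ := hx
    obtain ⟨k', ⟨hk1, hk2⟩, -⟩ := hy2 k hk hreg
    exact ⟨k', hk2, hXz k hk k' hk1⟩

theorem pa_const {κ : Type*} [Fintype κ]
    (l : ι → E →L[ℝ] ℝ) (c : ι → ℝ) (S : κ → Set ι) (C : κ → Set E)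
    (hl : ∀ a, l a ≠ 0)
    (hC : ∀ k, C k = {x | ∀ a ∈ S k, l a x ≤ c a})
    (hcov : ∀ x, ∃ k, x ∈ C k)
    (hdisj : ∀ i j, i ≠ j → interior (C i) ∩ interior (C j) = ∅)
    (A : κ → E ≃L[ℝ] E) (b : κ → E)
    (hdet : ∀ k, 0 < LinearMap.det (A k : E →ₗ[ℝ] E))
    (hglue : ∀ i j x, x ∈ C i → x ∈ C j → A i x + b i = A j x + b j)
    (y₀ y : E) (m₀ m : ℕ)
    (h₀ : ∀ᶠ p in 𝓝 y₀, paCount C A b p = m₀) (h : ∀ᶠ p in 𝓝 y, paCount C A b p = m) :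
    m₀ = m := by
  -- the generic set
  let M : κ × ι → E →L[ℝ] ℝ := fun q => (l q.2).comp ((A q.1).symm : E →L[ℝ] E)
  let d : κ × ι → ℝ := fun q => c q.2 + l q.2 ((A q.1).symm (b q.1))
  have hMd : ∀ k a p, M (k, a) p - d (k, a) = l a ((A k).symm (p - b k)) - c a := by
    intro k a p
    simp [M, d]; ring
  have hM : ∀ q, M q ≠ 0 := by
    rintro ⟨k, a⟩ h0
    apply hl a
    ext v
    have := congrArg (fun g : E →L[ℝ] ℝ => g (A k v)) h0
    simpa [M] using this
  have hR : Dense {p | ∀ q, M q p ≠ d q} := pa_dense M d hM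
  have hRreg : ∀ p, (∀ q, M q p ≠ d q) → ∀ k a, l a ((A k).symm (p - b k)) ≠ c a := by
    intro p hp k a
    have := sub_ne_zero.2 (hp (k, a))
    rw [hMd] at this
    exact sub_ne_zero.1 this
  obtain ⟨y1, hy1R, hy1⟩ := (hR.inter_nhds_nonempty h₀)
  -- the second point
  let T := {q : κ × ι × ι // ¬ ∃ t : ℝ, t ≠ 0 ∧ l q.2.2 = t • l q.2.1}
  let φ : κ → ι → E → ℝ := fun k a p => M (k, a) p - d (k, a)
  have hφ1 : ∀ k a, φ k a y1 ≠ 0 := fun k a => sub_ne_zero.2 (hy1R (k, a))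
  let M2 : T → E →L[ℝ] ℝ := fun q => φ q.1.1 q.1.2.2 y1 • M (q.1.1, q.1.2.1) -
    φ q.1.1 q.1.2.1 y1 • M (q.1.1, q.1.2.2)
  let d2 : T → ℝ := fun q => φ q.1.1 q.1.2.2 y1 * d (q.1.1, q.1.2.1) -
    φ q.1.1 q.1.2.1 y1 * d (q.1.1, q.1.2.2)
  have hM2 : ∀ q, M2 q ≠ 0 := by
    rintro ⟨⟨k, a, a'⟩, hq⟩ h0
    apply hq
    refine ⟨φ k a' y1 / φ k a y1, div_ne_zero (hφ1 k a') (hφ1 k a), ?_⟩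
    ext v
    have h3 := congrArg (fun g : E →L[ℝ] ℝ => g (A k v)) h0
    have h4 : φ k a' y1 * l a v - φ k a y1 * l a' v = 0 := by simpa [M2, M] using h3
    have := hφ1 k a
    simp only [smul_apply, smul_eq_mul]
    field_simp
    linarith
  have hR2 : Dense {p | ∀ q : (κ × ι) ⊕ T, Sum.elim M M2 q p ≠ Sum.elim d d2 q} := by
    apply pa_dense
    rintro (q | q)
    · exact hM q
    · exact hM2 q
  obtain ⟨y2, hy2R, hy2⟩ := (hR2.inter_nhds_nonempty h)
  have hy2R1 : ∀ q, M q y2 ≠ d q := fun q => hy2R (Sum.inl q)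
  have hy2R2 : ∀ q, M2 q y2 ≠ d2 q := fun q => hy2R (Sum.inr q)
  -- the line through both points is generic
  let p : ℝ → E := fun t => y1 + t • (y2 - y1)
  have hpc : Continuous p := by
    change Continuous fun t : ℝ => y1 + t • (y2 - y1)
    fun_prop
  have hgen : ∀ t k a a', l a ((A k).symm (p t - b k)) = c a →
      l a' ((A k).symm (p t - b k)) = c a' → ∃ t : ℝ, t ≠ 0 ∧ l a' = t • l a := by
    intro t k a a' h1 h2
    by_contra hq
    have h3 := hy2R2 ⟨(k, a, a'), hq⟩
    have hφp : ∀ a, φ k a (p t) = (1 - t) * φ k a y1 + t * φ k a y2 := by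
      intro a
      simp [φ, p]; ring
    have e1 : φ k a (p t) = 0 := by simp only [φ]; rw [hMd, h1, sub_self]
    have e2 : φ k a' (p t) = 0 := by simp only [φ]; rw [hMd, h2, sub_self]
    rw [hφp] at e1 e2
    have h4 : φ k a' y1 * φ k a y2 - φ k a y1 * φ k a' y2 ≠ 0 := by
      intro h0
      apply h3
      have : M2 ⟨(k, a, a'), hq⟩ y2 - d2 ⟨(k, a, a'), hq⟩ =
        φ k a' y1 * φ k a y2 - φ k a y1 * φ k a' y2 := by
        simp [M2, d2, φ]; ring
      linarith
    have ht : t * (φ k a' y1 * φ k a y2 - φ k a y1 * φ k a' y2) = 0 := by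
      linear_combination φ k a' y1 * e1 - φ k a y1 * e2
    have ht0 : t = 0 := (mul_eq_zero.1 ht).resolve_right h4
    subst ht0
    apply hφ1 k a
    linarith
  choose K hK using fun t => pa_local_const l c S C hl hC hcov hdisj A b hdet hglue (p t) (hgen t)
  have hlc : IsLocallyConstant K := by
    rw [IsLocallyConstant.iff_eventually_eq]
    intro t
    filter_upwards [hpc.continuousAt.eventually (hK t).eventually_nhds] with t' ht'
    obtain ⟨w, hwR, hw⟩ := hR.inter_nhds_nonempty (ht'.and (hK t'))
    rw [← hw.1 (hRreg w hwR), ← hw.2 (hRreg w hwR)]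
  have h01 : K 0 = K 1 := hlc.apply_eq_of_preconnectedSpace 0 1
  have hK0 : paCount C A b y1 = K 0 := by
    have := (hK 0).self_of_nhds
    simp only [p, zero_smul, add_zero] at this
    exact this (hRreg y1 hy1R)
  have hK1 : paCount C A b y2 = K 1 := by
    have := (hK 1).self_of_nhds
    simp only [p, one_smul, add_sub_cancel] at this
    exact this (hRreg y2 hy2R1)
  rw [← hy1, ← hy2, hK0, hK1, h01]

end PAHelpers

/-- If a piecewise affine map `f : ℝⁿ → ℝⁿ` has all Jacobians
positive and some regular value `y₀` has exactly one preimage, then every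
regular value has exactly one preimage. -/
theorem piecewise_affine_unique_fiber_propagates
    {n N : ℕ} (f : Eu n → Eu n) (F : Fin N → (Eu n →ᵃ[ℝ] Eu n))
    (C : Fin N → Set (Eu n)) (hpa : IsPiecewiseAffine f F C)
    (hJ : ∀ i, 0 < LinearMap.det (F i).linear)
    (y₀ : Eu n) (hy₀ : y₀ ∉ ⋃ i, f '' frontier (C i))
    (huniq : ∃! x : Eu n, f x = y₀) :
    ∀ y : Eu n, y ∉ (⋃ i, f '' frontier (C i)) → ∃! x : Eu n, f x = y := by
  classical
  intro y hy
  obtain ⟨hpoly, hne, hcov, hdisj, hf⟩ := hpa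
  choose m l c hC using hpoly
  have hcov' : ∀ x, ∃ k, x ∈ C k := fun x => by
    have : x ∈ ⋃ i, C i := hcov ▸ mem_univ x
    simpa using this
  let ι := {q : Σ i, Fin (m i) // l q.1 q.2 ≠ 0}
  let l' : ι → Eu n →L[ℝ] ℝ := fun q => LinearMap.toContinuousLinearMap (l q.1.1 q.1.2)
  let c' : ι → ℝ := fun q => c q.1.1 q.1.2
  let S : Fin N → Set ι := fun k => {q | q.1.1 = k}
  have hl' : ∀ a, l' a ≠ 0 := by
    intro a h0
    apply a.2
    ext v
    have := congrArg (fun g : Eu n →L[ℝ] ℝ => g v) h0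
    simpa [l'] using this
  have hC' : ∀ k, C k = {x | ∀ a ∈ S k, l' a x ≤ c' a} := by
    intro k
    obtain ⟨w, hw⟩ := hne k
    have hw := interior_subset hw
    ext x
    constructor
    · rintro hx ⟨⟨k', r⟩, hq⟩ hk
      have hk : k' = k := hk
      subst hk
      rw [hC] at hx
      exact hx r
    · intro hx
      rw [hC] at hw ⊢
      intro r
      by_cases h0 : l k r = 0
      · have := hw r
        rw [h0] at this ⊢
        exact this
      · exact hx ⟨⟨k, r⟩, h0⟩ rfl
  let A : Fin N → Eu n ≃L[ℝ] Eu n := fun k =>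
    (LinearEquiv.ofIsUnitDet (f := (F k).linear) (v := Module.finBasis ℝ (Eu n))
      (v' := Module.finBasis ℝ (Eu n))
      (by rw [LinearMap.det_toMatrix]; exact (hJ k).ne'.isUnit)).toContinuousLinearEquiv
  have hA : ∀ k v, A k v = (F k).linear v := fun k v => rfl
  let b : Fin N → Eu n := fun k => F k 0
  have hF : ∀ k x, F k x = A k x + b k := by
    intro k x
    rw [hA]
    have := congrFun (F k).decomp x
    simpa using this
  have hdet : ∀ k, 0 < LinearMap.det (A k : Eu n →ₗ[ℝ] Eu n) := by
    intro k
    have : (A k : Eu n →ₗ[ℝ] Eu n) = (F k).linear := by ext1 v; exact hA k v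
    rw [this]; exact hJ k
  have hglue : ∀ i j x, x ∈ C i → x ∈ C j → A i x + b i = A j x + b j := by
    intro i j x hi hj
    rw [← hF, ← hF, ← hf i x hi, ← hf j x hj]
  have hcl : ∀ k, IsClosed (C k) := fun k => by rw [hC']; exact pa_closed_s10 _ _ _
  have hG1 : ∀ k x, x ∈ C k → (A k).symm (f x - b k) = x := by
    intro k x hx
    rw [hf k x hx, hF]; simp
  have hG2 : ∀ k p, (A k).symm (p - b k) ∈ C k → f ((A k).symm (p - b k)) = p := by
    intro k p hp
    rw [hf k _ hp, hF]; simp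
  have hreg : ∀ p, p ∉ (⋃ i, f '' frontier (C i)) → ∀ k, ∀ x ∈ C k, f x = p →
      x ∈ interior (C k) := by
    intro p hp k x hx hfx
    by_contra hi
    apply hp
    rw [mem_iUnion]
    refine ⟨k, x, ?_, hfx⟩
    rw [(hcl k).frontier_eq]
    exact ⟨hx, hi⟩
  have hloc : ∀ p, p ∉ (⋃ i, f '' frontier (C i)) →
      ∀ᶠ q in 𝓝 p, paCount C A b q = paCount C A b p := by
    intro p hp
    have : ∀ k, ∀ᶠ q in 𝓝 p, ((A k).symm (q - b k) ∈ C k ↔ (A k).symm (p - b k) ∈ C k) := by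
      intro k
      have hc : Continuous fun q => (A k).symm (q - b k) := by fun_prop
      by_cases h : (A k).symm (p - b k) ∈ C k
      · have hi := hreg p hp k _ h (hG2 k p h)
        filter_upwards [(isOpen_interior.preimage hc).mem_nhds hi] with q hq
        exact ⟨fun _ => h, fun _ => interior_subset hq⟩
      · filter_upwards [((hcl k).isOpen_compl.preimage hc).mem_nhds h] with q hq
        exact ⟨fun h' => absurd h' hq, fun h' => absurd h' h⟩
    filter_upwards [eventually_all.2 this] with q hq
    unfold paCount
    simp only [hq]
  have heq := pa_const l' c' S C hl' hC' hcov' hdisj A b hdet hglue y₀ y _ _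
    (hloc y₀ hy₀) (hloc y hy)
  have h1 : paCount C A b y₀ = 1 := by
    obtain ⟨x, hx, hxu⟩ := huniq
    obtain ⟨i, hi⟩ := hcov' x
    unfold paCount
    rw [Finset.card_eq_one]
    refine ⟨i, ?_⟩
    ext k
    simp only [Finset.mem_filter, Finset.mem_univ, true_and, Finset.mem_singleton]
    constructor
    · intro hk
      have hkx := hxu _ (hG2 k y₀ hk)
      rw [hkx] at hk
      by_contra hne
      have h2 : x ∈ interior (C k) ∩ interior (C i) :=
        ⟨hreg y₀ hy₀ k x hk hx, hreg y₀ hy₀ i x hi hx⟩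
      rw [hdisj k i hne] at h2
      exact h2
    · rintro rfl
      have hx : f x = y₀ := hx
      rw [← hx, hG1 k x hi]
      exact hi
  rw [h1] at heq
  have h2 := heq.symm
  unfold paCount at h2
  rw [Finset.card_eq_one] at h2
  obtain ⟨i, hi⟩ := h2
  have hi' : ∀ k, (A k).symm (y - b k) ∈ C k ↔ k = i := by
    intro k
    have := Finset.ext_iff.1 hi k
    simpa using this
  refine ⟨(A i).symm (y - b i), hG2 i y ((hi' i).2 rfl), ?_⟩
  intro x hx
  have hx : f x = y := hx
  obtain ⟨k, hk⟩ := hcov' x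
  have hkx := hG1 k x hk
  rw [hx] at hkx
  have : k = i := (hi' k).1 (hkx ▸ hk)
  subst this
  exact hkx.symm
end

section
/- Let φ₁, φ₂ : ℝ² → ℝ each be a minimum of finitely many affine functions, and let f = (φ₁, φ₂) : ℝ² → ℝ². Suppose there exists ε ∈ {1, −1} such that at every point x ∈ ℝ² at which f is (Fréchet) differentiable, ε · det(Df(x)) > 0, where Df(x) is the derivative of f at x viewed as a 2×2 matrix. Then f is a homeomorphism of ℝ² onto ℝ². -/
/-- A function `ℝⁿ → ℝ` which is the minimum of a finite nonempty family of affine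
functions (a tropical polynomial function). -/
def IsMinOfAffine {n : ℕ} (φ : Eu n → ℝ) : Prop :=
  ∃ (k : ℕ) (A : Fin (k + 1) → (Eu n →ᵃ[ℝ] ℝ)), ∀ x, φ x = ⨅ i, A i x


open Filter Topology

lemma pigeon {α : Type*} [Finite α] (c : ℕ → α) : ∃ i, ∃ᶠ n in atTop, c n = i := by
  obtain ⟨i, hi⟩ := Finite.exists_infinite_fiber c
  refine ⟨i, ?_⟩
  rw [Nat.frequently_atTop_iff_infinite]
  exact Set.infinite_coe_iff.mp hi

lemma pick {α : Type*} [Finite α] (T : α → Set ℝ) (hT : ∀ i, IsClosed (T i))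
    (hcov : ∀ t, ∃ i, t ∈ T i) (x y : ℝ) (hy : x < y) :
    ∃ i s, x < s ∧ s ≤ y ∧ x ∈ T i ∧ s ∈ T i := by
  have hseq : ∀ n : ℕ, ∃ i, x + (y - x) / (n + 1 : ℝ) ∈ T i := fun n => hcov _
  choose c hc using hseq
  obtain ⟨i, hinf⟩ := pigeon c
  have hfr : ∃ᶠ n : ℕ in atTop, x + (y - x) / (n + 1 : ℝ) ∈ T i :=
    hinf.mono (fun n hn => hn ▸ hc n)
  have hlim : Tendsto (fun n : ℕ => x + (y - x) / (n + 1 : ℝ)) atTop (𝓝 x) := by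
    have h1 := (tendsto_one_div_add_atTop_nhds_zero_nat (𝕜 := ℝ)).const_mul (y - x)
    have h2 := h1.const_add x
    simpa [div_eq_mul_inv] using h2
  have hxT : x ∈ T i := (hT i).mem_of_frequently_of_tendsto hfr hlim
  obtain ⟨n, hn⟩ := hfr.exists
  have hpos : 0 < (y - x) / (n + 1 : ℝ) := div_pos (by linarith) (by positivity)
  have hle : (y - x) / (n + 1 : ℝ) ≤ y - x :=
    div_le_self (by linarith) (by linarith [(Nat.cast_nonneg n : (0:ℝ) ≤ n)])
  exact ⟨i, _, by linarith, by linarith, hxT, hn⟩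

/-- continuous and monotone on each piece of a finite closed cover -/
lemma mono_of_cover {α : Type*} [Finite α] (T : α → Set ℝ) (hT : ∀ i, IsClosed (T i))
    (hcov : ∀ t, ∃ i, t ∈ T i) (k : ℝ → ℝ) (hk : Continuous k)
    (hm : ∀ i, ∀ s ∈ T i, ∀ t ∈ T i, s ≤ t → k s ≤ k t) : ∀ s t, s ≤ t → k s ≤ k t := by
  intro a b hab
  have key : Set.Icc a b ⊆ {s | k a ≤ k s} := by
    apply IsClosed.Icc_subset_of_forall_exists_gt
    · exact (isClosed_le continuous_const hk).inter isClosed_Icc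
    · simp
    · rintro x ⟨hx, hxa, hxb⟩ y hy
      obtain ⟨i, s, h1, h2, hxT, hsT⟩ := pick T hT hcov x y hy
      exact ⟨s, le_trans hx (hm i _ hxT _ hsT h1.le), h1, h2⟩
  exact key ⟨hab, le_rfl⟩

lemma surj_of_expand (G : ℝ → ℝ) (hG : Continuous G) (m : ℝ) (hm : 0 < m)
    (h : ∀ s t, s ≤ t → m * (t - s) ≤ G t - G s) : Function.Surjective G := by
  apply hG.surjective
  · apply tendsto_atTop_mono' atTop (f₁ := fun t => m * t + G 0)
    · filter_upwards [eventually_ge_atTop 0] with t ht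
      have := h 0 t ht
      linarith
    · exact tendsto_atTop_add_const_right _ _ (tendsto_id.const_mul_atTop hm)
  · apply tendsto_atBot_mono' atBot (f₁ := fun t => m * t + G 0)
    · filter_upwards [eventually_le_atBot 0] with t ht
      have := h t 0 ht
      linarith
    · exact tendsto_atBot_add_const_right _ _ (tendsto_id.const_mul_atBot hm)

lemma fin_bound {ι : Type*} [Finite ι] (a : ι → ℝ) : ∃ L, 0 ≤ L ∧ ∀ i, |a i| ≤ L := by
  cases nonempty_fintype ι
  exact ⟨∑ i, |a i|, Finset.sum_nonneg (fun _ _ => abs_nonneg _), fun i =>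
    Finset.single_le_sum (f := fun i => |a i|) (fun _ _ => abs_nonneg _) (Finset.mem_univ i)⟩

lemma fin_pos {ι : Type*} [Finite ι] (a : ι → ℝ) : ∃ m, 0 < m ∧ ∀ i, 0 < a i → m ≤ a i := by
  obtain ⟨L, hL, h⟩ := fin_bound (fun i => (a i)⁻¹)
  refine ⟨(L + 1)⁻¹, by positivity, fun i hi => ?_⟩
  have := (le_abs_self _).trans (h i)
  rw [inv_le_comm₀ (by linarith) hi]
  linarith

lemma lip_of_min {ι : Type*} (a b c : ι → ℝ) (P : ℝ → ℝ → ℝ) (L : ℝ)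
    (ha : ∀ i, |a i| ≤ L) (hb : ∀ i, |b i| ≤ L)
    (hP : ∀ i s t, P s t ≤ a i * s + b i * t + c i)
    (hP' : ∀ s t, ∃ i, P s t = a i * s + b i * t + c i) (s t s' t' : ℝ) :
    |P s t - P s' t'| ≤ L * (|s - s'| + |t - t'|) := by
  have key : ∀ s t s' t', P s t - P s' t' ≤ L * (|s - s'| + |t - t'|) := by
    intro s t s' t'
    obtain ⟨i, hi⟩ := hP' s' t'
    have h1 := hP i s t
    have h2 : a i * (s - s') ≤ L * |s - s'| := by
      refine (le_abs_self _).trans ?_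
      rw [abs_mul]; exact mul_le_mul_of_nonneg_right (ha i) (abs_nonneg _)
    have h3 : b i * (t - t') ≤ L * |t - t'| := by
      refine (le_abs_self _).trans ?_
      rw [abs_mul]; exact mul_le_mul_of_nonneg_right (hb i) (abs_nonneg _)
    rw [hi]; linarith
  rw [abs_le]
  constructor
  · have := key s' t' s t
    rw [abs_sub_comm s', abs_sub_comm t'] at this
    linarith
  · exact key s t s' t'

lemma cont_of_lip (P : ℝ → ℝ → ℝ) (L : ℝ) (hL : 0 ≤ L)
    (h : ∀ s t s' t', |P s t - P s' t'| ≤ L * (|s - s'| + |t - t'|)) :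
    Continuous (fun z : ℝ × ℝ => P z.1 z.2) := by
  have : LipschitzWith (Real.toNNReal (2 * L)) (fun z : ℝ × ℝ => P z.1 z.2) := by
    apply LipschitzWith.of_dist_le_mul
    intro z z'
    rw [Real.coe_toNNReal _ (by linarith), Real.dist_eq]
    refine (h _ _ _ _).trans ?_
    have h1 : |z.1 - z'.1| ≤ dist z z' := by
      rw [Prod.dist_eq, ← Real.dist_eq]; exact le_max_left _ _
    have h2 : |z.2 - z'.2| ≤ dist z z' := by
      rw [Prod.dist_eq, ← Real.dist_eq]; exact le_max_right _ _
    nlinarith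
  exact this.continuous

lemma core {ι κ : Type*} [Finite ι] [Finite κ] (a b c : ι → ℝ) (a' b' c' : κ → ℝ)
    (P Q : ℝ → ℝ → ℝ)
    (hP : ∀ i s t, P s t ≤ a i * s + b i * t + c i)
    (hQ : ∀ i s t, Q s t ≤ a' i * s + b' i * t + c' i)
    (hcov : ∀ s t, ∃ i j, P s t = a i * s + b i * t + c i ∧ Q s t = a' j * s + b' j * t + c' j
      ∧ 0 < a i * b' j - b i * a' j)
    (hpos : ∀ i, 0 < a i) :
    ∃ F : (ℝ × ℝ) ≃ₜ (ℝ × ℝ), ∀ z, F z = (P z.1 z.2, Q z.1 z.2) := by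
  obtain ⟨L1, hL1, hL1'⟩ := fin_bound a
  obtain ⟨L2, hL2, hL2'⟩ := fin_bound b
  obtain ⟨L3, hL3, hL3'⟩ := fin_bound a'
  obtain ⟨L4, hL4, hL4'⟩ := fin_bound b'
  obtain ⟨L, hL, hPlip, hQlip⟩ : ∃ L, 0 ≤ L ∧
      (∀ s t s' t', |P s t - P s' t'| ≤ L * (|s - s'| + |t - t'|)) ∧
      (∀ s t s' t', |Q s t - Q s' t'| ≤ L * (|s - s'| + |t - t'|)) := by
    refine ⟨L1 + L2 + L3 + L4, by positivity, ?_, ?_⟩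
    · apply lip_of_min a b c P _ (fun i => (hL1' i).trans (by linarith))
        (fun i => (hL2' i).trans (by linarith)) hP
      intro s t
      obtain ⟨i, j, h, -⟩ := hcov s t
      exact ⟨i, h⟩
    · apply lip_of_min a' b' c' Q _ (fun i => (hL3' i).trans (by linarith))
        (fun i => (hL4' i).trans (by linarith)) hQ
      intro s t
      obtain ⟨i, j, -, h, -⟩ := hcov s t
      exact ⟨j, h⟩
  obtain ⟨m, hm, hma⟩ := fin_pos a
  obtain ⟨δ, hδ, hδ'⟩ := fin_pos (fun q : ι × κ => (a q.1 * b' q.2 - b q.1 * a' q.2) / a q.1)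
  have hPc := cont_of_lip P L hL hPlip
  have hQc := cont_of_lip Q L hL hQlip
  have hPm : ∀ t s s', s ≤ s' → m * (s' - s) ≤ P s' t - P s t := by
    intro t s s' h
    obtain ⟨i, j, h1, -⟩ := hcov s' t
    have h2 := hP i s t
    have h3 := hma i (hpos i)
    rw [h1]
    nlinarith
  have hPabs : ∀ t s s', m * |s' - s| ≤ |P s' t - P s t| := by
    intro t s s'
    rcases le_total s s' with h | h
    · rw [abs_of_nonneg (sub_nonneg.2 h)]
      exact (hPm t s s' h).trans (le_abs_self _)
    · rw [abs_sub_comm, abs_sub_comm (P s' t), abs_of_nonneg (sub_nonneg.2 h)]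
      exact (hPm t s' s h).trans (le_abs_self _)
  have hsol : ∀ p t, ∃ s, P s t = p := by
    intro p t
    exact surj_of_expand (fun s => P s t) (hPc.comp (Continuous.prodMk_left t)) m hm (hPm t) p
  choose σ hσ using hsol
  have hσuniq : ∀ s t, σ (P s t) t = s := by
    intro s t
    have := hPabs t s (σ (P s t) t)
    rw [hσ, sub_self, abs_zero] at this
    have h0 : |σ (P s t) t - s| ≤ 0 := by
      by_contra hh
      push Not at hh
      nlinarith [mul_pos hm hh]
    have := abs_nonpos_iff.1 h0
    linarith
  have hσlip : ∀ p t t', m * |σ p t - σ p t'| ≤ L * |t - t'| := by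
    intro p t t'
    refine (hPabs t' _ _).trans ?_
    have := hPlip (σ p t) t' (σ p t) t
    rw [hσ] at this ⊢
    simpa [abs_sub_comm] using this
  have hσc : ∀ p, Continuous (σ p) := by
    intro p
    have : LipschitzWith (Real.toNNReal (L / m)) (σ p) := by
      apply LipschitzWith.of_dist_le_mul
      intro t t'
      rw [Real.coe_toNNReal _ (by positivity), Real.dist_eq, Real.dist_eq, div_mul_eq_mul_div,
        le_div_iff₀ hm]
      linarith [hσlip p t t']
    exact this.continuous
  have hHc : ∀ p, Continuous (fun t => Q (σ p t) t) := by
    intro p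
    exact hQc.comp ((hσc p).prodMk continuous_id)
  have hHm : ∀ p t t', t ≤ t' → δ * (t' - t) ≤ Q (σ p t') t' - Q (σ p t) t := by
    intro p
    have := mono_of_cover (α := {q : ι × κ // 0 < a q.1 * b' q.2 - b q.1 * a' q.2})
      (fun q => {t | p = a q.1.1 * σ p t + b q.1.1 * t + c q.1.1} ∩
        {t | Q (σ p t) t = a' q.1.2 * σ p t + b' q.1.2 * t + c' q.1.2}) ?_ ?_
        (fun t => Q (σ p t) t - δ * t) ((hHc p).sub (by fun_prop)) ?_
    · intro t t' h
      have := this t t' h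
      linarith
    · intro q
      have := hσc p
      exact (isClosed_eq (by fun_prop) (by fun_prop)).inter (isClosed_eq (hHc p) (by fun_prop))
    · intro t
      obtain ⟨i, j, h1, h2, h3⟩ := hcov (σ p t) t
      rw [hσ] at h1
      exact ⟨⟨(i, j), h3⟩, h1, h2⟩
    · rintro ⟨⟨i, j⟩, hD⟩ s ⟨h1, h2⟩ t ⟨h3, h4⟩ hst
      simp only [Set.mem_ofPred_eq] at h1 h2 h3 h4 hD ⊢
      have h5 := hδ' (i, j) (div_pos hD (hpos i))
      simp only at h5
      rw [le_div_iff₀ (hpos i)] at h5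
      have h6 : a i * (Q (σ p t) t - Q (σ p s) s) = (a i * b' j - b i * a' j) * (t - s) := by
        rw [h2, h4]
        linear_combination a' j * (h1 - h3)
      have h7 : a i * (δ * (t - s)) ≤ a i * (Q (σ p t) t - Q (σ p s) s) := by
        rw [h6]; nlinarith
      have := le_of_mul_le_mul_left h7 (hpos i)
      linarith
  have hHabs : ∀ p t t', δ * |t' - t| ≤ |Q (σ p t') t' - Q (σ p t) t| := by
    intro p t t'
    rcases le_total t t' with h | h
    · rw [abs_of_nonneg (sub_nonneg.2 h)]
      exact (hHm p t t' h).trans (le_abs_self _)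
    · rw [abs_sub_comm, abs_sub_comm (Q (σ p t') t'), abs_of_nonneg (sub_nonneg.2 h)]
      exact (hHm p t' t h).trans (le_abs_self _)
  set F : ℝ × ℝ → ℝ × ℝ := fun z => (P z.1 z.2, Q z.1 z.2) with hF
  have hFc : Continuous F := hPc.prodMk hQc
  have hsurj : Function.Surjective F := by
    rintro ⟨p, q⟩
    obtain ⟨t, ht⟩ := surj_of_expand _ (hHc p) δ hδ (hHm p) q
    exact ⟨(σ p t, t), by simp only [hF, hσ]; simpa using ht⟩
  obtain ⟨K1, hK1, hT⟩ : ∃ K1, 0 ≤ K1 ∧ ∀ z z' : ℝ × ℝ, |z.2 - z'.2| ≤ K1 * dist (F z) (F z')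
      ∧ m * |z.1 - z'.1| ≤ (1 + L * K1) * dist (F z) (F z') := by
    refine ⟨(1 + L / m) / δ, by positivity, ?_⟩
    rintro ⟨s, t⟩ ⟨s', t'⟩
    set d := dist (F (s, t)) (F (s', t')) with hd
    have hd1 : |P s t - P s' t'| ≤ d := by
      rw [hd, Prod.dist_eq, ← Real.dist_eq]; exact le_max_left _ _
    have hd2 : |Q s t - Q s' t'| ≤ d := by
      rw [hd, Prod.dist_eq, ← Real.dist_eq]; exact le_max_right _ _
    simp only
    set r := σ (P s t) t' with hr
    have e1 : m * |r - s'| ≤ d := by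
      refine (hPabs t' _ _).trans ?_
      rw [hr, hσ]; exact hd1
    have e1' : |r - s'| ≤ d / m := by rw [le_div_iff₀ hm]; linarith
    have e2 : |Q r t' - Q s' t'| ≤ L * |r - s'| := by simpa using hQlip r t' s' t'
    have e3 : δ * |t - t'| ≤ |Q s t - Q r t'| := by
      have := hHabs (P s t) t' t
      rwa [hσuniq] at this
    have e4 : |Q s t - Q r t'| ≤ |Q s t - Q s' t'| + |Q r t' - Q s' t'| := by
      rw [abs_sub_comm (Q r t')]; exact abs_sub_le _ _ _
    have e5 : |t - t'| ≤ (1 + L / m) / δ * d := by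
      rw [div_mul_eq_mul_div, le_div_iff₀ hδ]
      have : L * |r - s'| ≤ L * (d / m) := mul_le_mul_of_nonneg_left e1' hL
      have e : (1 + L / m) * d = d + L * (d / m) := by ring
      rw [e]; linarith
    refine ⟨e5, ?_⟩
    have e6 : m * |s - r| ≤ L * |t - t'| := by
      have := hσlip (P s t) t t'
      rwa [hσuniq] at this
    have e7 := abs_sub_le s r s'
    have e8 := mul_le_mul_of_nonneg_left e5 hL
    nlinarith
  have hanti : AntilipschitzWith (Real.toNNReal (K1 + (1 + L * K1) / m)) F := by
    apply AntilipschitzWith.of_le_mul_dist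
    intro z z'
    rw [Real.coe_toNNReal _ (by positivity)]
    obtain ⟨h1, h2⟩ := hT z z'
    have h3 : |z.1 - z'.1| ≤ (1 + L * K1) / m * dist (F z) (F z') := by
      rw [div_mul_eq_mul_div, le_div_iff₀ hm]; linarith
    have h4 : 0 ≤ (1 + L * K1) / m * dist (F z) (F z') := by positivity
    have h5 : 0 ≤ K1 * dist (F z) (F z') := by positivity
    rw [Prod.dist_eq, Real.dist_eq, Real.dist_eq, add_mul]
    apply max_le <;> linarith
  let E := Equiv.ofBijective F ⟨hanti.injective, hsurj⟩
  have hEi : Continuous E.symm := (hanti.to_rightInverse (E.apply_symm_apply)).continuous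
  exact ⟨⟨E, hFc, hEi⟩, fun z => rfl⟩

lemma cont_min {τ : Type*} [Finite τ] (a b : τ → ℝ) (p : ℝ → ℝ → ℝ)
    (h1 : ∀ i s t, p s t ≤ a i * s + b i * t) (h2 : ∀ s t, ∃ i, p s t = a i * s + b i * t) :
    Continuous (fun z : ℝ × ℝ => p z.1 z.2) := by
  obtain ⟨L1, hL1, hL1'⟩ := fin_bound a
  obtain ⟨L2, hL2, hL2'⟩ := fin_bound b
  apply cont_of_lip p (L1 + L2) (by positivity)
  exact lip_of_min a b (fun _ => 0) p _ (fun i => (hL1' i).trans (by linarith))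
      (fun i => (hL2' i).trans (by linarith)) (by simpa using h1) (by simpa using h2)

lemma hom_min {τ : Type*} (a b : τ → ℝ) (p : ℝ → ℝ → ℝ)
    (h1 : ∀ i s t, p s t ≤ a i * s + b i * t) (h2 : ∀ s t, ∃ i, p s t = a i * s + b i * t)
    (r s t : ℝ) (hr : 0 < r) : p (r * s) (r * t) = r * p s t := by
  apply le_antisymm
  · obtain ⟨i, hi⟩ := h2 s t
    rw [hi]; linarith [h1 i (r * s) (r * t)]
  · obtain ⟨i, hi⟩ := h2 (r * s) (r * t)
    rw [hi]
    have := mul_le_mul_of_nonneg_left (h1 i s t) hr.le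
    linarith

lemma exists_dir {ι κ : Type*} [Finite ι] [Finite κ] (a b : ι → ℝ) (a' b' : κ → ℝ)
    (p q : ℝ → ℝ → ℝ) (ε : ℝ)
    (hp : ∀ i s t, p s t ≤ a i * s + b i * t)
    (hq : ∀ i s t, q s t ≤ a' i * s + b' i * t)
    (hcov : ∀ s t, ∃ i j, p s t = a i * s + b i * t ∧ q s t = a' j * s + b' j * t
      ∧ 0 < ε * (a i * b' j - b i * a' j)) :
    ∃ v w, 0 < p v w := by
  by_contra hcon
  push Not at hcon
  have hp' : ∀ s t, ∃ i, p s t = a i * s + b i * t := fun s t => by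
    obtain ⟨i, j, h, -⟩ := hcov s t
    exact ⟨i, h⟩
  have hq' : ∀ s t, ∃ i, q s t = a' i * s + b' i * t := fun s t => by
    obtain ⟨i, j, -, h, -⟩ := hcov s t
    exact ⟨j, h⟩
  have hpc := cont_min a b p hp hp'
  have hqc := cont_min a' b' q hq hq'
  have hph := hom_min a b p hp hp'
  have hqh := hom_min a' b' q hq hq'
  have loc : ∀ x y u u' : ℝ, ∃ D r : ℝ, 0 < D ∧ 0 < r ∧
      ε * (p x y * q (x + r * u) (y + r * u') - q x y * p (x + r * u) (y + r * u'))
        = D * r * (x * u' - y * u) := by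
    intro x y u u'
    obtain ⟨⟨⟨i, j⟩, hD⟩, r, hr, -, ⟨h1, h2⟩, h3, h4⟩ :=
      pick (α := {k : ι × κ // 0 < ε * (a k.1 * b' k.2 - b k.1 * a' k.2)})
        (fun k => {r | p (x + r * u) (y + r * u') = a k.1.1 * (x + r * u) + b k.1.1 * (y + r * u')}
          ∩ {r | q (x + r * u) (y + r * u') = a' k.1.2 * (x + r * u) + b' k.1.2 * (y + r * u')})
        (by
          intro k
          have hl : Continuous (fun r : ℝ => (x + r * u, y + r * u')) := by fun_prop
          exact (isClosed_eq (hpc.comp hl) (by fun_prop)).inter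
            (isClosed_eq (hqc.comp hl) (by fun_prop)))
        (by
          intro r
          obtain ⟨i, j, h1, h2, h3⟩ := hcov (x + r * u) (y + r * u')
          exact ⟨⟨(i, j), h3⟩, h1, h2⟩) 0 1 one_pos
    simp only [Set.mem_ofPred_eq, zero_mul, add_zero] at h1 h2 h3 h4 hD
    refine ⟨_, r, hD, hr, ?_⟩
    rw [h1, h2, h3, h4]
    ring
  have sq : ∀ x y : ℝ, (x, y) ≠ 0 → 0 < x * x + y * y := by
    intro x y h
    by_contra hh
    push Not at hh
    apply h
    have hx : x = 0 := by nlinarith [mul_self_nonneg x, mul_self_nonneg y]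
    have hy : y = 0 := by nlinarith [mul_self_nonneg x, mul_self_nonneg y]
    simp [hx, hy]
  have both : ∀ x y : ℝ, (x, y) ≠ 0 →
      (∃ s t, 0 < p x y * q s t - q x y * p s t) ∧ (∃ s t, p x y * q s t - q x y * p s t < 0) := by
    intro x y h
    have hs := sq x y h
    obtain ⟨D, r, hD, hr, h1⟩ := loc x y (-y) x
    obtain ⟨D', r', hD', hr', h2⟩ := loc x y y (-x)
    have h3 : 0 < D * r * (x * x - y * (-y)) := by
      have := mul_pos (mul_pos hD hr) hs
      linarith
    have h4 : D' * r' * (x * (-x) - y * y) < 0 := by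
      have := mul_pos (mul_pos hD' hr') hs
      linarith
    rw [← h1] at h3
    rw [← h2] at h4
    rcases lt_trichotomy ε 0 with he | he | he
    · exact ⟨⟨_, _, by nlinarith only [h4, he]⟩, ⟨_, _, by nlinarith only [h3, he]⟩⟩
    · simp [he] at h3
    · exact ⟨⟨_, _, pos_of_mul_pos_right h3 he.le⟩,
        ⟨_, _, by nlinarith only [h4, he]⟩⟩
  have hneg : ∀ x y : ℝ, (x, y) ≠ 0 → p x y < 0 := by
    intro x y h
    refine lt_of_le_of_ne (hcon x y) (fun h0 => ?_)
    obtain ⟨⟨s, t, h1⟩, ⟨s', t', h2⟩⟩ := both x y h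
    have h3 := hcon s t
    have h4 := hcon s' t'
    rw [h0] at h1 h2
    rcases le_total 0 (q x y) with h5 | h5
    · nlinarith
    · nlinarith
  obtain ⟨z, hz, hmax⟩ := (isCompact_sphere (0 : ℝ × ℝ) 1).exists_isMaxOn
    ⟨(1, 0), by simp [Prod.norm_def]⟩
    (f := fun z : ℝ × ℝ => q z.1 z.2 / p z.1 z.2)
    (hqc.continuousOn.div hpc.continuousOn (fun z hz => by
      apply (hneg z.1 z.2 _).ne
      rintro h0
      have : z = 0 := h0
      simp [this] at hz))
  have hz0 : (z.1, z.2) ≠ (0 : ℝ × ℝ) := by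
    intro h0
    have : z = 0 := h0
    simp [this] at hz
  obtain ⟨⟨s, t, h1⟩, -⟩ := both z.1 z.2 hz0
  have hst : (s, t) ≠ (0 : ℝ × ℝ) := by
    intro h0
    simp only [Prod.mk_eq_zero] at h0
    obtain ⟨i, hi⟩ := hp' s t
    obtain ⟨j, hj⟩ := hq' s t
    rw [hi, hj, h0.1, h0.2] at h1
    simp at h1
  have hn : 0 < ‖(s, t)‖ := norm_pos_iff.2 hst
  have hmem : (‖(s, t)‖⁻¹ • (s, t) : ℝ × ℝ) ∈ Metric.sphere (0 : ℝ × ℝ) 1 := by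
    rw [mem_sphere_zero_iff_norm, norm_smul, norm_inv, norm_norm, inv_mul_cancel₀ hn.ne']
  have h2 := hmax hmem
  simp only [Set.mem_ofPred_eq, Prod.smul_mk, smul_eq_mul] at h2
  rw [hph _ _ _ (inv_pos.2 hn), hqh _ _ _ (inv_pos.2 hn),
    mul_div_mul_left _ _ (inv_pos.2 hn).ne'] at h2
  have h3 := hneg _ _ hz0
  have h4 := hneg _ _ hst
  rw [div_le_iff_of_neg h4, div_mul_eq_mul_div, div_le_iff_of_neg h3] at h2
  linarith

lemma fin_min {ι : Type*} [Finite ι] [Nonempty ι] (g : ι → ℝ) :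
    (∀ i, (⨅ k, g k) ≤ g i) ∧ ∃ i, (⨅ k, g k) = g i :=
  ⟨fun i => ciInf_le (Set.finite_range g).bddBelow i,
    let ⟨i, hi⟩ := exists_eq_ciInf_of_finite (f := g); ⟨i, hi.symm⟩⟩

lemma main_coord {ι κ : Type*} [Finite ι] [Finite κ] [Nonempty ι] [Nonempty κ]
    (a b c : ι → ℝ) (a' b' c' : κ → ℝ)
    (P Q : ℝ → ℝ → ℝ) (ε : ℝ) (hε : ε = 1 ∨ ε = -1)
    (hP : ∀ i s t, P s t ≤ a i * s + b i * t + c i)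
    (hQ : ∀ i s t, Q s t ≤ a' i * s + b' i * t + c' i)
    (hcov : ∀ s t, ∃ i j, P s t = a i * s + b i * t + c i ∧ Q s t = a' j * s + b' j * t + c' j
      ∧ 0 < ε * (a i * b' j - b i * a' j)) :
    ∃ F : (ℝ × ℝ) ≃ₜ (ℝ × ℝ), ∀ z, F z = (P z.1 z.2, Q z.1 z.2) := by
  have lim : ∀ A B C A' B' C' s t : ℝ,
      (∃ᶠ n : ℕ in atTop, A * (n * s) + B * (n * t) + C ≤ A' * (n * s) + B' * (n * t) + C') →
      A * s + B * t ≤ A' * s + B' * t := by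
    intro A B C A' B' C' s t h
    by_contra hlt
    push Not at hlt
    obtain ⟨N, hN⟩ := exists_nat_gt ((C' - C) / (A * s + B * t - (A' * s + B' * t)))
    obtain ⟨n, hn, hle⟩ := (h.and_eventually (eventually_ge_atTop N)).exists
    rw [div_lt_iff₀ (by linarith)] at hN
    have h1 : (N : ℝ) ≤ n := by exact_mod_cast hle
    have h2 := mul_le_mul_of_nonneg_right h1 (sub_nonneg.2 hlt.le)
    linarith
  have hcov' : ∀ s t, ∃ i j, (∀ k, a i * s + b i * t ≤ a k * s + b k * t) ∧
      (∀ k, a' j * s + b' j * t ≤ a' k * s + b' k * t) ∧ 0 < ε * (a i * b' j - b i * a' j) := by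
    intro s t
    have := fun n : ℕ => hcov (n * s) (n * t)
    choose I J h1 h2 h3 using this
    obtain ⟨⟨i, j⟩, hf⟩ := pigeon (fun n => (I n, J n))
    refine ⟨i, j, fun k => ?_, fun k => ?_, ?_⟩
    · apply lim _ _ (c i) _ _ (c k)
      refine hf.mono (fun n hn => ?_)
      obtain ⟨e1, e2⟩ := Prod.mk.inj hn
      have := hP k (n * s) (n * t)
      rwa [h1 n, e1] at this
    · apply lim _ _ (c' j) _ _ (c' k)
      refine hf.mono (fun n hn => ?_)
      obtain ⟨e1, e2⟩ := Prod.mk.inj hn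
      have := hQ k (n * s) (n * t)
      rwa [h2 n, e2] at this
    · obtain ⟨n, hn⟩ := hf.exists
      obtain ⟨e1, e2⟩ := Prod.mk.inj hn
      have := h3 n
      rwa [e1, e2] at this
  obtain ⟨v, w, hvw⟩ := exists_dir a b a' b' (fun s t => ⨅ i, (a i * s + b i * t))
    (fun s t => ⨅ i, (a' i * s + b' i * t)) ε
    (fun i s t => (fin_min (fun i => a i * s + b i * t)).1 i)
    (fun i s t => (fin_min (fun i => a' i * s + b' i * t)).1 i)
    (by
      intro s t
      obtain ⟨i, j, h1, h2, h3⟩ := hcov' s t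
      exact ⟨i, j, le_antisymm ((fin_min (fun i => a i * s + b i * t)).1 i) (le_ciInf h1),
        le_antisymm ((fin_min (fun i => a' i * s + b' i * t)).1 j) (le_ciInf h2), h3⟩)
  have hpos : ∀ i, 0 < a i * v + b i * w := fun i =>
    lt_of_lt_of_le hvw ((fin_min (fun i => a i * v + b i * w)).1 i)
  have hN : 0 < v * v + w * w := by
    by_contra hh
    push Not at hh
    have hx : v = 0 := by nlinarith [mul_self_nonneg v, mul_self_nonneg w]
    have hy : w = 0 := by nlinarith [mul_self_nonneg v, mul_self_nonneg w]
    obtain ⟨i⟩ := ‹Nonempty ι›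
    have := hpos i
    simp [hx, hy] at this
  have hεε : ε * ε = 1 := by rcases hε with h | h <;> simp [h]
  obtain ⟨F, hF⟩ := core (fun i => a i * v + b i * w) (fun i => ε * (b i * v - a i * w)) c
    (fun i => a' i * v + b' i * w) (fun i => ε * (b' i * v - a' i * w)) c'
    (fun s t => P (v * s - ε * w * t) (w * s + ε * v * t))
    (fun s t => Q (v * s - ε * w * t) (w * s + ε * v * t))
    (fun i s t => (hP i _ _).trans (le_of_eq (by ring)))
    (fun i s t => (hQ i _ _).trans (le_of_eq (by ring)))
    (by
      intro s t
      obtain ⟨i, j, h1, h2, h3⟩ := hcov (v * s - ε * w * t) (w * s + ε * v * t)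
      refine ⟨i, j, h1.trans (by ring), h2.trans (by ring), ?_⟩
      have := mul_pos hN h3
      linarith) hpos
  have hN0 : v ^ 2 + w ^ 2 ≠ 0 := by rw [pow_two, pow_two]; exact hN.ne'
  let G : (ℝ × ℝ) ≃ₜ (ℝ × ℝ) :=
    { toFun := fun z => ((v * z.1 + w * z.2) / (v * v + w * w),
        ε * (v * z.2 - w * z.1) / (v * v + w * w))
      invFun := fun z => (v * z.1 - ε * w * z.2, w * z.1 + ε * v * z.2)
      left_inv := by
        intro z
        ext
        · simp only
          field_simp
          linear_combination (-w * (v * z.2 - w * z.1)) * hεε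
        · simp only
          field_simp
          linear_combination (v * (v * z.2 - w * z.1)) * hεε
      right_inv := by
        intro z
        ext
        · simp only
          field_simp
          ring
        · simp only
          field_simp
          linear_combination ((v * v + w * w) * z.2) * hεε
      continuous_toFun := by fun_prop
      continuous_invFun := by fun_prop }
  refine ⟨G.trans F, fun z => ?_⟩
  have h := G.symm_apply_apply z
  have h1 : v * (G z).1 - ε * w * (G z).2 = z.1 := congrArg Prod.fst h
  have h2 : w * (G z).1 + ε * v * (G z).2 = z.2 := congrArg Prod.snd h
  rw [Homeomorph.trans_apply, hF, h1, h2]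

lemma affine_coord (A : Eu 2 →ᵃ[ℝ] ℝ) : ∃ a b c : ℝ, ∀ x : Eu 2, A x = a * x 0 + b * x 1 + c := by
  refine ⟨A.linear (EuclideanSpace.single 0 1), A.linear (EuclideanSpace.single 1 1), A 0, ?_⟩
  intro x
  have h1 : A x = A.linear x + A 0 := by
    have := A.map_vadd 0 x
    simpa using this
  have h2 : x = x 0 • EuclideanSpace.single 0 (1 : ℝ) + x 1 • EuclideanSpace.single 1 (1 : ℝ) := by
    ext i
    fin_cases i <;> simp
  rw [h1]
  conv_lhs => rw [h2]
  simp [mul_comm]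

lemma dense_ne (a b c : ℝ) (h : ¬ (a = 0 ∧ b = 0 ∧ c = 0)) :
    Dense {x : Eu 2 | a * x 0 + b * x 1 + c ≠ 0} := by
  obtain ⟨y, hy⟩ : ∃ y : Eu 2, a * y 0 + b * y 1 + c ≠ 0 := by
    by_contra hh
    push Not at hh
    have h0 := hh !₂[0, 0]
    have h1 := hh !₂[1, 0]
    have h2 := hh !₂[0, 1]
    simp at h0 h1 h2
    apply h
    refine ⟨by linarith, by linarith, h0⟩
  intro x
  by_cases hx : a * x 0 + b * x 1 + c = 0
  · have hlim : Tendsto (fun n : ℕ => x + (1 / ((n : ℝ) + 1)) • (y - x)) atTop (𝓝 x) := by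
      have h1 := (tendsto_one_div_add_atTop_nhds_zero_nat (𝕜 := ℝ)).smul_const (y - x)
      simpa using h1.const_add x
    refine mem_closure_of_tendsto hlim (Eventually.of_forall fun n => ?_)
    have hn : (0 : ℝ) < 1 / ((n : ℝ) + 1) := by positivity
    generalize 1 / ((n : ℝ) + 1) = r at hn
    have : a * (x + r • (y - x)) 0 + b * (x + r • (y - x)) 1 + c
        = r * (a * y 0 + b * y 1 + c) := by
      simp
      linear_combination (1 - r) * hx
    show _ ≠ _
    rw [this]
    exact mul_ne_zero hn.ne' hy
  · exact subset_closure hx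

/-- at a generic point the minimum is locally a single affine function -/
lemma locally_single {ι : Type*} [Finite ι] [Nonempty ι] (a b c : ι → ℝ) (x : Eu 2)
    (hx : ∀ i j, ¬ (a i - a j = 0 ∧ b i - b j = 0 ∧ c i - c j = 0) →
      (a i - a j) * x 0 + (b i - b j) * x 1 + (c i - c j) ≠ 0) :
    ∃ i, ∀ᶠ y : Eu 2 in 𝓝 x,
      (⨅ k, (a k * y 0 + b k * y 1 + c k)) = a i * y 0 + b i * y 1 + c i := by
  obtain ⟨hle, i, hi⟩ := fin_min (fun k => a k * x 0 + b k * x 1 + c k)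
  refine ⟨i, ?_⟩
  have : ∀ k, ∀ᶠ y : Eu 2 in 𝓝 x, a i * y 0 + b i * y 1 + c i ≤ a k * y 0 + b k * y 1 + c k := by
    intro k
    by_cases hk : a i - a k = 0 ∧ b i - b k = 0 ∧ c i - c k = 0
    · obtain ⟨h1, h2, h3⟩ := hk
      refine Eventually.of_forall fun y => ?_
      rw [sub_eq_zero.1 h1, sub_eq_zero.1 h2, sub_eq_zero.1 h3]
    · have h1 := hx i k hk
      have h2 := hle k
      rw [hi] at h2
      simp only at h2
      have h3 : a i * x 0 + b i * x 1 + c i < a k * x 0 + b k * x 1 + c k := by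
        refine lt_of_le_of_ne h2 (fun h => h1 ?_)
        linarith
      have c1 : Continuous (fun y : Eu 2 => a i * y 0 + b i * y 1 + c i) := by fun_prop
      have c2 : Continuous (fun y : Eu 2 => a k * y 0 + b k * y 1 + c k) := by fun_prop
      filter_upwards [c1.continuousAt.eventually_lt c2.continuousAt h3] with y hy using hy.le
  filter_upwards [eventually_all.2 this] with y hy
  exact le_antisymm ((fin_min (fun k => a k * y 0 + b k * y 1 + c k)).1 i) (le_ciInf hy)

lemma deriv_det (f : Eu 2 → Eu 2) (x : Eu 2) (a b c a' b' c' : ℝ)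
    (h0 : ∀ᶠ y in 𝓝 x, f y 0 = a * y 0 + b * y 1 + c)
    (h1 : ∀ᶠ y in 𝓝 x, f y 1 = a' * y 0 + b' * y 1 + c') :
    DifferentiableAt ℝ f x ∧ LinearMap.det (fderiv ℝ f x).toLinearMap = a * b' - b * a' := by
  let B := (EuclideanSpace.basisFun (Fin 2) ℝ).toBasis
  let M : Eu 2 →ₗ[ℝ] Eu 2 := Matrix.toLin B B !![a, b; a', b']
  have hM : ∀ y, M y = !₂[a * y 0 + b * y 1, a' * y 0 + b' * y 1] := by
    intro y
    ext i
    fin_cases i <;> simp [M, B, Matrix.toLin_apply, Matrix.mulVec, dotProduct, Fin.sum_univ_two, EuclideanSpace.basisFun_repr]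
  have hd : HasFDerivAt (fun y => LinearMap.toContinuousLinearMap M y + !₂[c, c'])
      (LinearMap.toContinuousLinearMap M) x :=
    (LinearMap.toContinuousLinearMap M).hasFDerivAt.add_const _
  have heq : f =ᶠ[𝓝 x] (fun y => LinearMap.toContinuousLinearMap M y + !₂[c, c']) := by
    filter_upwards [h0, h1] with y e0 e1
    ext i
    fin_cases i <;> simp [hM, e0, e1]
  have hd' := hd.congr_of_eventuallyEq heq
  refine ⟨hd'.differentiableAt, ?_⟩
  rw [hd'.fderiv]
  have : ((LinearMap.toContinuousLinearMap M : Eu 2 →L[ℝ] Eu 2) : Eu 2 →ₗ[ℝ] Eu 2) = M := by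
    ext; simp
  rw [this]
  simp only [M, LinearMap.det_toLin, Matrix.det_fin_two_of]

/-- strong tropical Jacobian conjecture in the plane.
If `f = (φ₁, φ₂) : ℝ² → ℝ²` with `φ₁, φ₂` minima of finitely many affine functions,
and all Jacobians of `f` at points of differentiability have the same sign
(`ε · det Df(x) > 0` for a fixed sign `ε ∈ {1, −1}`), then `f` is a homeomorphism
of `ℝ²` onto `ℝ²`. -/
theorem tropical_polynomial_plane_jacobian
    (φ₁ φ₂ : Eu 2 → ℝ) (h₁ : IsMinOfAffine φ₁) (h₂ : IsMinOfAffine φ₂)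
    (f : Eu 2 → Eu 2) (hf : ∀ x : Eu 2, f x 0 = φ₁ x ∧ f x 1 = φ₂ x)
    (hε : ∃ ε : ℝ, (ε = 1 ∨ ε = -1) ∧
      ∀ x : Eu 2, DifferentiableAt ℝ f x →
        0 < ε * LinearMap.det (fderiv ℝ f x).toLinearMap) :
    ∃ g : Eu 2 ≃ₜ Eu 2, ⇑g = f := by
  obtain ⟨ε, hε, hdet⟩ := hε
  obtain ⟨k₁, A₁, hA₁⟩ := h₁
  obtain ⟨k₂, A₂, hA₂⟩ := h₂
  choose a b c hA using fun i => affine_coord (A₁ i)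
  choose a' b' c' hA' using fun i => affine_coord (A₂ i)
  simp only [hA] at hA₁
  simp only [hA'] at hA₂
  have hm₁ := fun x : Eu 2 => fin_min (fun i => a i * x 0 + b i * x 1 + c i)
  have hm₂ := fun x : Eu 2 => fin_min (fun i => a' i * x 0 + b' i * x 1 + c' i)
  simp only [← hA₁] at hm₁
  simp only [← hA₂] at hm₂
  have contmin : ∀ {k : ℕ} (a b c : Fin (k + 1) → ℝ),
      Continuous (fun x : Eu 2 => ⨅ i, (a i * x 0 + b i * x 1 + c i)) := by
    intro k a b c
    have : (fun x : Eu 2 => ⨅ i, (a i * x 0 + b i * x 1 + c i)) =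
        fun x => Finset.univ.inf' Finset.univ_nonempty (fun i => a i * x 0 + b i * x 1 + c i) := by
      funext x
      rw [Finset.inf'_univ_eq_ciInf]
    rw [this]
    exact Continuous.finset_inf'_apply _ (fun i _ => by fun_prop)
  have hφ₁ : Continuous φ₁ := by
    rw [funext hA₁]; exact contmin a b c
  have hφ₂ : Continuous φ₂ := by
    rw [funext hA₂]; exact contmin a' b' c'
  have gen : ∀ {k : ℕ} (a b c : Fin (k + 1) → ℝ),
      IsOpen {x : Eu 2 | ∀ i j, ¬ (a i - a j = 0 ∧ b i - b j = 0 ∧ c i - c j = 0) →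
      (a i - a j) * x 0 + (b i - b j) * x 1 + (c i - c j) ≠ 0} ∧
      Dense {x : Eu 2 | ∀ i j, ¬ (a i - a j = 0 ∧ b i - b j = 0 ∧ c i - c j = 0) →
      (a i - a j) * x 0 + (b i - b j) * x 1 + (c i - c j) ≠ 0} := by
    intro k a b c
    let S : Fin (k + 1) × Fin (k + 1) → Set (Eu 2) := fun q =>
      {x | ¬ (a q.1 - a q.2 = 0 ∧ b q.1 - b q.2 = 0 ∧ c q.1 - c q.2 = 0) →
      (a q.1 - a q.2) * x 0 + (b q.1 - b q.2) * x 1 + (c q.1 - c q.2) ≠ 0}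
    have hS : {x : Eu 2 | ∀ i j, ¬ (a i - a j = 0 ∧ b i - b j = 0 ∧ c i - c j = 0) →
      (a i - a j) * x 0 + (b i - b j) * x 1 + (c i - c j) ≠ 0} = ⋂ q, S q := by
      ext x
      rw [Set.mem_iInter]
      exact ⟨fun h q => h q.1 q.2, fun h i j => h (i, j)⟩
    have hSS : ∀ q, IsOpen (S q) ∧ Dense (S q) := by
      intro q
      by_cases hq : a q.1 - a q.2 = 0 ∧ b q.1 - b q.2 = 0 ∧ c q.1 - c q.2 = 0
      · have : S q = Set.univ := Set.eq_univ_of_forall (fun x h => absurd hq h)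
        rw [this]; exact ⟨isOpen_univ, dense_univ⟩
      · have : S q = {x : Eu 2 | (a q.1 - a q.2) * x 0 + (b q.1 - b q.2) * x 1
            + (c q.1 - c q.2) ≠ 0} := by
          ext x
          exact ⟨fun h => h hq, fun h _ => h⟩
        rw [this]
        exact ⟨isOpen_ne_fun (by fun_prop) (by fun_prop), dense_ne _ _ _ hq⟩
    rw [hS]
    exact ⟨isOpen_iInter_of_finite (fun q => (hSS q).1),
      dense_iInter_of_isOpen (fun q => (hSS q).1) (fun q => (hSS q).2)⟩
  have hcl : ∀ x : Eu 2, x ∈ ⋃ q : {q : Fin (k₁ + 1) × Fin (k₂ + 1) //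
      0 < ε * (a q.1 * b' q.2 - b q.1 * a' q.2)},
      {x : Eu 2 | φ₁ x = a q.1.1 * x 0 + b q.1.1 * x 1 + c q.1.1} ∩
      {x : Eu 2 | φ₂ x = a' q.1.2 * x 0 + b' q.1.2 * x 1 + c' q.1.2} := by
    have hdense := (gen a b c).2.inter_of_isOpen_left (gen a' b' c').2 (gen a b c).1
    intro x
    have hclosed : IsClosed (⋃ q : {q : Fin (k₁ + 1) × Fin (k₂ + 1) //
      0 < ε * (a q.1 * b' q.2 - b q.1 * a' q.2)},
      {x : Eu 2 | φ₁ x = a q.1.1 * x 0 + b q.1.1 * x 1 + c q.1.1} ∩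
      {x : Eu 2 | φ₂ x = a' q.1.2 * x 0 + b' q.1.2 * x 1 + c' q.1.2}) :=
      isClosed_iUnion_of_finite (fun q =>
        (isClosed_eq hφ₁ (by fun_prop)).inter (isClosed_eq hφ₂ (by fun_prop)))
    refine closure_minimal ?_ hclosed (hdense x)
    rintro y ⟨hy1, hy2⟩
    obtain ⟨i, hi⟩ := locally_single a b c y hy1
    obtain ⟨j, hj⟩ := locally_single a' b' c' y hy2
    simp only [← hA₁] at hi
    simp only [← hA₂] at hj
    obtain ⟨hd, hd'⟩ := deriv_det f y (a i) (b i) (c i) (a' j) (b' j) (c' j)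
      (hi.mono fun z hz => (hf z).1.trans hz) (hj.mono fun z hz => (hf z).2.trans hz)
    have := hdet y hd
    rw [hd'] at this
    exact Set.mem_iUnion.2 ⟨⟨(i, j), this⟩, hi.self_of_nhds, hj.self_of_nhds⟩
  obtain ⟨F, hF⟩ := main_coord a b c a' b' c' (fun s t => φ₁ !₂[s, t]) (fun s t => φ₂ !₂[s, t])
    ε hε (fun i s t => by simpa using (hm₁ !₂[s, t]).1 i)
    (fun i s t => by simpa using (hm₂ !₂[s, t]).1 i)
    (by
      intro s t
      obtain ⟨⟨⟨i, j⟩, hD⟩, h1, h2⟩ := Set.mem_iUnion.1 (hcl !₂[s, t])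
      exact ⟨i, j, by simpa using h1, by simpa using h2, hD⟩)
  let G : Eu 2 ≃ₜ ℝ × ℝ :=
    { toFun := fun x => (x 0, x 1)
      invFun := fun z => !₂[z.1, z.2]
      left_inv := by
        intro x
        ext i
        fin_cases i <;> simp
      right_inv := by
        intro z
        simp
      continuous_toFun := by fun_prop
      continuous_invFun := by fun_prop }
  refine ⟨(G.trans F).trans G.symm, ?_⟩
  funext x
  have hx : !₂[(G x).1, (G x).2] = x := G.symm_apply_apply x
  have e : ((G.trans F).trans G.symm) x = G.symm (F (G x)) := rfl
  rw [e, hF, hx]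
  apply G.injective
  rw [G.apply_symm_apply]
  exact (Prod.ext (hf x).1 (hf x).2).symm
end
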